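/- Let (W, S) be a finite Coxeter system with longest element w₀, fix a reduced word ω₀ for w₀, and let ≼ be the partial order on square-equivalence classes of maximal chains of the right weak order generated by increasing polygon moves with respect to heap(ω₀). Then for square-equivalence classes [C] and [C'], one has [C] ⋖ [C'] (a covering relation of ≼) if and only if inv_{ω₀}(C') = inv_{ω₀}(C) ∪ {D} for some non-commutative maximal dihedral reflection subgroup D with D ∉ inv_{ω₀}(C). -/

import Mathlib

/-! Generic order-theoretic definitions: covering relations, intervals, maximal
chains in subposets, polygons, polygon/square moves, square-equivalence,
ascending chains with respect to an edge labelling, increasing polygon moves,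
and the induced preorder on (square-equivalence classes of) maximal chains. -/

section GenericOrder

variable {α : Type*}

/-- `b` covers `a` with respect to the relation `r`. -/
def CovR (r : α → α → Prop) (a b : α) : Prop :=
  r a b ∧ a ≠ b ∧ ∀ z, r a z → r z b → z = a ∨ z = b

/-- The closed interval from `x` to `y` with respect to `r`. -/
def IccR (r : α → α → Prop) (x y : α) : Set α := {z | r x z ∧ r z y}

/-- `C` is a maximal chain of the subposet `S` (with respect to `r`). -/
def MaxChainIn (r : α → α → Prop) (S C : Set α) : Prop :=
  C ⊆ S ∧ IsChain r C ∧ ∀ C' : Set α, C' ⊆ S → IsChain r C' → C ⊆ C' → C = C'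

/-- `(x, y, C₁, C₂)` form a polygon: the interval `[x, y]` has exactly the two
distinct maximal chains `C₁ ≠ C₂`, whose union is the interval and whose
intersection is `{x, y}`. -/
def IsPolygonPair (r : α → α → Prop) (x y : α) (C₁ C₂ : Set α) : Prop :=
  r x y ∧ MaxChainIn r (IccR r x y) C₁ ∧ MaxChainIn r (IccR r x y) C₂ ∧
    C₁ ≠ C₂ ∧ IccR r x y = C₁ ∪ C₂ ∧ C₁ ∩ C₂ = {x, y} ∧
    ∀ C : Set α, MaxChainIn r (IccR r x y) C → C = C₁ ∨ C = C₂

/-- `P` is a polygon with respect to `r`. -/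
def IsPolygon (r : α → α → Prop) (P : Set α) : Prop :=
  ∃ x y C₁ C₂, P = IccR r x y ∧ IsPolygonPair r x y C₁ C₂

/-- `C` and `C'` are related by a polygon move. -/
def PolygonMove (r : α → α → Prop) (C C' : Set α) : Prop :=
  ∃ x y P₁ P₂, IsPolygonPair r x y P₁ P₂ ∧ P₁ ⊆ C ∧ P₂ ⊆ C' ∧ C \ P₁ = C' \ P₂

/-- `C` and `C'` are related by a square move: a polygon move across a
four-element polygon. -/
def SquareMove (r : α → α → Prop) (C C' : Set α) : Prop :=
  ∃ x y P₁ P₂, IsPolygonPair r x y P₁ P₂ ∧ (IccR r x y).ncard = 4 ∧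
    P₁ ⊆ C ∧ P₂ ⊆ C' ∧ C \ P₁ = C' \ P₂

/-- Square-equivalence: the reflexive-transitive closure of square moves. -/
def SqEquiv (r : α → α → Prop) : Set α → Set α → Prop :=
  Relation.ReflTransGen (SquareMove r)

/-- The chain `C` has strictly increasing edge labels (with respect to the
strict order `lt` on labels): for any two covering pairs occurring along `C`,
the earlier one has strictly smaller label. -/
def ChainAscending {E : Type*} (r : α → α → Prop) (lab : α → α → E)
    (lt : E → E → Prop) (C : Set α) : Prop :=
  ∀ a b c d, a ∈ C → b ∈ C → c ∈ C → d ∈ C →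
    CovR r a b → CovR r c d → r b c → lt (lab a b) (lab c d)

/-- `C'` is an increasing polygon move of `C`: they differ by a polygon move
across a non-square polygon, with `C` containing the ascending chain. -/
def IncPolygonMove {E : Type*} (r : α → α → Prop) (lab : α → α → E)
    (lt : E → E → Prop) (C C' : Set α) : Prop :=
  ∃ x y P₁ P₂, IsPolygonPair r x y P₁ P₂ ∧ (IccR r x y).ncard ≠ 4 ∧
    P₁ ⊆ C ∧ P₂ ⊆ C' ∧ C \ P₁ = C' \ P₂ ∧ ChainAscending r lab lt P₁

/-- The preorder `≼` on (square-equivalence classes of) maximal chains: the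
smallest preorder generated by square moves and increasing polygon moves. -/
def MGPre {E : Type*} (r : α → α → Prop) (lab : α → α → E) (lt : E → E → Prop) :
    Set α → Set α → Prop :=
  Relation.ReflTransGen (fun A B => SqEquiv r A B ∨ IncPolygonMove r lab lt A B)

/-- `[C'] covers [C]` in the preorder `≼` on square-equivalence classes of
maximal chains: `[C] ≺ [C']` and every class weakly between them equals `[C]`
or `[C']`. -/
def MGCover {E : Type*} (r : α → α → Prop) (lab : α → α → E) (lt : E → E → Prop)
    (C C' : Set α) : Prop :=
  MGPre r lab lt C C' ∧ ¬ MGPre r lab lt C' C ∧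
    ∀ D : Set α, IsMaxChain r D → MGPre r lab lt C D → MGPre r lab lt D C' →
      SqEquiv r D C ∨ SqEquiv r D C'

/-- The labelling is polygon-complete: increasing polygon moves always give
covering relations of the preorder on square-equivalence classes. -/
def PolygonComplete {E : Type*} (r : α → α → Prop) (lab : α → α → E)
    (lt : E → E → Prop) : Prop :=
  ∀ C C' : Set α, IsMaxChain r C → IsMaxChain r C' → IncPolygonMove r lab lt C C' →
    MGCover r lab lt C C'

end GenericOrder

/-! Coxeter-specific definitions: the right weak order, its labelling by
reflections, commutation moves, heap posets of reduced words, and (maximal)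
dihedral reflection subgroups. -/

section CoxeterDefs

variable {B : Type*} {W : Type*} [Group W] {M : CoxeterMatrix B}

/-- The right weak Bruhat order: `u ≤ w` iff `ℓ(u) + ℓ(u⁻¹ w) = ℓ(w)`. -/
def weakLE (cs : CoxeterSystem M W) (u w : W) : Prop :=
  cs.length u + cs.length (u⁻¹ * w) = cs.length w

/-- The set of labels of the covering relations of a chain `C` in the right
weak order: the covering relation `v ⋖ v s` is labelled by the reflection
`v s v⁻¹`, i.e. the cover `u ⋖ w` is labelled by `w * u⁻¹`. -/
def chainLabels (cs : CoxeterSystem M W) (C : Set W) : Set W :=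
  {t | ∃ u w : W, u ∈ C ∧ w ∈ C ∧ CovR (weakLE cs) u w ∧ t = w * u⁻¹}

/-- `ω'` is obtained from `ω` by one commutation move: swapping an adjacent
pair of commuting letters. -/
def CommMove (cs : CoxeterSystem M W) (ω ω' : List B) : Prop :=
  ∃ (l r : List B) (i j : B),
    cs.simple i * cs.simple j = cs.simple j * cs.simple i ∧
    ω = l ++ i :: j :: r ∧ ω' = l ++ j :: i :: r

/-- The strict heap order of a word `ω`: the transitive closure of the
relations `t_j < t_k` for `j < k` in the (left) inversion sequence of `ω`
whenever `t_j` and `t_k` do not commute. -/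
def heapLt (cs : CoxeterSystem M W) (ω : List B) : W → W → Prop :=
  Relation.TransGen (fun a b => ∃ j k : ℕ, j < k ∧
    (cs.leftInvSeq ω)[j]? = some a ∧ (cs.leftInvSeq ω)[k]? = some b ∧
    a * b ≠ b * a)

/-- A dihedral reflection subgroup: a subgroup generated by two reflections. -/
def IsDihedralSubgroup (cs : CoxeterSystem M W) (D : Subgroup W) : Prop :=
  ∃ t₁ t₂ : W, cs.IsReflection t₁ ∧ cs.IsReflection t₂ ∧
    D = Subgroup.closure {t₁, t₂}

/-- A maximal dihedral reflection subgroup: maximal under inclusion among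
dihedral reflection subgroups. -/
def IsMaxDihedralSubgroup (cs : CoxeterSystem M W) (D : Subgroup W) : Prop :=
  IsDihedralSubgroup cs D ∧
    ∀ D' : Subgroup W, IsDihedralSubgroup cs D' → D ≤ D' → D = D'

/-- The set of reflections of `W` contained in a subgroup `D`. -/
def reflectionsIn (cs : CoxeterSystem M W) (D : Subgroup W) : Set W :=
  {t | cs.IsReflection t ∧ t ∈ D}

/-- `D` contains two non-commuting reflections. -/
def IsNonCommutative (cs : CoxeterSystem M W) (D : Subgroup W) : Prop :=
  ∃ t t' : W, cs.IsReflection t ∧ cs.IsReflection t' ∧ t ∈ D ∧ t' ∈ D ∧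
    t * t' ≠ t' * t

/-- `t` occurs strictly before `t'` in the inversion sequence of `ω`. -/
def seqBefore (cs : CoxeterSystem M W) (ω : List B) (t t' : W) : Prop :=
  ∃ j k : ℕ, j < k ∧ (cs.leftInvSeq ω)[j]? = some t ∧
    (cs.leftInvSeq ω)[k]? = some t'

/-- `t` occurs strictly before `t'` in the label sequence of the chain `C`
of the right weak order. -/
def chainBefore (cs : CoxeterSystem M W) (C : Set W) (t t' : W) : Prop :=
  ∃ a b c d : W, a ∈ C ∧ b ∈ C ∧ c ∈ C ∧ d ∈ C ∧
    CovR (weakLE cs) a b ∧ CovR (weakLE cs) c d ∧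
    t = b * a⁻¹ ∧ t' = d * c⁻¹ ∧ weakLE cs b c

/-- The inversion set `inv_ω(C)` of a maximal chain `C`: the set of
non-commutative maximal dihedral reflection subgroups whose reflections occur
in the label sequence of `C` in a different relative order from the inversion
sequence of `ω`. -/
def invSubgroups (cs : CoxeterSystem M W) (ω : List B) (C : Set W) :
    Set (Subgroup W) :=
  {D | IsMaxDihedralSubgroup cs D ∧ IsNonCommutative cs D ∧
    ∃ t t' : W, cs.IsReflection t ∧ cs.IsReflection t' ∧ t ∈ D ∧ t' ∈ D ∧
      seqBefore cs ω t t' ∧ chainBefore cs C t' t}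

end CoxeterDefs

namespace MG
section A
variable {B : Type*} {W : Type*} [Group W] {M : CoxeterMatrix B} (cs : CoxeterSystem M W)

theorem dih_conj {G : Type*} [Group G] {a b : G} (ha : a * a = 1) (hb : b * b = 1) (k : ℕ) :
    b * (b * a) ^ k * b = ((b * a) ^ k)⁻¹ := by
  have hb' : b⁻¹ = b := inv_eq_of_mul_eq_one_left hb
  have ha' : a⁻¹ = a := inv_eq_of_mul_eq_one_left ha
  have h : b * (b * a) ^ k * b⁻¹ = (b * (b * a) * b⁻¹) ^ k := by
    rw [conj_pow]
  rw [hb'] at h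
  rw [h, ← inv_pow, mul_inv_rev, ha', hb', ← mul_assoc, hb, one_mul]

open Classical in
/-- sign action generator -/
noncomputable def fgen (i : B) : Function.End (W × ZMod 2) :=
  fun p => (cs.simple i * p.1 * cs.simple i, p.2 + if p.1 = cs.simple i then 1 else 0)

open Classical in
theorem fgen_pow (i j : B) (k : ℕ) (t : W) (e : ZMod 2) :
    ((fgen cs i * fgen cs j) ^ k) (t, e) =
      ((cs.simple i * cs.simple j) ^ k * t * (cs.simple j * cs.simple i) ^ k,
        e + ∑ l ∈ Finset.range (2 * k),
          if t = (cs.simple j * cs.simple i) ^ l * cs.simple j then 1 else 0) := by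
  set a := cs.simple i with ha
  set b := cs.simple j with hb
  have haa : a * a = 1 := cs.simple_mul_simple_self i
  have hbb : b * b = 1 := cs.simple_mul_simple_self j
  have ha' : a⁻¹ = a := inv_eq_of_mul_eq_one_left haa
  have hb' : b⁻¹ = b := inv_eq_of_mul_eq_one_left hbb
  induction k with
  | zero =>
    show (t, e) = _
    simp
  | succ k ih =>
    have hstep : ((fgen cs i * fgen cs j) ^ (k+1)) (t, e) =
      fgen cs i (fgen cs j (((fgen cs i * fgen cs j) ^ k) (t, e))) := by
      rw [pow_succ']; rfl
    have hab : (a * b) ^ k = ((b * a) ^ k)⁻¹ := by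
      rw [← inv_pow, mul_inv_rev, ha', hb']
    have hc := dih_conj haa hbb k
    set u := (b * a) ^ k with hu
    have e1 : ((a * b) ^ k * t * u = b) ↔ (t = (b*a) ^ (2*k) * b) := by
      have : (b*a)^(2*k) = u * u := by rw [two_mul, pow_add]
      rw [this, hab]
      have h2 : u * u * b = u * b * u⁻¹ := by
        rw [← hc]; simp only [mul_assoc]; rw [← mul_assoc b b, hbb, one_mul]
      rw [h2]
      constructor
      · intro h; rw [← h]; group
      · intro h; rw [h]; group
    have e2 : (b * ((a * b) ^ k * t * u) * b = a) ↔ (t = (b*a) ^ (2*k+1) * b) := by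
      have : (b*a)^(2*k+1) = u * (b * a) * u := by
        rw [two_mul, hu, ← pow_succ, ← pow_add]; congr 1; ring
      rw [this, hab]
      have h2 : u * (b * a) * u * b = u * b * a * b * u⁻¹ := by
        rw [← hc]; simp only [mul_assoc]; rw [← mul_assoc b b, hbb, one_mul]
      rw [h2]
      constructor
      · intro h; rw [← h]; 
        have : u * b * (b * (u⁻¹ * t * u) * b) * b * u⁻¹ = u * (b * b) * (u⁻¹ * t * u) * (b * b) * u⁻¹ := by
          group
        rw [this, hbb]; group
      · intro h; rw [h]
        have : b * (u⁻¹ * (u * b * a * b * u⁻¹) * u) * b = (b * b) * a * (b * b) := by group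
        rw [this, hbb]; group
    rw [hstep, ih]
    simp only [fgen, ← ha, ← hb]
    refine Prod.ext ?_ ?_
    · simp only
      rw [pow_succ' (a*b), pow_succ (b * a)]
      simp only [mul_assoc, hu]
    · simp only
      rw [show 2 * (k+1) = 2*k+1+1 by ring, Finset.sum_range_succ, Finset.sum_range_succ]
      simp only [e1, e2, add_assoc]

theorem fgen_liftable : M.IsLiftable (fgen cs) := by
  classical
  intro i j
  funext p
  obtain ⟨t, e⟩ := p
  rw [fgen_pow]
  have h1 : (cs.simple i * cs.simple j) ^ M i j = 1 := cs.simple_mul_simple_pow i j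
  have h2 : (cs.simple j * cs.simple i) ^ M i j = 1 := by
    rw [M.symmetric]; exact cs.simple_mul_simple_pow j i
  rw [h1, h2, two_mul, Finset.sum_range_add]
  simp only [pow_add, h2, one_mul, mul_one]
  refine Prod.ext rfl ?_
  show e + _ = e
  rw [← two_mul, show (2 : ZMod 2) = 0 from rfl]
  simp

noncomputable def eta : W →* Function.End (W × ZMod 2) := cs.lift ⟨fgen cs, fgen_liftable cs⟩

noncomputable def n (w t : W) : ZMod 2 := (eta cs w⁻¹ (t, 0)).2

open Classical in
theorem eta_simple (i : B) (p : W × ZMod 2) : eta cs (cs.simple i) p =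
    (cs.simple i * p.1 * cs.simple i, p.2 + if p.1 = cs.simple i then 1 else 0) := by
  unfold eta
  rw [cs.lift_apply_simple (fgen_liftable cs)]; rfl

theorem eta_form (w : W) (t : W) (e : ZMod 2) :
    eta cs w (t, e) = (w * t * w⁻¹, e + (eta cs w (t, 0)).2) := by
  classical
  induction w using cs.simple_induction_left generalizing t e with
  | one =>
    rw [map_one]; show (t,e) = (_, e + 0); simp
  | mul_simple_left w i ih =>
    have h : ∀ p, eta cs (cs.simple i * w) p = eta cs (cs.simple i) (eta cs w p) := by
      intro p; rw [map_mul]; rfl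
    rw [h, h, ih t e, ih t 0, eta_simple, eta_simple]
    simp [mul_assoc, add_assoc]

theorem n_mul (x y t : W) : n cs (x * y) t = n cs x t + n cs y (x⁻¹ * t * x) := by
  unfold n
  rw [mul_inv_rev, map_mul]
  show (eta cs y⁻¹ (eta cs x⁻¹ (t,0))).2 = _
  rw [eta_form cs x⁻¹ t 0, eta_form cs y⁻¹]
  simp

theorem n_one (t : W) : n cs 1 t = 0 := by
  unfold n; rw [inv_one, map_one]; rfl

open Classical in
theorem n_simple (i : B) (t : W) : n cs (cs.simple i) t = if t = cs.simple i then 1 else 0 := by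
  unfold n
  rw [cs.inv_simple, eta_simple]; simp

open Classical in
theorem n_word (ω : List B) (t : W) :
    n cs (cs.wordProd ω) t = ((cs.leftInvSeq ω).count t : ZMod 2) := by
  induction ω generalizing t with
  | nil => simp [n_one]
  | cons i ω ih =>
    rw [cs.wordProd_cons, n_mul, n_simple, ih, CoxeterSystem.leftInvSeq, List.count_cons]
    have : List.count t (List.map (MulAut.conj (cs.simple i)) (cs.leftInvSeq ω)) =
        List.count ((cs.simple i)⁻¹ * t * cs.simple i) (cs.leftInvSeq ω) := by
      have h := List.count_map_of_injective (cs.leftInvSeq ω) (MulAut.conj (cs.simple i))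
        (MulAut.conj (cs.simple i)).injective ((cs.simple i)⁻¹ * t * cs.simple i)
      rw [← h]; congr 1; simp [mul_assoc]
    rw [this]
    push_cast
    rw [add_comm]
    congr 1
    by_cases h : t = cs.simple i
    · simp [h]
    · simp [h, Ne.symm h]

theorem n_inv_self (v t : W) : n cs v (v * t * v⁻¹) + n cs v⁻¹ t = 0 := by
  have := n_mul cs v v⁻¹ (v * t * v⁻¹)
  rw [mul_inv_cancel, n_one] at this
  rw [this]; congr 2; group

theorem n_self {t : W} (ht : cs.IsReflection t) : n cs t t = 1 := by
  obtain ⟨v, i, rfl⟩ := ht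
  have h := n_inv_self cs v (cs.simple i)
  rw [n_mul, n_mul]
  have e1 : v⁻¹ * (v * cs.simple i * v⁻¹) * v = cs.simple i := by group
  have e2 : (v * cs.simple i)⁻¹ * (v * cs.simple i * v⁻¹) * (v * cs.simple i) = cs.simple i := by group
  rw [e1, e2, n_simple, if_pos rfl]
  linear_combination h

theorem zmod2 (a : ZMod 2) : a = 0 ∨ a = 1 := by
  revert a; decide

theorem n_word_reduced {ω : List B} (h : cs.IsReduced ω) (t : W) :
    n cs (cs.wordProd ω) t = 1 ↔ t ∈ cs.leftInvSeq ω := by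
  classical
  rw [n_word]
  by_cases ht : t ∈ cs.leftInvSeq ω
  · rw [List.count_eq_one_of_mem h.nodup_leftInvSeq ht]; simp [ht]
  · rw [List.count_eq_zero_of_not_mem ht]; simp [ht]

theorem n_lt {w t : W} (h : n cs w t = 1) : cs.IsReflection t ∧ cs.length (t * w) < cs.length w := by
  obtain ⟨ω, hω, rfl⟩ := cs.exists_isReduced w
  rw [n_word_reduced cs hω] at h
  exact cs.isLeftInversion_of_mem_leftInvSeq hω h

theorem n_iff {w t : W} (ht : cs.IsReflection t) : n cs w t = 1 ↔ cs.length (t * w) < cs.length w := by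
  constructor
  · intro h; exact (n_lt cs h).2
  · intro h
    rcases zmod2 (n cs w t) with h0 | h1
    · exfalso
      have : n cs (t * w) t = 1 := by
        rw [n_mul, n_self cs ht, show t⁻¹ * t * t = t by group, h0, add_zero]
      have := (n_lt cs this).2
      rw [← mul_assoc, ht.mul_self, one_mul] at this
      omega
    · exact h1

theorem n_zero_iff {w t : W} (ht : cs.IsReflection t) :
    n cs w t = 0 ↔ cs.length w < cs.length (t * w) := by
  have h := n_iff cs (w := w) ht
  have := ht.length_mul_right_ne w
  rcases zmod2 (n cs w t) with h0 | h0 <;> rw [h0] at h ⊢ <;> simp at h ⊢ <;> omega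

theorem n_refl {w t : W} (h : n cs w t ≠ 0) : cs.IsReflection t := by
  rcases zmod2 (n cs w t) with h0 | h0
  · exact absurd h0 h
  · exact (n_lt cs h0).1

theorem n_eq_zero_all {w : W} (h : ∀ t, n cs w t = 0) : w = 1 := by
  by_contra hw
  obtain ⟨i, hi⟩ := cs.exists_leftDescent_of_ne_one hw
  have := (n_iff cs (cs.isReflection_simple i)).2 hi
  rw [h] at this
  exact absurd this (by decide)

theorem length_eq_ncard [Finite W] (w : W) : cs.length w = {t | n cs w t = 1}.ncard := by
  classical
  obtain ⟨ω, hω, rfl⟩ := cs.exists_isReduced w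
  have : {t | n cs (cs.wordProd ω) t = 1} = ((cs.leftInvSeq ω).toFinset : Set W) := by
    ext t; simp [n_word_reduced cs hω]
  rw [this, Set.ncard_coe_finset, List.toFinset_card_of_nodup hω.nodup_leftInvSeq,
    cs.length_leftInvSeq]
  exact hω

end A
end MG

namespace MG
section Bg
variable {G : Type*} [Group G]

/-- alternating product of k factors starting with a -/
def alt (a b : G) : ℕ → G
  | 0 => 1
  | k + 1 => a * alt b a k

/-- the reflections of a dihedral group -/
def R (a b : G) (j : ℕ) : G := (a * b) ^ j * a

theorem inv_of_sq {a : G} (ha : a * a = 1) : a⁻¹ = a := inv_eq_of_mul_eq_one_left ha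

theorem sw_zpow {a b : G} (ha : a * a = 1) (hb : b * b = 1) (z : ℤ) :
    a * (a * b) ^ z * a = (a * b) ^ (-z) := by
  have ha' := inv_of_sq ha
  have hb' := inv_of_sq hb
  have h : a * (a * b) ^ z * a⁻¹ = (a * (a * b) * a⁻¹) ^ z := by rw [conj_zpow]
  rw [ha'] at h
  rw [h, zpow_neg, ← inv_zpow, mul_inv_rev, ha', hb', ← mul_assoc, ha, one_mul]

theorem dih_mem {a b : G} (ha : a * a = 1) (hb : b * b = 1) {x : G}
    (hx : x ∈ Subgroup.closure ({a, b} : Set G)) :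
    ∃ z : ℤ, x = (a * b) ^ z ∨ x = (a * b) ^ z * a := by
  have ha' := inv_of_sq ha
  have hb' := inv_of_sq hb
  have key : ∀ y : G, (∃ z : ℤ, y = (a * b) ^ z ∨ y = (a * b) ^ z * a) →
      (∃ z : ℤ, a * y = (a * b) ^ z ∨ a * y = (a * b) ^ z * a) ∧
      (∃ z : ℤ, b * y = (a * b) ^ z ∨ b * y = (a * b) ^ z * a) := by
    rintro y ⟨z, hz⟩
    have e1 : a * (a * b) ^ z = (a * b) ^ (-z) * a := by
      rw [← sw_zpow ha hb z, mul_assoc _ a a, ha, mul_one]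
    have e2 : b * (a * b) ^ z = (a * b) ^ (-z - 1) * a := by
      have : b = (a * b)⁻¹ * a := by rw [mul_inv_rev, mul_assoc, inv_mul_cancel, mul_one, hb']
      calc b * (a * b) ^ z = (a * b)⁻¹ * a * (a * b) ^ z := by rw [← this]
        _ = _ := ?_
      rw [mul_assoc, e1, ← mul_assoc, ← zpow_neg_one, ← zpow_add]
      congr 2; ring
    rcases hz with rfl | rfl
    · exact ⟨⟨_, Or.inr e1⟩, ⟨_, Or.inr e2⟩⟩
    · refine ⟨⟨-z, Or.inl ?_⟩, ⟨-z-1, Or.inl ?_⟩⟩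
      · rw [← mul_assoc, e1, mul_assoc, ha, mul_one]
      · rw [← mul_assoc, e2, mul_assoc, ha, mul_one]
  induction hx using Subgroup.closure_induction_left with
  | one => exact ⟨0, by simp⟩
  | mul_left x hx y hy ih =>
    rcases hx with rfl | rfl
    · exact (key y ih).1
    · exact (key y ih).2
  | inv_mul_cancel x hx y hy ih =>
    rcases hx with rfl | rfl
    · rw [ha']; exact (key y ih).1
    · rw [hb']; exact (key y ih).2

theorem alt_pow {a b : G} (ha : a * a = 1) (hb : b * b = 1) (k : ℕ) :
    alt a b k = (a * b) ^ k * alt b a k := by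
  induction k generalizing a b with
  | zero => simp [alt]
  | succ k ih =>
    have hh := dih_conj hb ha k
    simp only [alt]
    rw [ih ha hb, pow_succ]
    have : (a * b) ^ k * (a * b) * (b * ((a * b) ^ k * alt b a k)) =
        (a * b) ^ k * a * (b * b) * (a * b) ^ k * alt b a k := by group
    rw [this, hb, mul_one]
    have h2 : (a * b) ^ k * a * (a*b)^k = a := by
      have : a * (a*b)^k = ((a*b)^k)⁻¹ * a := by rw [← hh, mul_assoc _ a a, ha, mul_one]
      rw [mul_assoc, this, mul_inv_cancel_left]
    rw [h2]

theorem alt_symm {a b : G} (ha : a * a = 1) (hb : b * b = 1) {m : ℕ} (hm : (a * b) ^ m = 1) :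
    alt a b m = alt b a m := by
  rw [alt_pow ha hb, hm, one_mul]

theorem alt_left {a b : G} (ha : a * a = 1) (k : ℕ) : a * alt a b (k+1) = alt b a k := by
  simp only [alt]; rw [← mul_assoc, ha, one_mul]

theorem dih_alt {a b : G} (ha : a * a = 1) (hb : b * b = 1) {m : ℕ} (hm : (a * b) ^ m = 1)
    (hm1 : 1 ≤ m) {x : G} (hx : x ∈ Subgroup.closure ({a, b} : Set G)) :
    ∃ k ≤ m, x = alt a b k ∨ x = alt b a k := by
  have key : ∀ (a b : G), a * a = 1 → alt a b m = alt b a m → ∀ y : G,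
      (∃ k ≤ m, y = alt a b k ∨ y = alt b a k) → (∃ k ≤ m, a * y = alt a b k ∨ a * y = alt b a k) := by
    rintro a b ha hs y ⟨k, hk, h | h⟩
    · rcases k with _ | k
      · exact ⟨1, hm1, Or.inl (by simp [h, alt])⟩
      · exact ⟨k, by omega, Or.inr (by rw [h, alt_left ha])⟩
    · by_cases hkm : k = m
      · subst hkm
        obtain ⟨j, rfl⟩ : ∃ j, k = j + 1 := ⟨k - 1, by omega⟩
        exact ⟨j, by omega, Or.inr (by rw [h, ← hs, alt_left ha])⟩
      · exact ⟨k + 1, by omega, Or.inl (by rw [h]; rfl)⟩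
  have hs := alt_symm ha hb hm
  have sw : ∀ y, (∃ k ≤ m, y = alt a b k ∨ y = alt b a k) ↔ (∃ k ≤ m, y = alt b a k ∨ y = alt a b k) := by
    intro y; simp only [or_comm]
  have kb : ∀ y, (∃ k ≤ m, y = alt a b k ∨ y = alt b a k) →
     (∃ k ≤ m, b * y = alt a b k ∨ b * y = alt b a k) := fun y hy =>
    (sw _).2 (key b a hb hs.symm y ((sw _).1 hy))
  induction hx using Subgroup.closure_induction_left with
  | one => exact ⟨0, by simp, by simp [alt]⟩
  | mul_left x hx y hy ih =>
    rcases hx with rfl | rfl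
    · exact key _ _ ha hs y ih
    · exact kb y ih
  | inv_mul_cancel x hx y hy ih =>
    rcases hx with rfl | rfl
    · rw [inv_of_sq ha]; exact key _ _ ha hs y ih
    · rw [inv_of_sq hb]; exact kb y ih

theorem R_mem {a b : G} (j : ℕ) {D : Subgroup G} (ha : a ∈ D) (hb : b ∈ D) : R a b j ∈ D :=
  D.mul_mem (D.pow_mem (D.mul_mem ha hb) _) ha

theorem alt_mem {a b : G} (j : ℕ) {D : Subgroup G} (ha : a ∈ D) (hb : b ∈ D) : alt a b j ∈ D := by
  induction j generalizing a b with
  | zero => exact D.one_mem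
  | succ j ih => exact D.mul_mem ha (ih hb ha)

theorem R_succ {a b : G} (j : ℕ) : R a b (j+1) = a * R b a j * a := by
  unfold R
  have : a * ((b * a) ^ j * b) * a = (a * (b * a) ^ j) * (b * a) := by group
  rw [this, mul_assoc, ← pow_succ, pow_succ (a * b)]
  have h : ∀ k : ℕ, a * (b * a) ^ k = (a * b) ^ k * a := by
    intro k
    induction k with
    | zero => simp
    | succ k ih => rw [pow_succ, ← mul_assoc, ih, pow_succ]; group
  rw [h, pow_succ]

theorem alt_conj {a b : G} (ha : a * a = 1) (hb : b * b = 1) (k : ℕ) :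
    alt a b (k+1) * (alt a b k)⁻¹ = R a b k := by
  induction k generalizing a b with
  | zero => simp [alt, R]
  | succ k ih =>
    rw [R_succ, ← ih hb ha]
    simp only [alt, mul_inv_rev]
    rw [inv_of_sq ha]
    group

theorem R_swap {a b : G} (ha : a * a = 1) (hb : b * b = 1) {m : ℕ} (hm : (a * b) ^ m = 1)
    {j : ℕ} (hj : j < m) : R b a j = R a b (m - 1 - j) := by
  unfold R
  have h1 : (b * a) ^ j = ((a * b) ^ j)⁻¹ := by
    rw [← inv_pow, mul_inv_rev, inv_of_sq ha, inv_of_sq hb]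
  have h2 : (a * b) ^ (m - 1 - j) = ((a * b) ^ (j + 1))⁻¹ := by
    rw [eq_inv_iff_mul_eq_one, ← pow_add, ← hm]; congr 1; omega
  rw [h1, h2, pow_succ', mul_inv_rev, mul_inv_rev, inv_of_sq ha, inv_of_sq hb]
  rw [mul_assoc, mul_assoc, ha, mul_one]

theorem R_inj {a b : G} {i j : ℕ} (hi : i < orderOf (a * b)) (hj : j < orderOf (a * b))
    (h : R a b i = R a b j) : i = j := by
  unfold R at h
  have := mul_right_cancel h
  exact pow_injOn_Iio_orderOf hi hj this
end Bg

section B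
variable {B : Type*} {W : Type*} [Group W] {M : CoxeterMatrix B} (cs : CoxeterSystem M W)

theorem refl_parity {t : W} (ht : cs.IsReflection t) :
    cs.lengthParity t = Multiplicative.ofAdd (1 : ZMod 2) := by
  rw [cs.lengthParity_eq_ofAdd_length, (ZMod.natCast_eq_one_iff_odd).2 ht.odd_length]

theorem dih_form {D : Subgroup W} (hD : IsDihedralSubgroup cs D) : ∃ r t : W,
    (∀ z : ℤ, t * r ^ z * t = r ^ (-z)) ∧
    ∀ x ∈ D, ∃ z : ℤ, (x = r ^ z ∧ cs.lengthParity x = 1) ∨ (x = r ^ z * t ∧ cs.IsReflection x) := by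
  obtain ⟨a, b, ha, hb, rfl⟩ := hD
  refine ⟨a * b, a, sw_zpow ha.mul_self hb.mul_self, ?_⟩
  intro x hx
  obtain ⟨z, h | h⟩ := dih_mem ha.mul_self hb.mul_self hx
  · refine ⟨z, Or.inl ⟨h, ?_⟩⟩
    rw [h, map_zpow, map_mul, refl_parity cs ha, refl_parity cs hb]
    have : Multiplicative.ofAdd (1 : ZMod 2) * Multiplicative.ofAdd 1 = 1 := rfl
    rw [this, one_zpow]
  · refine ⟨z, Or.inr ⟨h, ?_⟩⟩
    have conj : ∀ (k : ℤ) (c : W), (a * b) ^ k * c * ((a*b)^k)⁻¹ = (a * b) ^ k * c * (a * b) ^ (-k) := by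
      intro k c; rw [zpow_neg]
    have sw : ∀ k : ℤ, a * (a * b) ^ k = (a * b) ^ (-k) * a := by
      intro k
      rw [← sw_zpow ha.mul_self hb.mul_self k, mul_assoc _ a a, ha.mul_self, mul_one]
    rcases Int.even_or_odd' z with ⟨k, rfl | rfl⟩
    · have : x = (a * b) ^ k * a * ((a*b)^k)⁻¹ := by
        rw [conj, mul_assoc, sw, ← mul_assoc, ← zpow_add, h]; congr 2; ring
      rw [this]; exact ha.conj _
    · have : x = (a * b) ^ k * (a * b * a⁻¹) * ((a*b)^k)⁻¹ := by
        rw [conj, ha.inv, mul_assoc, mul_assoc (a * b), sw, ← mul_assoc (a * b), neg_neg,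
          ← zpow_one_add, ← mul_assoc, ← zpow_add, h]
        congr 2; ring
      rw [this]; exact (hb.conj _).conj _

theorem dih_form_refl {x r t : W} {z : ℤ} (hx : cs.IsReflection x)
    (h : (x = r ^ z ∧ cs.lengthParity x = 1) ∨ (x = r ^ z * t ∧ cs.IsReflection x)) :
    x = r ^ z * t := by
  rcases h with h | h
  · rw [refl_parity cs hx] at h
    exact absurd h.2 (by decide)
  · exact h.1

theorem rot_comm {D : Subgroup W} (hD : IsDihedralSubgroup cs D) {a b c d : W}
    (ha : cs.IsReflection a) (hb : cs.IsReflection b) (hc : cs.IsReflection c) (hd : cs.IsReflection d)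
    (ha' : a ∈ D) (hb' : b ∈ D) (hc' : c ∈ D) (hd' : d ∈ D) :
    (a * b) * (c * d) = (c * d) * (a * b) := by
  obtain ⟨r, t, hsw, h⟩ := dih_form cs hD
  have : ∀ {a b : W}, cs.IsReflection a → cs.IsReflection b → a ∈ D → b ∈ D → ∃ z : ℤ, a * b = r ^ z := by
    intro a b ha hb ha' hb'
    obtain ⟨z, h1⟩ := h a ha'
    obtain ⟨w, h2⟩ := h b hb'
    refine ⟨z + -w, ?_⟩
    rw [dih_form_refl cs ha h1, dih_form_refl cs hb h2, zpow_add, ← hsw]; group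
  obtain ⟨z, hz⟩ := this ha hb ha' hb'
  obtain ⟨w, hw⟩ := this hc hd hc' hd'
  rw [hz, hw, ← zpow_add, ← zpow_add, add_comm]

theorem three_refl {D : Subgroup W} (hD : IsDihedralSubgroup cs D) {a b c : W}
    (ha : cs.IsReflection a) (hb : cs.IsReflection b) (hc : cs.IsReflection c)
    (ha' : a ∈ D) (hb' : b ∈ D) (hc' : c ∈ D) : cs.IsReflection (a * b * c) := by
  obtain ⟨r, t, hsw, h⟩ := dih_form cs hD
  obtain ⟨u, h4 | h4⟩ := h (a * b * c) (D.mul_mem (D.mul_mem ha' hb') hc')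
  · exfalso
    have := h4.2
    rw [map_mul, map_mul, refl_parity cs ha, refl_parity cs hb, refl_parity cs hc] at this
    exact absurd this (by decide)
  · exact h4.2

/-- canonical generators -/
def Canon (D : Subgroup W) (a : W) : Prop :=
  a ∈ D ∧ cs.IsReflection a ∧ ∀ t ∈ D, n cs a t = 1 → t = a

theorem canon_self {D : Subgroup W} {a : W} (h : Canon cs D a) : n cs a a = 1 := n_self cs h.2.1

theorem canon_ne {D : Subgroup W} {a t : W} (h : Canon cs D a) (ht : t ∈ D) (hne : t ≠ a) :
    n cs a t = 0 := by
  rcases zmod2 (n cs a t) with h0 | h0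
  · exact h0
  · exact absurd (h.2.2 t ht h0) hne

open Classical in
theorem canon_val {D : Subgroup W} {a t : W} (h : Canon cs D a) (ht : t ∈ D) :
    n cs a t = if t = a then 1 else 0 := by
  split_ifs with h1
  · rw [h1]; exact canon_self cs h
  · exact canon_ne cs h ht h1

theorem canon_simple {D : Subgroup W} {i : B} (h : cs.simple i ∈ D) : Canon cs D (cs.simple i) := by
  classical
  refine ⟨h, cs.isReflection_simple i, fun t _ h1 => ?_⟩
  rw [n_simple] at h1
  by_contra h2
  rw [if_neg h2] at h1
  exact absurd h1 (by decide)

theorem canon_H {D : Subgroup W} {a b c : W} (ha : Canon cs D a) (hb : Canon cs D b)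
    (hc : Canon cs D c) (hab : a ≠ b) (hac : a ≠ c) (hbc : b ≠ c) : a * c * a ≠ b := by
  intro h
  have hn : n cs b a = 1 := by
    rw [← h, n_mul, n_mul, show a⁻¹ * a * a = a by group, canon_self cs ha,
      canon_ne cs hc ha.1 hac, canon_ne cs ha _ _]
    · simp
    · exact D.mul_mem (D.mul_mem (D.inv_mem (D.mul_mem ha.1 hc.1)) ha.1) (D.mul_mem ha.1 hc.1)
    · intro h2
      have h3 : a * c = c * a := by
        have : c * ((a * c)⁻¹ * a * (a * c)) = a * c := by
          rw [mul_inv_rev, hc.2.1.inv]; 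
          have : c * (c * a⁻¹ * a * (a * c)) = (c * c) * (a * c) := by group
          rw [this, hc.2.1.mul_self, one_mul]
        rw [← this, h2]
      apply hbc
      rw [← h, h3, mul_assoc, ha.2.1.mul_self, mul_one]
  exact hab (hb.2.2 a ha.1 hn)

theorem canon_K {D : Subgroup W} (hD : IsDihedralSubgroup cs D) {a b c : W}
    (ha : Canon cs D a) (hb : Canon cs D b)
    (hc : Canon cs D c) (hab : a ≠ b) (hac : a ≠ c) (hbc : b ≠ c) : a * b = b * a := by
  have h1 : (a * b) * (a * c) = (a * c) * (a * b) := rot_comm cs hD ha.2.1 hb.2.1 ha.2.1 hc.2.1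
    ha.1 hb.1 ha.1 hc.1
  have h2 : b * a * c = c * a * b := by
    have : a * (b * a * c) = a * (c * a * b) := by simpa only [mul_assoc] using h1
    exact mul_left_cancel this
  have h3 : n cs (c * a * b) c = 1 := by
    rw [n_mul, n_mul, canon_self cs hc, show c⁻¹ * c * c = c by group,
      canon_ne cs ha hc.1 hac.symm, canon_ne cs hb _ _]
    · simp
    · exact D.mul_mem (D.mul_mem (D.inv_mem (D.mul_mem hc.1 ha.1)) hc.1) (D.mul_mem hc.1 ha.1)
    · intro h4
      apply canon_H cs ha hb hc hab hac hbc
      rw [← h4, mul_inv_rev, ha.2.1.inv]; group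
  by_contra hne
  rw [← h2, n_mul, n_mul, canon_ne cs hb hc.1 hbc.symm, canon_ne cs ha, canon_ne cs hc] at h3
  · exact absurd h3 (by decide)
  · exact D.mul_mem (D.mul_mem (D.inv_mem (D.mul_mem hb.1 ha.1)) hc.1) (D.mul_mem hb.1 ha.1)
  · intro h4
    apply hne
    have h5 : c * (b * a) = b * a * c := by
      have : c * (b * a) = (b * a) * ((b * a)⁻¹ * c * (b * a)) := by group
      rw [this, h4]
    rw [h2, mul_assoc] at h5
    exact (mul_left_cancel h5).symm
  · exact D.mul_mem (D.mul_mem (D.inv_mem hb.1) hc.1) hb.1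
  · intro h4
    apply canon_H cs hb ha hc hab.symm hbc hac
    rw [← h4, hb.2.1.inv]

theorem canon_two {D : Subgroup W} (hD : IsDihedralSubgroup cs D) {a b c : W}
    (ha : Canon cs D a) (hb : Canon cs D b)
    (hc : Canon cs D c) (hab : a ≠ b) (hac : a ≠ c) (hbc : b ≠ c) : False := by
  have k1 := canon_K cs hD ha hb hc hab hac hbc
  have k2 := canon_K cs hD ha hc hb hac hab hbc.symm
  have k3 := canon_K cs hD hb hc ha hbc hab.symm hac.symm
  have hr := three_refl cs hD ha.2.1 hb.2.1 hc.2.1 ha.1 hb.1 hc.1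
  have hD' : a * b * c ∈ D := D.mul_mem (D.mul_mem ha.1 hb.1) hc.1
  have h := n_self cs hr
  have c1 : ∀ x, x = a ∨ x = b → x⁻¹ * (a * b * c) * x = a * b * c := by
    rintro x (rfl | rfl)
    · have : (x * b * c) * x = x * (x * b * c) := by
        rw [mul_assoc, ← k2, ← mul_assoc, mul_assoc x b x, ← k1]; group
      rw [mul_assoc, this]; group
    · have : (a * x * c) * x = x * (a * x * c) := by
        rw [mul_assoc, ← k3, k1, mul_assoc x a, ← mul_assoc a x, k1]
      rw [mul_assoc, this]; group
  have c2 : (a * b)⁻¹ * (a * b * c) * (a * b) = a * b * c := by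
    have := c1 b (Or.inr rfl)
    have h2 := c1 a (Or.inl rfl)
    calc _ = b⁻¹ * (a⁻¹ * (a * b * c) * a) * b := by group
      _ = _ := by rw [h2, this]
  rw [n_mul, n_mul, c2, c1 a (Or.inl rfl), canon_ne cs ha hD', canon_ne cs hb hD',
    canon_ne cs hc hD'] at h
  · exact absurd h (by decide)
  · intro h
    have : a * b = 1 := by simpa using h
    exact hab (by rw [← ha.2.1.inv]; exact inv_eq_of_mul_eq_one_right this)
  · intro h
    rw [k1, mul_assoc] at h
    have : a * c = 1 := by simpa using h
    exact hac (by rw [← ha.2.1.inv]; exact inv_eq_of_mul_eq_one_right this)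
  · intro h
    rw [mul_assoc] at h
    have : b * c = 1 := by simpa using h
    exact hbc (by rw [← hb.2.1.inv]; exact inv_eq_of_mul_eq_one_right this)

theorem min_coset (D : Subgroup W) (x : W) :
    ∃ d ∈ D, ∃ y, x = d * y ∧ ∀ t ∈ D, n cs y t = 0 := by
  classical
  have hex : ∃ k : ℕ, ∃ d ∈ D, ∃ y, x = d * y ∧ cs.length y = k :=
    ⟨_, 1, D.one_mem, x, by simp, rfl⟩
  obtain ⟨d, hd, y, hxy, hk⟩ := Nat.find_spec hex
  refine ⟨d, hd, y, hxy, fun t ht => ?_⟩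
  rcases zmod2 (n cs y t) with h | h
  · exact h
  · exfalso
    obtain ⟨h1, h2⟩ := n_lt cs h
    rw [hk] at h2
    refine Nat.find_min hex h2 ⟨d * t, D.mul_mem hd ht, t * y, ?_, rfl⟩
    rw [hxy, mul_assoc, ← mul_assoc t t, h1.mul_self, one_mul]

theorem n_coset {D : Subgroup W} {d y : W} (hd : d ∈ D) (hy : ∀ t ∈ D, n cs y t = 0) {t : W}
    (ht : t ∈ D) : n cs (d * y) t = n cs d t := by
  rw [n_mul, hy _ (D.mul_mem (D.mul_mem (D.inv_mem hd) ht) hd), add_zero]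

theorem canon_step {D : Subgroup W} {d y : W} {i : B} (hd : d ∈ D) (hy : ∀ t ∈ D, n cs y t = 0)
    (hi : y * cs.simple i * y⁻¹ ∈ D) : Canon cs D (y * cs.simple i * y⁻¹) := by
  classical
  refine ⟨hi, (cs.isReflection_simple i).conj y, fun t ht h => ?_⟩
  set a := y * cs.simple i * y⁻¹ with ha
  have e : a * y = y * cs.simple i := by rw [ha]; group
  have h1 : n cs (a * y) t = n cs a t := n_coset cs hi hy ht
  rw [e, n_mul, hy t ht, h, n_simple] at h1
  split_ifs at h1 with h2
  · rw [ha, ← h2]; group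
  · simp at h1

theorem canon_gen_word (D : Subgroup W) (ω : List B) :
    (∀ t ∈ cs.leftInvSeq ω, t ∈ D → t ∈ Subgroup.closure {a | Canon cs D a}) ∧
    ∃ d ∈ Subgroup.closure {a | Canon cs D a}, ∃ y, cs.wordProd ω = d * y ∧ ∀ t ∈ D, n cs y t = 0 := by
  classical
  have hle : Subgroup.closure {a | Canon cs D a} ≤ D := by
    rw [Subgroup.closure_le]; intro a ha; exact ha.1
  induction ω using List.reverseRecOn with
  | nil => exact ⟨by simp, 1, Subgroup.one_mem _, 1, by simp, fun t _ => n_one cs t⟩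
  | append_singleton ω i ih =>
    obtain ⟨h1, d, hd, y, hdy, hy⟩ := ih
    have hl : cs.leftInvSeq (ω ++ [i]) =
        cs.leftInvSeq ω ++ [cs.wordProd ω * cs.simple i * (cs.wordProd ω)⁻¹] := by
      have := cs.leftInvSeq_concat ω i
      simpa [List.concat_eq_append] using this
    have hp : cs.wordProd (ω ++ [i]) = cs.wordProd ω * cs.simple i := by
      rw [cs.wordProd_append, cs.wordProd_singleton]
    have key : cs.wordProd ω * cs.simple i * (cs.wordProd ω)⁻¹ = d * (y * cs.simple i * y⁻¹) * d⁻¹ := by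
      rw [hdy]; group
    rw [hl, hp, key]
    by_cases hD : y * cs.simple i * y⁻¹ ∈ D
    · have hc := canon_step cs (hle hd) hy hD
      have hc' : y * cs.simple i * y⁻¹ ∈ Subgroup.closure {a | Canon cs D a} :=
        Subgroup.subset_closure hc
      refine ⟨?_, d * (y * cs.simple i * y⁻¹), Subgroup.mul_mem _ hd hc', y, ?_, hy⟩
      · intro t ht htD
        rw [List.mem_append, List.mem_singleton] at ht
        rcases ht with ht | rfl
        · exact h1 t ht htD
        · exact Subgroup.mul_mem _ (Subgroup.mul_mem _ hd hc') (Subgroup.inv_mem _ hd)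
      · rw [hdy]; group
    · refine ⟨?_, d, hd, y * cs.simple i, ?_, ?_⟩
      · intro t ht htD
        rw [List.mem_append, List.mem_singleton] at ht
        rcases ht with ht | rfl
        · exact h1 t ht htD
        · exfalso; apply hD
          have := D.mul_mem (D.mul_mem (D.inv_mem (hle hd)) htD) (hle hd)
          convert this using 1; group
      · rw [hdy]; group
      · intro t ht
        rw [n_mul, hy t ht, n_simple, if_neg, add_zero]
        intro h; apply hD; rw [← h]
        convert ht using 1; group

theorem canon_gen {D : Subgroup W} {t : W} (ht : cs.IsReflection t) (htD : t ∈ D) :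
    t ∈ Subgroup.closure {a | Canon cs D a} := by
  obtain ⟨ω, hω, h⟩ := cs.exists_isReduced t
  refine (canon_gen_word cs D ω).1 t ?_ htD
  rw [← n_word_reduced cs hω, ← h]
  exact n_self cs ht

theorem canon_closure {D : Subgroup W} (hD : IsDihedralSubgroup cs D) :
    D = Subgroup.closure {a | Canon cs D a} := by
  apply le_antisymm
  · obtain ⟨t1, t2, h1, h2, h⟩ := hD
    conv_lhs => rw [h]
    rw [Subgroup.closure_le]
    have m1 : t1 ∈ D := by rw [h]; exact Subgroup.subset_closure (by simp)
    have m2 : t2 ∈ D := by rw [h]; exact Subgroup.subset_closure (by simp)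
    rintro x (rfl | rfl)
    · exact canon_gen cs h1 m1
    · exact canon_gen cs h2 m2
  · rw [Subgroup.closure_le]; intro a ha; exact ha.1

theorem canon_pair {D : Subgroup W} (hD : IsDihedralSubgroup cs D) {a b : W}
    (ha : Canon cs D a) (hb : Canon cs D b) (hab : a ≠ b) : D = Subgroup.closure {a, b} := by
  rw [canon_closure cs hD]
  congr 1
  ext c
  constructor
  · intro hc
    by_contra h
    simp only [Set.mem_insert_iff, Set.mem_singleton_iff, not_or] at h
    exact canon_two cs hD ha hb hc hab (Ne.symm h.1) (Ne.symm h.2)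
  · rintro (rfl | rfl)
    · exact ha
    · exact hb

theorem canon_exists {D : Subgroup W} (hD : IsDihedralSubgroup cs D) (hn : IsNonCommutative cs D) :
    ∃ a b, Canon cs D a ∧ Canon cs D b ∧ a ≠ b ∧ a * b ≠ b * a := by
  by_contra hcon
  push Not at hcon
  obtain ⟨t, t', _, _, ht, ht', hne⟩ := hn
  rw [canon_closure cs hD] at ht ht'
  apply hne
  have : ∀ x ∈ {a | Canon cs D a}, ∀ y ∈ {a | Canon cs D a}, x * y = y * x := by
    intro x hx y hy
    by_cases h : x = y
    · rw [h]
    · exact hcon x y hx hy h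
  exact (Subgroup.closure_induction₂ (p := fun x y _ _ => x * y = y * x)
    (fun x y hx hy => this x hx y hy)
    (by simp) (by simp)
    (fun x y z _ _ _ h1 h2 => by rw [mul_assoc, h2, ← mul_assoc, h1, mul_assoc])
    (fun x y z _ _ _ h1 h2 => by rw [← mul_assoc, h1, mul_assoc, h2, mul_assoc])
    (fun x y _ _ h => by rw [inv_mul_eq_iff_eq_mul, ← mul_assoc, h, mul_assoc, mul_inv_cancel, mul_one])
    (fun x y _ _ h => by rw [mul_inv_eq_iff_eq_mul, mul_assoc, h, ← mul_assoc, inv_mul_cancel, one_mul]) ht ht')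

end B
end MG

namespace MG
section C
variable {B : Type*} {W : Type*} [Group W] {M : CoxeterMatrix B} (cs : CoxeterSystem M W)

structure Dih (D : Subgroup W) (a b : W) : Prop where
  dih : IsDihedralSubgroup cs D
  ca : Canon cs D a
  cb : Canon cs D b
  ne : a ≠ b

variable {cs}
namespace Dih
variable {D : Subgroup W} {a b : W}

theorem symm (h : Dih cs D a b) : Dih cs D b a := ⟨h.dih, h.cb, h.ca, h.ne.symm⟩
theorem aa (h : Dih cs D a b) : a * a = 1 := h.ca.2.1.mul_self
theorem bb (h : Dih cs D a b) : b * b = 1 := h.cb.2.1.mul_self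
theorem clos (h : Dih cs D a b) : D = Subgroup.closure {a, b} := canon_pair cs h.dih h.ca h.cb h.ne
theorem ord (h : Dih cs D a b) : orderOf (b * a) = orderOf (a * b) := by
  rw [← orderOf_inv (b * a), mul_inv_rev, inv_of_sq h.aa, inv_of_sq h.bb]

theorem two [Finite W] (h : Dih cs D a b) : 2 ≤ orderOf (a * b) := by
  have h0 : 0 < orderOf (a * b) := orderOf_pos _
  have h1 : orderOf (a * b) ≠ 1 := by
    rw [Ne, orderOf_eq_one_iff]
    intro h1
    apply h.ne
    rw [← inv_of_sq h.aa]
    exact inv_eq_of_mul_eq_one_right h1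
  omega

theorem swap [Finite W] (h : Dih cs D a b) {j : ℕ} (hj : j < orderOf (a * b)) :
    R b a j = R a b (orderOf (a * b) - 1 - j) :=
  R_swap h.aa h.bb (pow_orderOf_eq_one _) hj

theorem R_refl (h : Dih cs D a b) (j : ℕ) : cs.IsReflection (R a b j) := by
  have ha := h.ca.2.1
  have hb := h.cb.2.1
  clear h
  induction j generalizing a b with
  | zero => simpa [R] using ha
  | succ j ih =>
    rw [R_succ]
    have := (ih hb ha).conj a
    rwa [ha.inv] at this

theorem Rm (h : Dih cs D a b) (j : ℕ) : R a b j ∈ D := R_mem j h.ca.1 h.cb.1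
theorem am (h : Dih cs D a b) (j : ℕ) : alt a b j ∈ D := alt_mem j h.ca.1 h.cb.1

theorem n_alt [Finite W] (h : Dih cs D a b) {k : ℕ} (hk : k ≤ orderOf (a * b)) {t : W} (ht : t ∈ D) :
    n cs (alt a b k) t = 1 ↔ ∃ j < k, t = R a b j := by
  induction k generalizing a b t with
  | zero => simp [alt, n_one]
  | succ k ih =>
    have e : alt a b (k+1) = a * alt b a k := rfl
    rw [e, n_mul]
    have hm := D.mul_mem (D.mul_mem (D.inv_mem h.ca.1) ht) h.ca.1
    have ih' := ih h.symm (by rw [h.ord]; omega) hm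
    by_cases hta : t = a
    · subst hta
      have h0 : n cs (alt b t k) (t⁻¹ * t * t) = 0 := by
        rcases zmod2 (n cs (alt b t k) (t⁻¹ * t * t)) with h0 | h0
        · exact h0
        · obtain ⟨j, hj, h1⟩ := ih'.1 h0
          rw [h.swap (by omega)] at h1
          have : R t b 0 = R t b (orderOf (t * b) - 1 - j) := by
            rw [← h1]; simp [R]
          have := R_inj (by omega) (by omega) this
          omega
      rw [h0, canon_self cs h.ca]
      simp only [add_zero, true_iff]
      exact ⟨0, by omega, by simp [R]⟩
    · rw [canon_ne cs h.ca ht hta, zero_add, ih']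
      constructor
      · rintro ⟨j, hj, h1⟩
        refine ⟨j + 1, by omega, ?_⟩
        rw [R_succ, ← h1]
        rw [inv_of_sq h.aa]
        calc t = (a * a) * t * (a * a) := by rw [h.aa]; simp
          _ = _ := by group
      · rintro ⟨j, hj, h1⟩
        rcases j with _ | j
        · exact absurd (by simpa [R] using h1) hta
        · refine ⟨j, by omega, ?_⟩
          rw [h1, R_succ, inv_of_sq h.aa]
          calc _ = (a * a) * R b a j * (a * a) := by group
            _ = _ := by rw [h.aa]; simp

theorem refl_R [Finite W] (h : Dih cs D a b) {t : W} (ht : t ∈ D) (hr : cs.IsReflection t) :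
    ∃ j < orderOf (a * b), t = R a b j := by
  rw [h.clos] at ht
  obtain ⟨z, hz | hz⟩ := dih_mem h.aa h.bb ht
  · exfalso
    have h1 := refl_parity cs hr
    have h2 := refl_parity cs h.ca.2.1
    have h3 := refl_parity cs h.cb.2.1
    rw [hz, map_zpow, map_mul, h2, h3, ← ofAdd_add] at h1
    have : (1 : ZMod 2) + 1 = 0 := by decide
    rw [this, ofAdd_zero, one_zpow] at h1
    revert h1; decide
  · have hm : (0:ℤ) < orderOf (a * b) := by have := h.two; omega
    refine ⟨(z % orderOf (a * b)).toNat, ?_, ?_⟩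
    · have := Int.emod_lt_of_pos z hm
      have := Int.emod_nonneg z hm.ne'
      omega
    · rw [hz, R, ← zpow_natCast, Int.toNat_of_nonneg (Int.emod_nonneg z hm.ne'), zpow_mod_orderOf]

theorem seg [Finite W] (h : Dih cs D a b) (x : W) :
    ∃ k ≤ orderOf (a * b), (∀ t ∈ D, n cs x t = 1 ↔ ∃ j < k, t = R a b j) ∨
      (∀ t ∈ D, n cs x t = 1 ↔ ∃ j < k, t = R b a j) := by
  obtain ⟨d, hd, y, rfl, hy⟩ := min_coset cs D x
  have hd' := hd
  rw [h.clos] at hd'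
  obtain ⟨k, hk, rfl | rfl⟩ := dih_alt h.aa h.bb (pow_orderOf_eq_one _) (by have := h.two; omega) hd'
  · exact ⟨k, hk, Or.inl fun t ht => by rw [n_coset cs hd hy ht, h.n_alt hk ht]⟩
  · exact ⟨k, hk, Or.inr fun t ht => by rw [n_coset cs hd hy ht, h.symm.n_alt (by rwa [h.ord]) ht]⟩

/-- initial segment property : if R i not in N(x), R j in N(x) with i<j then final -/
theorem seg_up [Finite W] (h : Dih cs D a b) (x : W) {i j k : ℕ} (hij : i < j) (hjk : j < k)
    (hk : k < orderOf (a * b)) (h1 : n cs x (R a b i) = 0) (h2 : n cs x (R a b j) = 1) :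
    n cs x (R a b k) = 1 := by
  obtain ⟨p, hp, hs | hs⟩ := h.seg x
  · exfalso
    obtain ⟨q, hq, e⟩ := (hs _ (h.Rm j)).1 h2
    have := R_inj (by omega) (by omega) e
    have := (hs _ (h.Rm i)).2 ⟨i, by omega, rfl⟩
    rw [h1] at this; exact absurd this (by decide)
  · obtain ⟨q, hq, e⟩ := (hs _ (h.Rm j)).1 h2
    rw [h.swap (by omega)] at e
    have := R_inj (by omega) (by omega) e
    refine (hs _ (h.Rm k)).2 ⟨orderOf (a * b) - 1 - k, by omega, ?_⟩
    rw [h.swap (by omega)]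
    congr 1; omega

theorem seg_down [Finite W] (h : Dih cs D a b) (x : W) {i j k : ℕ} (hij : i < j) (hjk : j < k)
    (hk : k < orderOf (a * b)) (h1 : n cs x (R a b k) = 0) (h2 : n cs x (R a b j) = 1) :
    n cs x (R a b i) = 1 := by
  have e : ∀ l, l < orderOf (a * b) → R a b l = R b a (orderOf (a * b) - 1 - l) := by
    intro l hl
    rw [h.swap (by omega)]; congr 1; omega
  rw [e _ (by omega)] at h1 h2 ⊢
  exact h.symm.seg_up x (i := orderOf (a * b) - 1 - k) (j := orderOf (a * b) - 1 - j) (by omega) (by omega)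
    (by rw [h.ord]; omega) h1 h2
end Dih

theorem dih_conj_sub {D : Subgroup W} (hD : IsDihedralSubgroup cs D) (x : W) :
    IsDihedralSubgroup cs (D.map (MulAut.conj x).toMonoidHom) := by
  obtain ⟨t1, t2, h1, h2, rfl⟩ := hD
  refine ⟨x * t1 * x⁻¹, x * t2 * x⁻¹, h1.conj x, h2.conj x, ?_⟩
  rw [MonoidHom.map_closure]
  congr 1
  simp [Set.image_insert_eq]

theorem dih_simple {i j : B} (h : cs.simple i ≠ cs.simple j) :
    Dih cs (Subgroup.closure {cs.simple i, cs.simple j}) (cs.simple i) (cs.simple j) := by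
  refine ⟨⟨_, _, cs.isReflection_simple i, cs.isReflection_simple j, rfl⟩, canon_simple cs ?_, canon_simple cs ?_, h⟩
  · exact Subgroup.subset_closure (by simp)
  · exact Subgroup.subset_closure (by simp)

theorem max_simple {i j : B} (h : cs.simple i ≠ cs.simple j) (x : W) :
    IsMaxDihedralSubgroup cs
      ((Subgroup.closure {cs.simple i, cs.simple j}).map (MulAut.conj x).toMonoidHom) := by
  refine ⟨dih_conj_sub (dih_simple h).dih x, fun D' hD' hle => ?_⟩
  have h1 := dih_conj_sub hD' x⁻¹
  have hm : ∀ y ∈ Subgroup.closure {cs.simple i, cs.simple j}, y ∈ D'.map (MulAut.conj x⁻¹).toMonoidHom := by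
    intro y hy
    refine ⟨x * y * x⁻¹, hle ⟨y, hy, by simp⟩, ?_⟩
    simp only [MulEquiv.toMonoidHom_eq_coe, MonoidHom.coe_coe, MulAut.conj_apply]
    group
  have h2 := canon_pair cs h1 (canon_simple cs (hm _ (Subgroup.subset_closure (by simp))))
    (canon_simple cs (hm (cs.simple j) (Subgroup.subset_closure (by simp)))) h
  rw [← h2]
  apply le_antisymm
  · rw [h2]; exact hle
  · intro y hy
    refine ⟨x⁻¹ * y * x, ⟨y, hy, by simp⟩, ?_⟩
    simp only [MulEquiv.toMonoidHom_eq_coe, MonoidHom.coe_coe, MulAut.conj_apply]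
    group
end C
end MG

set_option linter.unusedSectionVars false
namespace MG
section D
variable {B : Type*} {W : Type*} [Group W] {M : CoxeterMatrix B} {cs : CoxeterSystem M W} [Finite W]

theorem z01 {a : ZMod 2} : a ≠ 1 ↔ a = 0 := by revert a; decide
theorem z10 {a : ZMod 2} : a ≠ 0 ↔ a = 1 := by revert a; decide

theorem ncard_conj (x g : W) : {t | n cs g (x⁻¹ * t * x) = 1}.ncard = cs.length g := by
  rw [length_eq_ncard]
  have : {t | n cs g t = 1} = (fun t => x⁻¹ * t * x) '' {t | n cs g (x⁻¹ * t * x) = 1} := by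
    ext t
    simp only [Set.mem_ofPred_eq, Set.mem_image]
    constructor
    · intro h; refine ⟨x * t * x⁻¹, ?_, by group⟩
      have : x⁻¹ * (x * t * x⁻¹) * x = t := by group
      rwa [this]
    · rintro ⟨s, hs, rfl⟩; exact hs
  rw [this, Set.ncard_image_of_injective]
  intro s t h
  simpa using h

theorem le_iff {u w : W} : weakLE cs u w ↔ ∀ t, n cs u t = 1 → n cs w t = 1 := by
  unfold weakLE
  set X := {t | n cs (u⁻¹ * w) (u⁻¹ * t * u) = 1} with hX
  have hXc : X.ncard = cs.length (u⁻¹ * w) := ncard_conj u _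
  have hn : ∀ t, n cs w t = n cs u t + n cs (u⁻¹ * w) (u⁻¹ * t * u) := by
    intro t; rw [← n_mul]; simp
  rw [← hXc, length_eq_ncard, length_eq_ncard]
  set U := {t | n cs u t = 1} with hU
  set V := {t | n cs w t = 1} with hV
  have hsub : V ⊆ U ∪ X := by
    intro t ht
    simp only [hV, hU, hX, Set.mem_ofPred_eq, Set.mem_union] at *
    rw [hn] at ht
    rcases zmod2 (n cs u t) with h | h
    · right; rwa [h, zero_add] at ht
    · left; exact h
  constructor
  · intro h t ht
    have h1 : V.ncard ≤ (U ∪ X).ncard := Set.ncard_le_ncard hsub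
    have h2 := Set.ncard_union_add_ncard_inter U X
    have h3 : (U ∩ X).ncard = 0 := by omega
    rw [Set.ncard_eq_zero] at h3
    rw [hn, ht]
    rcases zmod2 (n cs (u⁻¹ * w) (u⁻¹ * t * u)) with h | h
    · rw [h]; rfl
    · exfalso
      have : t ∈ U ∩ X := ⟨ht, h⟩
      rw [h3] at this; exact this
  · intro h
    have h3 : U ∩ X = ∅ := by
      ext t
      simp only [hU, hX, Set.mem_inter_iff, Set.mem_ofPred_eq, Set.mem_empty_iff_false, iff_false, not_and]
      intro h1 h2
      have := h t h1
      rw [hn, h1, h2] at this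
      exact absurd this (by decide)
    have h4 : V = U ∪ X := by
      apply Set.Subset.antisymm hsub
      rintro t (ht | ht)
      · exact h t ht
      · simp only [hV, hX, Set.mem_ofPred_eq] at *
        rw [hn, ht]
        rcases zmod2 (n cs u t) with h5 | h5
        · rw [h5]; rfl
        · have := h t h5
          rw [hn, h5, ht] at this; exact absurd this (by decide)
    have h2 := Set.ncard_union_add_ncard_inter U X
    rw [h3, Set.ncard_empty] at h2
    rw [h4]; omega

theorem le_refl' (u : W) : weakLE cs u u := le_iff.2 fun _ h => h
theorem le_tr {u v w : W} (h1 : weakLE cs u v) (h2 : weakLE cs v w) : weakLE cs u w :=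
  le_iff.2 fun t h => le_iff.1 h2 t (le_iff.1 h1 t h)
theorem le_len {u v : W} (h : weakLE cs u v) : cs.length u ≤ cs.length v := by
  unfold weakLE at h; omega
theorem le_eq_len {u v : W} (h : weakLE cs u v) (h2 : cs.length v ≤ cs.length u) : u = v := by
  unfold weakLE at h
  have : cs.length (u⁻¹ * v) = 0 := by omega
  rw [cs.length_eq_zero_iff] at this
  exact (inv_mul_eq_one.1 this)
theorem le_anti {u v : W} (h : weakLE cs u v) (h2 : weakLE cs v u) : u = v :=
  le_eq_len h (le_len h2)
theorem one_le (w : W) : weakLE cs 1 w := by simp [weakLE]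
theorem le_mul {x g : W} : weakLE cs x (x * g) ↔ cs.length (x * g) = cs.length x + cs.length g := by
  unfold weakLE; rw [inv_mul_cancel_left]; exact eq_comm

theorem le_cases {C : Set W} (hC : IsChain (weakLE cs) C) {p q : W} (hp : p ∈ C) (hq : q ∈ C)
    (h : cs.length p ≤ cs.length q) : weakLE cs p q := by
  by_cases e : p = q
  · rw [e]; exact le_refl' q
  · rcases hC hp hq e with h1 | h1
    · exact h1
    · exact absurd (le_eq_len h1 h).symm e

theorem exists_up {u w : W} (h : weakLE cs u w) (hne : u ≠ w) :
    ∃ i, weakLE cs u (u * cs.simple i) ∧ weakLE cs (u * cs.simple i) w ∧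
      cs.length (u * cs.simple i) = cs.length u + 1 := by
  have h1 : u⁻¹ * w ≠ 1 := by rw [Ne, inv_mul_eq_one]; exact hne
  obtain ⟨i, hi⟩ := cs.exists_leftDescent_of_ne_one h1
  rw [cs.isLeftDescent_iff] at hi
  have h2 := cs.length_mul_le u (cs.simple i)
  have h3 := cs.length_mul_le (u * cs.simple i) (cs.simple i * (u⁻¹ * w))
  have h4 : u * cs.simple i * (cs.simple i * (u⁻¹ * w)) = w := by
    rw [mul_assoc, cs.simple_mul_simple_cancel_left]; group
  rw [h4] at h3
  rw [cs.length_simple] at h2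
  unfold weakLE at h ⊢
  have h5 : (u * cs.simple i)⁻¹ * w = cs.simple i * (u⁻¹ * w) := by
    rw [mul_inv_rev, cs.inv_simple, mul_assoc]
  refine ⟨i, ?_, ?_, by omega⟩
  · rw [inv_mul_cancel_left, cs.length_simple]; omega
  · rw [h5]; omega

theorem cov_iff {u w : W} : CovR (weakLE cs) u w ↔
    ∃ i, w = u * cs.simple i ∧ cs.length w = cs.length u + 1 := by
  constructor
  · rintro ⟨h1, h2, h3⟩
    obtain ⟨i, a, b, c⟩ := exists_up h1 h2
    rcases h3 _ a b with h | h
    · rw [h] at c; omega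
    · exact ⟨i, h.symm, by rw [← h, c]⟩
  · rintro ⟨i, rfl, h⟩
    refine ⟨le_mul.2 (by rw [cs.length_simple, h]), fun e => by rw [← e] at h; omega, fun z h1 h2 => ?_⟩
    have l1 := le_len h1
    have l2 := le_len h2
    by_cases e : cs.length z = cs.length u
    · left; exact (le_eq_len h1 (by omega)).symm
    · right; exact le_eq_len h2 (by omega)

/-- the chain of prefixes -/
def chainOf (cs : CoxeterSystem M W) (x : W) (ω : List B) : Set W :=
  {z | ∃ k ≤ ω.length, z = x * cs.wordProd (ω.take k)}

theorem pref_len {x : W} {ω : List B} (h : cs.length (x * cs.wordProd ω) = cs.length x + ω.length)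
    {k : ℕ} (hk : k ≤ ω.length) : cs.length (x * cs.wordProd (ω.take k)) = cs.length x + k := by
  have h1 := cs.length_mul_le x (cs.wordProd (ω.take k))
  have h2 := cs.length_wordProd_le (ω.take k)
  have h3 := cs.length_wordProd_le (ω.drop k)
  have h4 := cs.length_mul_le (x * cs.wordProd (ω.take k)) (cs.wordProd (ω.drop k))
  rw [mul_assoc, ← cs.wordProd_append, List.take_append_drop] at h4
  rw [List.length_take] at h2
  rw [List.length_drop] at h3
  omega

theorem pref_le {x : W} {ω : List B} (h : cs.length (x * cs.wordProd ω) = cs.length x + ω.length)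
    {j k : ℕ} (hj : j ≤ k) (hk : k ≤ ω.length) :
    weakLE cs (x * cs.wordProd (ω.take j)) (x * cs.wordProd (ω.take k)) := by
  have e : ω.take k = ω.take j ++ (ω.take k).drop j := by
    conv_lhs => rw [← List.take_append_drop j (ω.take k)]
    rw [List.take_take, min_eq_left hj]
  have h1 := pref_len h (hj.trans hk)
  have h2 := pref_len h hk
  have h3 : x * cs.wordProd (ω.take k) = x * cs.wordProd (ω.take j) * cs.wordProd ((ω.take k).drop j) := by
    rw [mul_assoc, ← cs.wordProd_append, ← e]
  rw [h3, le_mul, ← h3]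
  have h4 := cs.length_wordProd_le ((ω.take k).drop j)
  have h5 := cs.length_mul_le (x * cs.wordProd (ω.take j)) (cs.wordProd ((ω.take k).drop j))
  rw [← h3] at h5
  rw [List.length_drop, List.length_take, min_eq_left hk] at h4
  omega

theorem chainOf_chain {x : W} {ω : List B} (h : cs.length (x * cs.wordProd ω) = cs.length x + ω.length) :
    IsChain (weakLE cs) (chainOf cs x ω) := by
  rintro _ ⟨j, hj, rfl⟩ _ ⟨k, hk, rfl⟩ _
  rcases le_total j k with h1 | h1
  · left; exact pref_le h h1 hk
  · right; exact pref_le h h1 hj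

theorem chainOf_max {x : W} {ω : List B} (h : cs.length (x * cs.wordProd ω) = cs.length x + ω.length) :
    MaxChainIn (weakLE cs) (IccR (weakLE cs) x (x * cs.wordProd ω)) (chainOf cs x ω) := by
  refine ⟨?_, chainOf_chain h, ?_⟩
  · rintro _ ⟨j, hj, rfl⟩
    have h1 := pref_le h (Nat.zero_le j) hj
    have h2 := pref_le h hj le_rfl
    simp only [List.take_zero, cs.wordProd_nil, mul_one, List.take_length] at h1 h2
    exact ⟨h1, h2⟩
  · intro C hC hch hsub
    apply Set.Subset.antisymm hsub
    intro p hp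
    have l1 := le_len (hC hp).1
    have l2 := le_len (hC hp).2
    have hk : cs.length p - cs.length x ≤ ω.length := by omega
    refine ⟨cs.length p - cs.length x, hk, ?_⟩
    have h3 := pref_len h hk
    exact le_eq_len (le_cases hch hp (hsub ⟨_, hk, rfl⟩) (by omega)) (by omega)

theorem max_ends {x y : W} (hxy : weakLE cs x y) {P : Set W}
    (hP : MaxChainIn (weakLE cs) (IccR (weakLE cs) x y) P) : x ∈ P ∧ y ∈ P := by
  obtain ⟨h1, h2, h3⟩ := hP
  constructor
  · rw [h3 (insert x P) (Set.insert_subset ⟨le_refl' x, hxy⟩ h1)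
      (h2.insert fun b hb _ => Or.inl (h1 hb).1) (Set.subset_insert _ _)]
    exact Set.mem_insert _ _
  · rw [h3 (insert y P) (Set.insert_subset ⟨hxy, le_refl' y⟩ h1)
      (h2.insert fun b hb _ => Or.inr (h1 hb).2) (Set.subset_insert _ _)]
    exact Set.mem_insert _ _

theorem max_step {x y : W} (hxy : weakLE cs x y) {P : Set W}
    (hP : MaxChainIn (weakLE cs) (IccR (weakLE cs) x y) P) {z : W} (hz : z ∈ P) (hne : z ≠ y) :
    ∃ i, z * cs.simple i ∈ P ∧ cs.length (z * cs.simple i) = cs.length z + 1 := by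
  classical
  have hy := (max_ends hxy hP).2
  obtain ⟨h1, h2, h3⟩ := hP
  have hex : ∃ l, ∃ z' ∈ P, z' ≠ z ∧ weakLE cs z z' ∧ cs.length z' = l :=
    ⟨_, y, hy, Ne.symm hne, (h1 hz).2, rfl⟩
  obtain ⟨z', hz', hn', hle, hl⟩ := Nat.find_spec hex
  obtain ⟨i, a, b, c⟩ := exists_up hle (Ne.symm hn')
  refine ⟨i, ?_, c⟩
  rw [h3 (insert (z * cs.simple i) P) ?_ ?_ (Set.subset_insert _ _)]
  · exact Set.mem_insert _ _
  · exact Set.insert_subset ⟨le_tr (h1 hz).1 a, le_tr b (h1 hz').2⟩ h1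
  · refine h2.insert fun p hp _ => ?_
    by_cases e : p = z
    · right; rw [e]; exact a
    · rcases h2 hp hz e with h | h
      · right; exact le_tr h a
      · left
        have := Nat.find_min' hex ⟨p, hp, e, h, rfl⟩
        exact le_tr b (le_cases h2 hz' hp (by omega))

theorem max_word {x y : W} (hxy : weakLE cs x y) {P : Set W}
    (hP : MaxChainIn (weakLE cs) (IccR (weakLE cs) x y) P) :
    ∃ ω : List B, y = x * cs.wordProd ω ∧ cs.length y = cs.length x + ω.length ∧ P = chainOf cs x ω := by
  have key : ∀ d : ℕ, ∀ z ∈ P, cs.length y - cs.length z = d →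
      ∃ ω : List B, y = z * cs.wordProd ω ∧ cs.length y = cs.length z + ω.length ∧
        ∀ k, z * cs.wordProd (ω.take k) ∈ P := by
    intro d
    induction d with
    | zero =>
      intro z hz hd
      have := le_eq_len (hP.1 hz).2 (by omega)
      subst this
      exact ⟨[], by simp, by simp, fun k => by simpa using hz⟩
    | succ d ih =>
      intro z hz hd
      obtain ⟨i, h1, h2⟩ := max_step hxy hP hz (by rintro rfl; omega)
      obtain ⟨ω, h3, h4, h5⟩ := ih _ h1 (by omega)
      refine ⟨i :: ω, by rw [cs.wordProd_cons, ← mul_assoc]; exact h3, by simp; omega, ?_⟩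
      rintro (_ | k)
      · simpa using hz
      · rw [List.take_succ_cons, cs.wordProd_cons, ← mul_assoc]; exact h5 k
  obtain ⟨ω, h1, h2, h3⟩ := key _ x (max_ends hxy hP).1 rfl
  refine ⟨ω, h1, h2, ?_⟩
  subst h1
  exact ((chainOf_max h2).2.2 P hP.1 hP.2.1 (by rintro _ ⟨k, _, rfl⟩; exact h3 k)).symm

/-! top element -/
theorem n_top {w₀ : W} (hw₀ : ∀ w : W, cs.length w ≤ cs.length w₀) {t : W} (ht : cs.IsReflection t) : n cs w₀ t = 1 := by
  rw [n_iff cs ht]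
  exact lt_of_le_of_ne (hw₀ _) (ht.length_mul_right_ne _)

theorem le_top' {w₀ : W} (hw₀ : ∀ w : W, cs.length w ≤ cs.length w₀) (w : W) : weakLE cs w w₀ :=
  le_iff.2 fun _ h => n_top hw₀ (n_lt cs h).1

theorem icc_univ {w₀ : W} (hw₀ : ∀ w : W, cs.length w ≤ cs.length w₀) : IccR (weakLE cs) 1 w₀ = Set.univ := by
  ext z; simp [IccR, one_le, le_top' hw₀]

theorem maxChain_iff {w₀ : W} (hw₀ : ∀ w : W, cs.length w ≤ cs.length w₀) {C : Set W} : IsMaxChain (weakLE cs) C ↔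
    MaxChainIn (weakLE cs) (IccR (weakLE cs) 1 w₀) C := by
  rw [icc_univ hw₀]
  constructor
  · rintro ⟨h1, h2⟩; exact ⟨Set.subset_univ _, h1, fun C' _ h3 h4 => h2 h3 h4⟩
  · rintro ⟨_, h1, h2⟩; exact ⟨h1, fun C' h3 h4 => h2 C' (Set.subset_univ _) h3 h4⟩

theorem maxChain_word {w₀ : W} (hw₀ : ∀ w : W, cs.length w ≤ cs.length w₀) {C : Set W} (h : IsMaxChain (weakLE cs) C) :
    ∃ ω, cs.IsReduced ω ∧ cs.wordProd ω = w₀ ∧ C = chainOf cs 1 ω := by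
  obtain ⟨ω, h1, h2, h3⟩ := max_word (one_le w₀) ((maxChain_iff hw₀).1 h)
  rw [one_mul] at h1
  refine ⟨ω, ?_, h1.symm, h3⟩
  unfold CoxeterSystem.IsReduced
  rw [← h1, h2, cs.length_one, zero_add]

theorem word_maxChain {w₀ : W} (hw₀ : ∀ w : W, cs.length w ≤ cs.length w₀) {ω : List B} (h : cs.IsReduced ω) (hp : cs.wordProd ω = w₀) :
    IsMaxChain (weakLE cs) (chainOf cs 1 ω) := by
  rw [maxChain_iff hw₀]
  have := chainOf_max (cs := cs) (x := 1) (ω := ω) (by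
    rw [one_mul, cs.length_one, zero_add]; exact h)
  rwa [one_mul, hp] at this
end D
end MG

set_option linter.unusedSectionVars false
namespace MG
section E
variable {B : Type*} {W : Type*} [Group W] {M : CoxeterMatrix B} {cs : CoxeterSystem M W} [Finite W]

def altW (i j : B) : ℕ → List B
  | 0 => []
  | k + 1 => i :: altW j i k

theorem altW_len (i j : B) (k : ℕ) : (altW i j k).length = k := by
  induction k generalizing i j with
  | zero => rfl
  | succ k ih => simp [altW, ih]

theorem altW_prod (i j : B) (k : ℕ) : cs.wordProd (altW i j k) = alt (cs.simple i) (cs.simple j) k := by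
  induction k generalizing i j with
  | zero => simp [altW, alt]
  | succ k ih => simp [altW, alt, ih, cs.wordProd_cons]

theorem altW_take (i j : B) {l k : ℕ} (h : l ≤ k) : (altW i j k).take l = altW i j l := by
  induction k generalizing i j l with
  | zero => obtain rfl : l = 0 := by omega
            rfl
  | succ k ih =>
    rcases l with _ | l
    · rfl
    · simp only [altW, List.take_succ_cons]; rw [ih _ _ (by omega)]

theorem n_out {i j : B} {d t : W} (hd : d ∈ Subgroup.closure {cs.simple i, cs.simple j})
    (ht : t ∉ Subgroup.closure {cs.simple i, cs.simple j}) : n cs d t = 0 := by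
  classical
  have key : ∀ s ∈ ({cs.simple i, cs.simple j} : Set W), ∀ y : W,
      (∀ t, t ∉ Subgroup.closure {cs.simple i, cs.simple j} → n cs y t = 0) →
      ∀ t, t ∉ Subgroup.closure {cs.simple i, cs.simple j} → n cs (s * y) t = 0 := by
    intro s hs y hy t ht
    have hsD := Subgroup.subset_closure hs
    rw [n_mul, hy _ (fun h => ht ?_)]
    · rcases hs with rfl | rfl
      all_goals rw [n_simple, if_neg, add_zero]; rintro rfl; exact ht hsD
    · have := Subgroup.mul_mem _ (Subgroup.mul_mem _ hsD h) (Subgroup.inv_mem _ hsD)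
      have e : s * (s⁻¹ * t * s) * s⁻¹ = t := by group
      rwa [e] at this
  have : ∀ t, t ∉ Subgroup.closure {cs.simple i, cs.simple j} → n cs d t = 0 := by
    induction hd using Subgroup.closure_induction_left with
    | one => intro t _; exact n_one cs t
    | mul_left x hx y hy ih => exact key x hx y ih
    | inv_mul_cancel x hx y hy ih =>
      have : x⁻¹ = x := by rcases hx with rfl | rfl <;> exact cs.inv_simple _
      rw [this]; exact key x hx y ih
  exact this t ht

variable {i j : B}

theorem len_alt (h : cs.simple i ≠ cs.simple j) {k : ℕ} (hk : k ≤ orderOf (cs.simple i * cs.simple j)) :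
    cs.length (alt (cs.simple i) (cs.simple j) k) = k := by
  have hd := dih_simple h
  rw [length_eq_ncard]
  have : {t | n cs (alt (cs.simple i) (cs.simple j) k) t = 1} = R (cs.simple i) (cs.simple j) '' (Set.Iio k) := by
    ext t
    simp only [Set.mem_ofPred_eq, Set.mem_image, Set.mem_Iio]
    by_cases ht : t ∈ Subgroup.closure {cs.simple i, cs.simple j}
    · rw [hd.n_alt hk ht]
      simp only [eq_comm]
    · rw [n_out (hd.am k) ht]
      constructor
      · intro h; exact absurd h (by decide)
      · rintro ⟨l, _, rfl⟩; exact absurd (hd.Rm l) ht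
  rw [this, Set.InjOn.ncard_image]
  · simp [Set.ncard_eq_toFinset_card']
  · intro p hp q hq e
    simp only [Set.mem_Iio] at hp hq
    exact R_inj (by omega) (by omega) e

/-- one side of a polygon -/
def side (x a b : W) (m : ℕ) : Set W := {z | ∃ k ≤ m, z = x * alt a b k}

theorem side_chainOf (x : W) (i j : B) (m : ℕ) :
    side x (cs.simple i) (cs.simple j) m = chainOf cs x (altW i j m) := by
  ext z
  simp only [side, chainOf, Set.mem_ofPred_eq, altW_len]
  constructor
  · rintro ⟨k, hk, rfl⟩; exact ⟨k, hk, by rw [altW_take _ _ hk, altW_prod]⟩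
  · rintro ⟨k, hk, rfl⟩; exact ⟨k, hk, by rw [altW_take _ _ hk, altW_prod]⟩

theorem chainOf_mono (x : W) (u v : List B) : chainOf cs x u ⊆ chainOf cs x (u ++ v) := by
  rintro _ ⟨k, hk, rfl⟩
  exact ⟨k, by simp; omega, by rw [List.take_append_of_le_length hk]⟩

/-- canonical polygon data -/
structure Pol (cs : CoxeterSystem M W) (x : W) (i j : B) : Prop where
  ne : cs.simple i ≠ cs.simple j
  len : cs.length (x * alt (cs.simple i) (cs.simple j) (orderOf (cs.simple i * cs.simple j))) =
    cs.length x + orderOf (cs.simple i * cs.simple j)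

theorem Pol.symm {x : W} (h : Pol cs x i j) : Pol cs x j i := by
  refine ⟨h.ne.symm, ?_⟩
  have hd := dih_simple h.ne
  rw [hd.ord, ← alt_symm hd.aa hd.bb (pow_orderOf_eq_one _), h.len]

/-- if both a and b are inversions of g -/
theorem top_factor (h : cs.simple i ≠ cs.simple j) {g : W} (h1 : n cs g (cs.simple i) = 1)
    (h2 : n cs g (cs.simple j) = 1) : ∃ y,
    g = alt (cs.simple i) (cs.simple j) (orderOf (cs.simple i * cs.simple j)) * y ∧
    cs.length g = orderOf (cs.simple i * cs.simple j) + cs.length y := by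
  have hd := dih_simple h
  obtain ⟨d, hdD, y, rfl, hy⟩ := min_coset cs (Subgroup.closure {cs.simple i, cs.simple j}) g
  have h2' := hd.two
  have key : d = alt (cs.simple i) (cs.simple j) (orderOf (cs.simple i * cs.simple j)) := by
    rw [n_coset cs hdD hy hd.ca.1] at h1
    rw [n_coset cs hdD hy hd.cb.1] at h2
    obtain ⟨k, hk, rfl | rfl⟩ := dih_alt hd.aa hd.bb (pow_orderOf_eq_one _) (by omega) hdD
    · rw [hd.n_alt hk hd.cb.1] at h2
      obtain ⟨l, hl, e⟩ := h2
      have e2 : cs.simple j = R (cs.simple j) (cs.simple i) 0 := by simp [R]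
      rw [hd.swap (by omega)] at e2
      have := R_inj (by omega) (by omega) (e.symm.trans e2)
      congr 1; omega
    · rw [hd.symm.n_alt (by rwa [hd.ord]) hd.ca.1] at h1
      obtain ⟨l, hl, e⟩ := h1
      have e2 : cs.simple i = R (cs.simple i) (cs.simple j) 0 := by simp [R]
      rw [hd.swap (by omega)] at e
      have := R_inj (by omega) (by omega) (e2.symm.trans e)
      rw [alt_symm hd.aa hd.bb (pow_orderOf_eq_one _)]
      congr 1; omega
  refine ⟨y, by rw [← key], ?_⟩
  have : weakLE cs d (d * y) := by
    rw [le_iff]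
    intro t ht
    by_cases htD : t ∈ Subgroup.closure {cs.simple i, cs.simple j}
    · rw [n_coset cs hdD hy htD, ht]
    · rw [n_out hdD htD] at ht; exact absurd ht (by decide)
  rw [le_mul.1 this, key, len_alt h le_rfl]

theorem E1 {x y : W} {P₁ P₂ : Set W} (h : IsPolygonPair (weakLE cs) x y P₁ P₂) :
    ∃ i j, Pol cs x i j ∧
      y = x * alt (cs.simple i) (cs.simple j) (orderOf (cs.simple i * cs.simple j)) ∧
      P₁ = side x (cs.simple i) (cs.simple j) (orderOf (cs.simple i * cs.simple j)) ∧
      P₂ = side x (cs.simple j) (cs.simple i) (orderOf (cs.simple i * cs.simple j)) := by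
  obtain ⟨hxy, m1, m2, hne, hU, hI, hex⟩ := h
  obtain ⟨u, hu1, hu2, hu3⟩ := max_word hxy m1
  obtain ⟨v, hv1, hv2, hv3⟩ := max_word hxy m2
  rcases u with _ | ⟨i, u⟩
  · exfalso; apply hne
    have : v = [] := by rw [← List.length_eq_zero_iff]; simp at hu2; omega
    rw [hu3, hv3, this]
  rcases v with _ | ⟨j, v⟩
  · exfalso; simp at hu2 hv2; omega
  have hi : x * cs.simple i ∈ P₁ := by rw [hu3]; exact ⟨1, by simp, by simp [cs.wordProd_cons]⟩
  have hj : x * cs.simple j ∈ P₂ := by rw [hv3]; exact ⟨1, by simp, by simp [cs.wordProd_cons]⟩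
  have li : cs.length (x * cs.simple i) = cs.length x + 1 := by
    have := pref_len (k := 1) (hu1 ▸ hu2) (by simp); simpa [cs.wordProd_cons] using this
  have lj : cs.length (x * cs.simple j) = cs.length x + 1 := by
    have := pref_len (k := 1) (hv1 ▸ hv2) (by simp); simpa [cs.wordProd_cons] using this
  have hij : cs.simple i ≠ cs.simple j := by
    intro e
    have : x * cs.simple i ∈ P₁ ∩ P₂ := ⟨hi, by rw [e]; exact hj⟩
    rw [hI] at this
    rcases this with h | h
    · rw [h] at li; omega
    · rw [Set.mem_singleton_iff] at h
      rw [h] at li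
      simp only [List.length_cons] at hu2 hv2
      have a1 : u = [] := by rw [← List.length_eq_zero_iff]; omega
      have a2 : v = [] := by rw [← List.length_eq_zero_iff]; omega
      subst a1 a2
      apply hne
      rw [hu3, hv3]
      ext z
      constructor
      · rintro ⟨k, hk, rfl⟩; refine ⟨k, hk, ?_⟩
        rcases k with _ | k <;> simp [cs.wordProd_cons, e]
      · rintro ⟨k, hk, rfl⟩; refine ⟨k, hk, ?_⟩
        rcases k with _ | k <;> simp [cs.wordProd_cons, e]
  have hd := dih_simple hij
  have inv : ∀ l, weakLE cs (x * cs.simple l) y → cs.length (x * cs.simple l) = cs.length x + 1 →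
      n cs (x⁻¹ * y) (cs.simple l) = 1 := by
    classical
    intro l hl hll
    have h0 := le_iff.1 (le_mul.2 (by rw [cs.length_simple, hll] : cs.length (x * cs.simple l) = cs.length x + cs.length (cs.simple l)))
    have hx : n cs x (x * cs.simple l * x⁻¹) = 0 := by
      rw [← z01]
      intro h1
      have := h0 _ h1
      have e : x⁻¹ * (x * cs.simple l * x⁻¹) * x = cs.simple l := by group
      rw [n_mul, h1, e, n_simple, if_pos rfl] at this
      exact absurd this (by decide)
    have h3 : n cs (x * cs.simple l) (x * cs.simple l * x⁻¹) = 1 := by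
      have e : x⁻¹ * (x * cs.simple l * x⁻¹) * x = cs.simple l := by group
      rw [n_mul, hx, e, n_simple, if_pos rfl, zero_add]
    have h4 := le_iff.1 hl _ h3
    have e2 : y = x * (x⁻¹ * y) := by group
    have e : x⁻¹ * (x * cs.simple l * x⁻¹) * x = cs.simple l := by group
    rw [e2, n_mul, hx, e, zero_add] at h4
    exact h4
  have ni := inv i (m1.1 hi).2 li
  have nj := inv j (m2.1 hj).2 lj
  obtain ⟨y', hy', hl'⟩ := top_factor hij ni nj
  set m := orderOf (cs.simple i * cs.simple j) with hm
  have h2 := hd.two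
  obtain ⟨ω, hω, hωp⟩ := cs.exists_isReduced y'
  unfold CoxeterSystem.IsReduced at hω
  unfold weakLE at hxy
  have hs := alt_symm hd.aa hd.bb (pow_orderOf_eq_one _)
  rw [← hm] at hs
  have mk : ∀ p q : B, alt (cs.simple i) (cs.simple j) m = alt (cs.simple p) (cs.simple q) m →
      MaxChainIn (weakLE cs) (IccR (weakLE cs) x y) (chainOf cs x (altW p q m ++ ω)) := by
    intro p q hpq
    have e : x * cs.wordProd (altW p q m ++ ω) = y := by
      rw [cs.wordProd_append, altW_prod, ← hpq, ← hωp, ← hy']; group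
    have := chainOf_max (cs := cs) (x := x) (ω := altW p q m ++ ω) (by
      rw [e, List.length_append, altW_len, ← hω, ← hωp]; omega)
    rwa [e] at this
  have c1 := mk i j rfl
  have c2 := mk j i hs
  have mem : ∀ (p q : B) (k : ℕ), k ≤ m → x * alt (cs.simple p) (cs.simple q) k ∈ chainOf cs x (altW p q m ++ ω) := by
    intro p q k hk
    refine ⟨k, by rw [List.length_append, altW_len]; omega, ?_⟩
    rw [List.take_append_of_le_length (by rw [altW_len]; exact hk), altW_take _ _ hk, altW_prod]
  have diff : ∀ P, IsChain (weakLE cs) P → x * cs.simple i ∈ P → x * cs.simple j ∈ P → False := by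
    intro P hP a b
    exact hij (mul_left_cancel (le_eq_len (le_cases hP a b (by omega)) (by omega)))
  have q1 : P₁ = chainOf cs x (altW i j m ++ ω) := by
    rcases hex _ c1 with h | h
    · exact h.symm
    · exfalso; apply diff P₂ m2.2.1 _ hj
      rw [← h]; simpa [alt] using mem i j 1 (by omega)
  have q2 : P₂ = chainOf cs x (altW j i m ++ ω) := by
    rcases hex _ c2 with h | h
    · exfalso; apply diff P₁ m1.2.1 hi
      rw [← h]; simpa [alt] using mem j i 1 (by omega)
    · exact h.symm
  have hz : x * alt (cs.simple i) (cs.simple j) m ∈ P₁ ∩ P₂ := by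
    refine ⟨by rw [q1]; exact mem i j m le_rfl, ?_⟩
    rw [q2, hs]; exact mem j i m le_rfl
  have lz := len_alt hij (le_refl _)
  rw [← hm] at lz
  have hzy : x * alt (cs.simple i) (cs.simple j) m = y := by
    rw [hI] at hz
    rcases hz with h | h
    · have : alt (cs.simple i) (cs.simple j) m = 1 := by simpa using h
      rw [this, cs.length_one] at lz; omega
    · exact h
  have hy1 : ω = [] := by
    rw [← List.length_eq_zero_iff, ← hω, ← hωp]
    rw [← hzy, inv_mul_cancel_left, lz] at hl'
    omega
  subst hy1
  rw [List.append_nil, ← side_chainOf] at q1 q2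
  refine ⟨i, j, ⟨hij, ?_⟩, hzy.symm, q1, q2⟩
  rw [← hm, hzy, ← hxy, ← hzy, inv_mul_cancel_left, lz]

end E
end MG

set_option linter.unusedSectionVars false
namespace MG
section F
variable {B : Type*} {W : Type*} [Group W] {M : CoxeterMatrix B} {cs : CoxeterSystem M W} [Finite W]
variable {i j : B}

theorem pos_of_mem_alt (h : cs.simple i ≠ cs.simple j) {k : ℕ}
    (hk : k ≤ orderOf (cs.simple i * cs.simple j))
    (h1 : n cs (alt (cs.simple j) (cs.simple i) k) (cs.simple i) = 1) :
    k = orderOf (cs.simple i * cs.simple j) := by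
  have hd := dih_simple h
  rw [hd.symm.n_alt (by rwa [hd.ord]) hd.ca.1] at h1
  obtain ⟨l, hl, e⟩ := h1
  have e2 : cs.simple i = R (cs.simple i) (cs.simple j) 0 := by simp [R]
  rw [hd.swap (by omega)] at e
  have := R_inj (by omega) (by omega) (e2.symm.trans e)
  omega

namespace Pol
variable {x : W}

theorem prefLen (h : Pol cs x i j) {k : ℕ} (hk : k ≤ orderOf (cs.simple i * cs.simple j)) :
    cs.length (x * alt (cs.simple i) (cs.simple j) k) = cs.length x + k := by
  have := pref_len (cs := cs) (x := x) (ω := altW i j (orderOf (cs.simple i * cs.simple j)))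
    (by rw [altW_prod, altW_len, h.len]) (k := k) (by rw [altW_len]; exact hk)
  rwa [altW_take _ _ hk, altW_prod] at this

theorem prefLe (h : Pol cs x i j) {l k : ℕ} (hl : l ≤ k) (hk : k ≤ orderOf (cs.simple i * cs.simple j)) :
    weakLE cs (x * alt (cs.simple i) (cs.simple j) l) (x * alt (cs.simple i) (cs.simple j) k) := by
  have := pref_le (cs := cs) (x := x) (ω := altW i j (orderOf (cs.simple i * cs.simple j)))
    (by rw [altW_prod, altW_len, h.len]) hl (by rw [altW_len]; exact hk)
  rwa [altW_take _ _ hk, altW_take _ _ (hl.trans hk), altW_prod, altW_prod] at this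

theorem sym (h : Pol cs x i j) : alt (cs.simple j) (cs.simple i) (orderOf (cs.simple i * cs.simple j)) =
    alt (cs.simple i) (cs.simple j) (orderOf (cs.simple i * cs.simple j)) :=
  (alt_symm (dih_simple h.ne).aa (dih_simple h.ne).bb (pow_orderOf_eq_one _)).symm

theorem sideMax (h : Pol cs x i j) : MaxChainIn (weakLE cs) (IccR (weakLE cs) x
    (x * alt (cs.simple i) (cs.simple j) (orderOf (cs.simple i * cs.simple j))))
    (side x (cs.simple i) (cs.simple j) (orderOf (cs.simple i * cs.simple j))) := by
  rw [side_chainOf]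
  have := chainOf_max (cs := cs) (x := x) (ω := altW i j (orderOf (cs.simple i * cs.simple j)))
    (by rw [altW_prod, altW_len, h.len])
  rwa [altW_prod] at this

/-- reflections of the polygon are not inversions of x -/
theorem n_x (h : Pol cs x i j) {t : W} (ht : t ∈ Subgroup.closure {cs.simple i, cs.simple j})
    (hr : cs.IsReflection t) : n cs x (x * t * x⁻¹) = 0 := by
  have hd := dih_simple h.ne
  rw [← z01]
  intro h1
  have h2 := le_iff.1 (le_mul.2 (by rw [h.len, len_alt h.ne le_rfl])) _ h1
  have e : x⁻¹ * (x * t * x⁻¹) * x = t := by group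
  obtain ⟨l, hl, e2⟩ := hd.refl_R ht hr
  rw [n_mul, h1, e, (hd.n_alt le_rfl ht).2 ⟨l, hl, e2⟩] at h2
  exact absurd h2 (by decide)

theorem inIcc (h : Pol cs x i j) {z : W} (hz : z ∈ IccR (weakLE cs) x
    (x * alt (cs.simple i) (cs.simple j) (orderOf (cs.simple i * cs.simple j)))) :
    ∃ k ≤ orderOf (cs.simple i * cs.simple j), z = x * alt (cs.simple i) (cs.simple j) k ∨
      z = x * alt (cs.simple j) (cs.simple i) k := by
  have hd := dih_simple h.ne
  obtain ⟨h1, h2⟩ := hz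
  have hg : weakLE cs (x⁻¹ * z) (alt (cs.simple i) (cs.simple j) (orderOf (cs.simple i * cs.simple j))) := by
    have l1 := len_alt h.ne le_rfl
    have l2 := h.len
    unfold weakLE at *
    have e : (x⁻¹ * z)⁻¹ * alt (cs.simple i) (cs.simple j) (orderOf (cs.simple i * cs.simple j)) =
      z⁻¹ * (x * alt (cs.simple i) (cs.simple j) (orderOf (cs.simple i * cs.simple j))) := by group
    rw [e, l1]
    omega
  have hg0 : ∀ t, t ∉ Subgroup.closure {cs.simple i, cs.simple j} → n cs (x⁻¹ * z) t = 0 := by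
    intro t ht
    rw [← z01]
    intro h3
    have := le_iff.1 hg _ h3
    rw [n_out (hd.am _) ht] at this
    exact absurd this (by decide)
  obtain ⟨d, hdD, y, e, hy⟩ := min_coset cs (Subgroup.closure {cs.simple i, cs.simple j}) (x⁻¹ * z)
  have hy1 : y = 1 := by
    apply n_eq_zero_all cs
    intro t
    by_cases ht : t ∈ Subgroup.closure {cs.simple i, cs.simple j}
    · exact hy t ht
    · have hnt : d * t * d⁻¹ ∉ Subgroup.closure {cs.simple i, cs.simple j} := by
        intro h3
        apply ht
        have := Subgroup.mul_mem _ (Subgroup.mul_mem _ (Subgroup.inv_mem _ hdD) h3) hdD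
        have e : d⁻¹ * (d * t * d⁻¹) * d = t := by group
        rwa [e] at this
      have h4 := hg0 _ hnt
      have e4 : d⁻¹ * (d * t * d⁻¹) * d = t := by group
      rwa [e, n_mul, n_out hdD hnt, e4, zero_add] at h4
  rw [hy1, mul_one] at e
  have e' : z = x * d := by rw [← e]; group
  obtain ⟨k, hk, hh⟩ := dih_alt hd.aa hd.bb (pow_orderOf_eq_one _) (by have := hd.two; omega) hdD
  refine ⟨k, hk, ?_⟩
  rw [e']
  rcases hh with rfl | rfl
  · left; rfl
  · right; rfl

theorem E2half (h : Pol cs x i j) {C : Set W} (hC : MaxChainIn (weakLE cs) (IccR (weakLE cs) x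
    (x * alt (cs.simple i) (cs.simple j) (orderOf (cs.simple i * cs.simple j)))) C)
    (hm : x * cs.simple i ∈ C) :
    C = side x (cs.simple i) (cs.simple j) (orderOf (cs.simple i * cs.simple j)) := by
  have hd := dih_simple h.ne
  have h2 := hd.two
  refine hC.2.2 _ h.sideMax.1 h.sideMax.2.1 ?_
  intro p hp
  obtain ⟨k, hk, e | e⟩ := h.inIcc (hC.1 hp)
  · exact ⟨k, hk, e⟩
  · by_cases hk0 : k = 0
    · subst hk0; exact ⟨0, hk, by rw [e]; simp [alt]⟩
    · have l1 := h.prefLen (k := 1) (by omega)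
      have l2 := h.symm.prefLen (k := k) (by rw [hd.ord]; omega)
      have e1 : alt (cs.simple i) (cs.simple j) 1 = cs.simple i := by simp [alt]
      rw [e1] at l1
      have hle := le_cases hC.2.1 hm hp (by rw [e]; omega)
      have nx := h.n_x hd.ca.1 hd.ca.2.1
      have e3 : x⁻¹ * (x * cs.simple i * x⁻¹) * x = cs.simple i := by group
      have := le_iff.1 hle (x * cs.simple i * x⁻¹) (by
        rw [n_mul, nx, e3, canon_self cs hd.ca, zero_add])
      rw [e, n_mul, nx, e3, zero_add] at this
      have := pos_of_mem_alt h.ne hk this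
      subst this
      exact ⟨_, le_rfl, by rw [e, h.sym]⟩

theorem E2 (h : Pol cs x i j) : IsPolygonPair (weakLE cs) x
    (x * alt (cs.simple i) (cs.simple j) (orderOf (cs.simple i * cs.simple j)))
    (side x (cs.simple i) (cs.simple j) (orderOf (cs.simple i * cs.simple j)))
    (side x (cs.simple j) (cs.simple i) (orderOf (cs.simple i * cs.simple j))) := by
  have hd := dih_simple h.ne
  have h2 := hd.two
  have s1 := h.sideMax
  have s2 := h.symm.sideMax
  rw [hd.ord, h.sym] at s2
  have hI : side x (cs.simple i) (cs.simple j) (orderOf (cs.simple i * cs.simple j)) ∩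
      side x (cs.simple j) (cs.simple i) (orderOf (cs.simple i * cs.simple j)) =
      {x, x * alt (cs.simple i) (cs.simple j) (orderOf (cs.simple i * cs.simple j))} := by
    ext z
    constructor
    · rintro ⟨⟨k, hk, rfl⟩, ⟨l, hl, e⟩⟩
      have e' := mul_left_cancel e
      have l1 := len_alt h.ne hk
      have l2 := len_alt h.symm.ne (k := l) (by rw [hd.ord]; omega)
      rw [← e', l1] at l2
      subst l2
      by_cases hk0 : k = 0
      · left; subst hk0; simp [alt]
      · right
        have : n cs (alt (cs.simple j) (cs.simple i) k) (cs.simple i) = 1 := by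
          rw [← e', hd.n_alt hk hd.ca.1]
          exact ⟨0, by omega, by simp [R]⟩
        rw [pos_of_mem_alt h.ne hk this]; rfl
    · rintro (rfl | rfl)
      · exact ⟨⟨0, by omega, by simp [alt]⟩, ⟨0, by omega, by simp [alt]⟩⟩
      · exact ⟨⟨_, le_rfl, rfl⟩, ⟨_, le_rfl, by rw [h.sym]⟩⟩
  have hle : weakLE cs x (x * alt (cs.simple i) (cs.simple j) (orderOf (cs.simple i * cs.simple j))) :=
    le_mul.2 (by rw [h.len, len_alt h.ne le_rfl])
  refine ⟨hle, s1, s2, ?_, ?_, hI, ?_⟩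
  · intro e
    rw [← e, Set.inter_self] at hI
    have : x * cs.simple i ∈ side x (cs.simple i) (cs.simple j) (orderOf (cs.simple i * cs.simple j)) :=
      ⟨1, by omega, by simp [alt]⟩
    have l1 := h.prefLen (k := 1) (by omega)
    have l2 := h.len
    have e1 : alt (cs.simple i) (cs.simple j) 1 = cs.simple i := by simp [alt]
    rw [e1] at l1
    rw [hI] at this
    rcases this with h3 | h3
    · rw [h3] at l1; omega
    · rw [Set.mem_singleton_iff] at h3; rw [h3] at l1; omega
  · apply Set.Subset.antisymm
    · intro z hz
      obtain ⟨k, hk, e | e⟩ := h.inIcc hz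
      · left; exact ⟨k, hk, e⟩
      · right; exact ⟨k, hk, e⟩
    · exact Set.union_subset s1.1 s2.1
  · intro C hC
    have hx := max_ends hle hC
    obtain ⟨l, hl1, hl2⟩ := max_step hle hC hx.1 (by
      intro e
      have := h.len
      rw [← e] at this; omega)
    obtain ⟨k, hk, e | e⟩ := h.inIcc (hC.1 hl1)
    · left
      have := h.prefLen hk
      rw [e, this] at hl2
      have : k = 1 := by omega
      subst this
      apply h.E2half hC
      rw [e] at hl1; simpa [alt] using hl1
    · right
      have := h.symm.prefLen (k := k) (by rw [hd.ord]; omega)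
      rw [e, this] at hl2
      have : k = 1 := by omega
      subst this
      have := h.symm.E2half (C := C) (by rw [hd.ord, h.sym]; exact hC)
        (by rw [e] at hl1; simpa [alt] using hl1)
      rwa [hd.ord] at this

theorem ncard (h : Pol cs x i j) : (IccR (weakLE cs) x
    (x * alt (cs.simple i) (cs.simple j) (orderOf (cs.simple i * cs.simple j)))).ncard =
    2 * orderOf (cs.simple i * cs.simple j) := by
  have hd := dih_simple h.ne
  have h2 := hd.two
  obtain ⟨_, _, _, _, hU, hI, _⟩ := h.E2
  have key : ∀ {i j : B}, Pol cs x i j →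
      (side x (cs.simple i) (cs.simple j) (orderOf (cs.simple i * cs.simple j))).ncard =
      orderOf (cs.simple i * cs.simple j) + 1 := by
    intro i j h
    have : side x (cs.simple i) (cs.simple j) (orderOf (cs.simple i * cs.simple j)) =
      (fun k => x * alt (cs.simple i) (cs.simple j) k) '' Set.Iic (orderOf (cs.simple i * cs.simple j)) := by
      ext z; simp only [side, Set.mem_ofPred_eq, Set.mem_image, Set.mem_Iic, eq_comm]
    rw [this, Set.InjOn.ncard_image]
    · simp [Set.ncard_eq_toFinset_card']
    · intro p hp q hq e
      have l1 := h.prefLen hp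
      have l2 := h.prefLen hq
      simp only at e
      rw [e, l2] at l1; omega
  have k1 := key h
  have k2 := key h.symm
  rw [hd.ord] at k2
  have k3 := Set.ncard_union_add_ncard_inter
    (side x (cs.simple i) (cs.simple j) (orderOf (cs.simple i * cs.simple j)))
    (side x (cs.simple j) (cs.simple i) (orderOf (cs.simple i * cs.simple j)))
  rw [hU]
  rw [hI, k1, k2, Set.ncard_pair] at k3
  · omega
  · intro e
    have := h.len
    rw [← e] at this; omega

theorem ncard4 (h : Pol cs x i j) : (IccR (weakLE cs) x
    (x * alt (cs.simple i) (cs.simple j) (orderOf (cs.simple i * cs.simple j)))).ncard = 4 ↔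
    cs.simple i * cs.simple j = cs.simple j * cs.simple i := by
  have hd := dih_simple h.ne
  have h2 := hd.two
  rw [h.ncard]
  have e : (cs.simple i * cs.simple j) ^ 2 = 1 ↔ cs.simple i * cs.simple j = cs.simple j * cs.simple i := by
    rw [pow_two, mul_eq_one_iff_eq_inv, mul_inv_rev, cs.inv_simple, cs.inv_simple]
  rw [← e]
  constructor
  · intro h3
    have : orderOf (cs.simple i * cs.simple j) = 2 := by omega
    rw [← this]; exact pow_orderOf_eq_one _
  · intro h3
    have := orderOf_le_of_pow_eq_one (by norm_num) h3
    omega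
end Pol
end F
end MG

set_option linter.unusedSectionVars false
namespace MG
section Gg
variable {B : Type*} {W : Type*} [Group W] {M : CoxeterMatrix B} {cs : CoxeterSystem M W} [Finite W]
variable {i j : B}

def bef (cs : CoxeterSystem M W) (C : Set W) (t t' : W) : Prop := ∃ x ∈ C, n cs x t = 1 ∧ n cs x t' = 0

theorem bef_ne {C : Set W} {t t' : W} (h : bef cs C t t') : t ≠ t' := by
  rintro rfl
  obtain ⟨x, _, h1, h2⟩ := h
  rw [h1] at h2; exact absurd h2 (by decide)

theorem bef_trans {C : Set W} (hC : IsChain (weakLE cs) C) {t t' t'' : W} (h1 : bef cs C t t')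
    (h2 : bef cs C t' t'') : bef cs C t t'' := by
  obtain ⟨x, hx, x1, x2⟩ := h1
  obtain ⟨y, hy, y1, y2⟩ := h2
  refine ⟨y, hy, ?_, y2⟩
  rcases le_total (cs.length x) (cs.length y) with h | h
  · exact le_iff.1 (le_cases hC hx hy h) _ x1
  · have := le_iff.1 (le_cases hC hy hx h) _ y1
    rw [x2] at this; exact absurd this (by decide)

theorem bef_asymm {C : Set W} (hC : IsChain (weakLE cs) C) {t t' : W} (h1 : bef cs C t t')
    (h2 : bef cs C t' t) : False := bef_ne (bef_trans hC h1 h2) rfl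

theorem n_pref {ω : List B} (h : cs.IsReduced ω) (k : ℕ) (t : W) :
    n cs (cs.wordProd (ω.take k)) t = 1 ↔ t ∈ (cs.leftInvSeq ω).take k := by
  rw [n_word_reduced cs (h.take k), cs.leftInvSeq_take]

theorem seq_iff_bef {ω : List B} (h : cs.IsReduced ω) {t t' : W} (ht' : n cs (cs.wordProd ω) t' = 1) :
    seqBefore cs ω t t' ↔ bef cs (chainOf cs 1 ω) t t' := by
  have nd := h.nodup_leftInvSeq
  constructor
  · rintro ⟨p, q, hpq, e1, e2⟩
    have hlt : q < ω.length := by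
      have := List.getElem?_eq_some_iff.1 e2
      obtain ⟨h1, _⟩ := this
      simpa using h1
    refine ⟨_, ⟨p+1, by omega, rfl⟩, ?_, ?_⟩
    · rw [one_mul, n_pref h]
      rw [List.mem_take_iff_getElem]
      obtain ⟨h1, h2⟩ := List.getElem?_eq_some_iff.1 e1
      exact ⟨p, by omega, h2⟩
    · rw [one_mul, ← z01, Ne, n_pref h, List.mem_take_iff_getElem]
      rintro ⟨r, hr, h3⟩
      obtain ⟨h1, h2⟩ := List.getElem?_eq_some_iff.1 e2
      rw [← h2] at h3
      have := (nd.getElem_inj_iff).1 h3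
      omega
  · rintro ⟨_, ⟨k, hk, rfl⟩, h1, h2⟩
    rw [one_mul] at h1 h2
    rw [n_pref h, List.mem_take_iff_getElem] at h1
    obtain ⟨p, hp, e1⟩ := h1
    rw [n_word_reduced cs h] at ht'
    obtain ⟨q, hq, e2⟩ := List.getElem_of_mem ht'
    rw [← z01, Ne, n_pref h, List.mem_take_iff_getElem] at h2
    refine ⟨p, q, ?_, ?_, ?_⟩
    · by_contra hcon
      exact h2 ⟨q, by omega, e2⟩
    · rw [List.getElem?_eq_some_iff]; exact ⟨by omega, e1⟩
    · rw [List.getElem?_eq_some_iff]; exact ⟨hq, e2⟩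

theorem cov_n {a b : W} (h : CovR (weakLE cs) a b) : n cs a (b * a⁻¹) = 0 ∧ n cs b (b * a⁻¹) = 1 := by
  classical
  obtain ⟨i, rfl, hl⟩ := cov_iff.1 h
  have hr : cs.IsReflection (a * cs.simple i * a⁻¹) := (cs.isReflection_simple i).conj a
  have e : a * cs.simple i * a⁻¹ * a = a * cs.simple i := by group
  have h0 : n cs a (a * cs.simple i * a⁻¹) = 0 := by
    rw [← z01, Ne, n_iff cs hr, e]; omega
  refine ⟨h0, ?_⟩
  have e3 : a⁻¹ * (a * cs.simple i * a⁻¹) * a = cs.simple i := by group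
  rw [n_mul, h0, e3, n_simple, if_pos rfl, zero_add]

theorem chainBefore_bef {C : Set W} {t t' : W} (h : chainBefore cs C t t') : bef cs C t t' := by
  obtain ⟨a, b, c, d, ha, hb, hc, hd, h1, h2, rfl, rfl, h3⟩ := h
  exact ⟨c, hc, le_iff.1 h3 _ (cov_n h1).2, (cov_n h2).1⟩

theorem take_prod {ω : List B} {k : ℕ} (hk : k < ω.length) :
    cs.wordProd (ω.take (k+1)) = cs.wordProd (ω.take k) * cs.simple ω[k] := by
  rw [List.take_succ_eq_append_getElem hk, cs.wordProd_append, cs.wordProd_singleton]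

theorem lis_get {ω : List B} {k : ℕ} {t : W} (h : (cs.leftInvSeq ω)[k]? = some t) :
    k < ω.length ∧ t = cs.wordProd (ω.take (k+1)) * (cs.wordProd (ω.take k))⁻¹ := by
  obtain ⟨h1, h2⟩ := List.getElem?_eq_some_iff.1 h
  have hk : k < ω.length := by simpa using h1
  refine ⟨hk, ?_⟩
  rw [← h2, cs.getElem_leftInvSeq _ _ hk, take_prod hk]

theorem cov_pref {ω : List B} (h : cs.IsReduced ω) {k : ℕ} (hk : k < ω.length) :
    CovR (weakLE cs) (cs.wordProd (ω.take k)) (cs.wordProd (ω.take (k+1))) := by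
  rw [cov_iff]
  refine ⟨ω[k], ?_, ?_⟩
  · exact take_prod hk
  · have h1 := h.take k
    have h2 := h.take (k+1)
    unfold CoxeterSystem.IsReduced at h1 h2
    rw [h1, h2, List.length_take, List.length_take]; omega

theorem seq_chainBefore {ω : List B} (h : cs.IsReduced ω) {t t' : W} (hs : seqBefore cs ω t t') :
    chainBefore cs (chainOf cs 1 ω) t t' := by
  obtain ⟨p, q, hpq, e1, e2⟩ := hs
  obtain ⟨l1, rfl⟩ := lis_get e1
  obtain ⟨l2, rfl⟩ := lis_get e2
  refine ⟨_, _, _, _, ⟨p, by omega, by rw [one_mul]⟩, ⟨p+1, by omega, by rw [one_mul]⟩, ⟨q, by omega, by rw [one_mul]⟩,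
    ⟨q+1, by omega, by rw [one_mul]⟩, cov_pref h l1, cov_pref h l2, rfl, rfl, ?_⟩
  have := pref_le (cs := cs) (x := 1) (ω := ω) (j := p+1) (k := q)
    (by rw [one_mul, cs.length_one, zero_add]; exact h) (by omega) (by omega)
  rwa [one_mul, one_mul] at this

theorem chainBefore_iff {w₀ : W} (hw₀ : ∀ w : W, cs.length w ≤ cs.length w₀) {C : Set W}
    (hC : IsMaxChain (weakLE cs) C) {t t' : W} (ht' : cs.IsReflection t') :
    chainBefore cs C t t' ↔ bef cs C t t' := by
  refine ⟨chainBefore_bef, fun h => ?_⟩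
  obtain ⟨ω, h1, h2, rfl⟩ := maxChain_word hw₀ hC
  exact seq_chainBefore h1 ((seq_iff_bef h1 (by rw [h2]; exact n_top hw₀ ht')).2 h)

theorem bef_total {w₀ : W} (hw₀ : ∀ w : W, cs.length w ≤ cs.length w₀) {C : Set W}
    (hC : IsMaxChain (weakLE cs) C) {t t' : W} (ht : cs.IsReflection t) (ht' : cs.IsReflection t')
    (hne : t ≠ t') : bef cs C t t' ∨ bef cs C t' t := by
  obtain ⟨ω, h1, h2, rfl⟩ := maxChain_word hw₀ hC
  have m1 := n_top hw₀ ht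
  have m2 := n_top hw₀ ht'
  rw [← h2] at m1 m2
  rw [← seq_iff_bef h1 m2, ← seq_iff_bef h1 m1]
  rw [n_word_reduced cs h1] at m1 m2
  obtain ⟨p, hp, e1⟩ := List.getElem_of_mem m1
  obtain ⟨q, hq, e2⟩ := List.getElem_of_mem m2
  rcases lt_trichotomy p q with h | h | h
  · left; exact ⟨p, q, h, by rw [List.getElem?_eq_some_iff]; exact ⟨hp, e1⟩, by rw [List.getElem?_eq_some_iff]; exact ⟨hq, e2⟩⟩
  · subst h; exact absurd (e1.symm.trans e2) hne
  · right; exact ⟨q, p, h, by rw [List.getElem?_eq_some_iff]; exact ⟨hq, e2⟩, by rw [List.getElem?_eq_some_iff]; exact ⟨hp, e1⟩⟩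

/-! polygon moves -/
theorem move_cases {P₁ P₂ : Set W} {x y : W}
    (hP : IsPolygonPair (weakLE cs) x y P₁ P₂) {p : W}
    (hp : ∀ q ∈ P₁, p ≠ q → weakLE cs p q ∨ weakLE cs q p) : p ∈ P₁ ∨ weakLE cs p x ∨ weakLE cs y p := by
  obtain ⟨hxy, m1, -⟩ := hP
  obtain ⟨hx, hy⟩ := max_ends hxy m1
  by_cases ex : p = x
  · right; left; rw [ex]; exact le_refl' _
  by_cases ey : p = y
  · right; right; rw [ey]; exact le_refl' _
  rcases hp x hx ex with h | h
  · exact Or.inr (Or.inl h)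
  rcases hp y hy ey with h' | h'
  · left
    rw [m1.2.2 (insert p P₁) (Set.insert_subset ⟨h, h'⟩ m1.1) (m1.2.1.insert hp) (Set.subset_insert _ _)]
    exact Set.mem_insert _ _
  · exact Or.inr (Or.inr h')

theorem move_max {C C' P₁ P₂ : Set W} {x y : W} (hC : IsMaxChain (weakLE cs) C)
    (hP : IsPolygonPair (weakLE cs) x y P₁ P₂) (h1 : P₁ ⊆ C) (h2 : P₂ ⊆ C') (h3 : C \ P₁ = C' \ P₂) :
    IsMaxChain (weakLE cs) C' := by
  have hP' : IsPolygonPair (weakLE cs) x y P₂ P₁ := by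
    obtain ⟨a, b, c, d, e, f, g⟩ := hP
    exact ⟨a, c, b, d.symm, by rw [e, Set.union_comm], by rw [Set.inter_comm, f], fun C h => (g C h).symm⟩
  obtain ⟨hxy, m1, m2, _⟩ := id hP
  obtain ⟨hx, hy⟩ := max_ends hxy m1
  obtain ⟨hx2, hy2⟩ := max_ends hxy m2
  have out : ∀ p ∈ C', p ∉ P₂ → p ∈ C ∧ (weakLE cs p x ∨ weakLE cs y p) := by
    intro p hp hp2
    have : p ∈ C \ P₁ := by rw [h3]; exact ⟨hp, hp2⟩
    refine ⟨this.1, ?_⟩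
    rcases move_cases hP (p := p) (fun q hq hne => hC.1 this.1 (h1 hq) hne) with h | h
    · exact absurd h this.2
    · exact h
  have cmp : ∀ p, (weakLE cs p x ∨ weakLE cs y p) → ∀ q ∈ IccR (weakLE cs) x y, weakLE cs p q ∨ weakLE cs q p := by
    rintro p (h | h) q hq
    · left; exact le_tr h hq.1
    · right; exact le_tr hq.2 h
  have hch : IsChain (weakLE cs) C' := by
    intro p hp q hq hne
    by_cases p2 : p ∈ P₂
    · by_cases q2 : q ∈ P₂
      · exact m2.2.1 p2 q2 hne
      · exact (cmp q (out q hq q2).2 p (m2.1 p2)).symm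
    · by_cases q2 : q ∈ P₂
      · exact cmp p (out p hp p2).2 q (m2.1 q2)
      · exact hC.1 (out p hp p2).1 (out q hq q2).1 hne
  refine ⟨hch, fun E hE hsub => Set.Subset.antisymm hsub ?_⟩
  intro q hq
  rcases move_cases hP' (p := q) (fun r hr hne => hE hq (hsub (h2 hr)) hne) with h | h
  · exact h2 h
  · have : q ∈ C := by
      rw [hC.2 (t := insert q C) (hC.1.insert ?_) (Set.subset_insert _ _)]
      · exact Set.mem_insert _ _
      · intro b hb hne
        by_cases b1 : b ∈ P₁
        · exact cmp q h b (m1.1 b1)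
        · have : b ∈ C' \ P₂ := by rw [← h3]; exact ⟨hb, b1⟩
          exact hE hq (hsub this.1) hne
    by_cases q1 : q ∈ P₁
    · rcases h with h | h
      · rw [le_anti h (m1.1 q1).1]; exact h2 hx2
      · rw [← le_anti h (m1.1 q1).2]; exact h2 hy2
    · have : q ∈ C' \ P₂ := by rw [← h3]; exact ⟨this, q1⟩
      exact this.1

def polD (cs : CoxeterSystem M W) (x : W) (i j : B) : Subgroup W :=
  (Subgroup.closure {cs.simple i, cs.simple j}).map (MulAut.conj x).toMonoidHom

theorem mem_polD {x t : W} : t ∈ polD cs x i j ↔ x⁻¹ * t * x ∈ Subgroup.closure {cs.simple i, cs.simple j} := by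
  constructor
  · rintro ⟨y, hy, rfl⟩
    have : x⁻¹ * ((MulAut.conj x).toMonoidHom y) * x = y := by
      simp only [MulEquiv.toMonoidHom_eq_coe, MonoidHom.coe_coe, MulAut.conj_apply]; group
    rw [this]; exact hy
  · intro h
    refine ⟨_, h, ?_⟩
    simp only [MulEquiv.toMonoidHom_eq_coe, MonoidHom.coe_coe, MulAut.conj_apply]; group

theorem bef_out {x t t' : W} {C C' : Set W} (hp : Pol cs x i j)
    (h3 : C \ side x (cs.simple i) (cs.simple j) (orderOf (cs.simple i * cs.simple j)) =
      C' \ side x (cs.simple j) (cs.simple i) (orderOf (cs.simple i * cs.simple j)))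
    (h2 : side x (cs.simple j) (cs.simple i) (orderOf (cs.simple i * cs.simple j)) ⊆ C')
    (ht : t ∉ polD cs x i j ∨ t' ∉ polD cs x i j) (h : bef cs C t t') : bef cs C' t t' := by
  have hd := dih_simple hp.ne
  obtain ⟨p, hpC, n1, n2⟩ := h
  by_cases p1 : p ∈ side x (cs.simple i) (cs.simple j) (orderOf (cs.simple i * cs.simple j))
  · obtain ⟨k, hk, rfl⟩ := p1
    have l1 := hp.prefLe (Nat.zero_le k) hk
    have e0 : alt (cs.simple i) (cs.simple j) 0 = 1 := rfl
    rw [e0, mul_one] at l1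
    have l2 := hp.prefLe hk le_rfl
    rw [mem_polD, mem_polD] at ht
    rcases ht with ht | ht
    · refine ⟨x, h2 ⟨0, by omega, by simp [alt]⟩, ?_, ?_⟩
      · rw [n_mul, n_out (hd.am k) ht, add_zero] at n1; exact n1
      · rw [← z01] at n2 ⊢
        exact fun h => n2 (le_iff.1 l1 _ h)
    · refine ⟨x * alt (cs.simple i) (cs.simple j) (orderOf (cs.simple i * cs.simple j)), h2 ⟨_, le_rfl, by rw [hp.sym]⟩, ?_, ?_⟩
      · exact le_iff.1 l2 _ n1
      · rw [n_mul, n_out (hd.am k) ht] at n2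
        rw [n_mul, n_out (hd.am _) ht, n2]
  · have : p ∈ C' \ side x (cs.simple j) (cs.simple i) (orderOf (cs.simple i * cs.simple j)) := by rw [← h3]; exact ⟨hpC, p1⟩
    exact ⟨p, this.1, n1, n2⟩

theorem bef_side {x : W} {C : Set W} (hp : Pol cs x i j)
    (h1 : side x (cs.simple i) (cs.simple j) (orderOf (cs.simple i * cs.simple j)) ⊆ C) {p q : ℕ}
    (hpq : p < q) (hq : q < orderOf (cs.simple i * cs.simple j)) :
    bef cs C (x * R (cs.simple i) (cs.simple j) p * x⁻¹) (x * R (cs.simple i) (cs.simple j) q * x⁻¹) := by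
  have hd := dih_simple hp.ne
  refine ⟨_, h1 ⟨p+1, by omega, rfl⟩, ?_, ?_⟩
  · have e : ∀ t, x⁻¹ * (x * t * x⁻¹) * x = t := fun t => by group
    rw [n_mul, hp.n_x (hd.Rm _) (hd.R_refl _), e, zero_add, hd.n_alt (by omega) (hd.Rm _)]
    exact ⟨p, by omega, rfl⟩
  · have e : ∀ t, x⁻¹ * (x * t * x⁻¹) * x = t := fun t => by group
    rw [n_mul, hp.n_x (hd.Rm _) (hd.R_refl _), e, zero_add, ← z01, Ne, hd.n_alt (by omega) (hd.Rm _)]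
    rintro ⟨r, hr, e⟩
    have := R_inj (by omega) (by omega) e
    omega

theorem polD_refl {x t : W} (hp : Pol cs x i j) (ht : t ∈ polD cs x i j) (hr : cs.IsReflection t) :
    ∃ p < orderOf (cs.simple i * cs.simple j), t = x * R (cs.simple i) (cs.simple j) p * x⁻¹ := by
  have hd := dih_simple hp.ne
  have := hr.conj x⁻¹
  rw [inv_inv] at this
  obtain ⟨p, h1, h2⟩ := hd.refl_R (mem_polD.1 ht) this
  exact ⟨p, h1, by rw [← h2]; group⟩

/-- order inside D is reversed by the move -/
theorem bef_in {x t t' : W} {C C' : Set W} (hC : IsChain (weakLE cs) C) (hp : Pol cs x i j)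
    (h1 : side x (cs.simple i) (cs.simple j) (orderOf (cs.simple i * cs.simple j)) ⊆ C)
    (h2 : side x (cs.simple j) (cs.simple i) (orderOf (cs.simple i * cs.simple j)) ⊆ C')
    (ht : t ∈ polD cs x i j) (ht' : t' ∈ polD cs x i j) (hr : cs.IsReflection t) (hr' : cs.IsReflection t')
    (h : bef cs C t t') : bef cs C' t' t := by
  have hd := dih_simple hp.ne
  obtain ⟨p, hp1, rfl⟩ := polD_refl hp ht hr
  obtain ⟨q, hq1, rfl⟩ := polD_refl hp ht' hr'
  have hpq : p < q := by
    rcases lt_trichotomy p q with h3 | h3 | h3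
    · exact h3
    · subst h3; exact absurd rfl (bef_ne h)
    · exact (bef_asymm hC h (bef_side hp h1 h3 hp1)).elim
  have := bef_side (C := C') hp.symm (by rw [hd.ord]; exact h2)
    (p := orderOf (cs.simple i * cs.simple j) - 1 - q) (q := orderOf (cs.simple i * cs.simple j) - 1 - p)
    (by omega) (by rw [hd.ord]; omega)
  rw [hd.swap (by omega), hd.swap (by omega)] at this
  convert this using 4 <;> omega

end Gg
end MG

set_option linter.unusedSectionVars false
namespace MG
section H
variable {B : Type*} {W : Type*} [Group W] {M : CoxeterMatrix B} {cs : CoxeterSystem M W} [Finite W]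
variable {i j : B} {w₀ : W}

theorem Dih.seg_mid {D : Subgroup W} {a b : W} (h : Dih cs D a b) (x : W) {i j k : ℕ} (hij : i < j) (hjk : j < k)
    (hk : k < orderOf (a * b)) (h1 : n cs x (R a b i) = 1) (h2 : n cs x (R a b k) = 1) :
    n cs x (R a b j) = 1 := by
  obtain ⟨p, hp, hs | hs⟩ := h.seg x
  · obtain ⟨q, hq, e⟩ := (hs _ (h.Rm k)).1 h2
    have := R_inj (by omega) (by omega) e
    exact (hs _ (h.Rm j)).2 ⟨j, by omega, rfl⟩
  · obtain ⟨q, hq, e⟩ := (hs _ (h.Rm i)).1 h1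
    rw [h.swap (by omega)] at e
    have := R_inj (by omega) (by omega) e
    refine (hs _ (h.Rm j)).2 ⟨orderOf (a * b) - 1 - j, by omega, ?_⟩
    rw [h.swap (by omega)]
    congr 1; omega

theorem Dih.mono {D : Subgroup W} {a b : W} (h : Dih cs D a b) (hw₀ : ∀ w : W, cs.length w ≤ cs.length w₀)
    {C : Set W} (hC : IsMaxChain (weakLE cs) C) (h0 : bef cs C (R a b 0) (R a b (orderOf (a * b) - 1)))
    {p q : ℕ} (hpq : p < q) (hq : q < orderOf (a * b)) : bef cs C (R a b p) (R a b q) := by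
  rcases bef_total hw₀ hC (h.R_refl p) (h.R_refl q) (fun e => by
    have := R_inj (by omega) (by omega) e; omega) with h1 | h1
  · exact h1
  exfalso
  obtain ⟨x, hx, x1, x2⟩ := h1
  obtain ⟨y, hy, y1, y2⟩ := h0
  have x3 : n cs x (R a b (orderOf (a * b) - 1)) = 1 := by
    by_cases e : q = orderOf (a * b) - 1
    · rw [← e]; exact x1
    · exact h.seg_up x hpq (by omega) (by omega) x2 x1
  have x4 : n cs x (R a b 0) = 1 := by
    rcases le_total (cs.length x) (cs.length y) with h5 | h5
    · have := le_iff.1 (le_cases hC.1 hx hy h5) _ x3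
      rw [y2] at this; exact absurd this (by decide)
    · exact le_iff.1 (le_cases hC.1 hy hx h5) _ y1
  have : n cs x (R a b p) = 1 := by
    rcases Nat.eq_zero_or_pos p with e | e
    · rw [e]; exact x4
    · exact h.seg_mid x e hpq hq x4 x1
  rw [x2] at this; exact absurd this (by decide)

theorem Dih.order {D : Subgroup W} {a b : W} (h : Dih cs D a b) (hw₀ : ∀ w : W, cs.length w ≤ cs.length w₀)
    {C : Set W} (hC : IsMaxChain (weakLE cs) C) :
    (∀ p q, p < q → q < orderOf (a * b) → bef cs C (R a b p) (R a b q)) ∨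
    (∀ p q, p < q → q < orderOf (a * b) → bef cs C (R a b q) (R a b p)) := by
  have h2 := h.two
  rcases bef_total hw₀ hC (h.R_refl 0) (h.R_refl (orderOf (a * b) - 1)) (fun e => by
    have := R_inj (by omega) (by omega) e; omega) with h1 | h1
  · left; intro p q; exact h.mono hw₀ hC h1
  · right
    intro p q hpq hq
    have h1' : bef cs C (R b a 0) (R b a (orderOf (b * a) - 1)) := by
      rw [h.ord, h.swap (by omega), h.swap (by omega)]
      convert h1 using 2 <;> omega
    have := h.symm.mono hw₀ hC h1' (p := orderOf (a * b) - 1 - q) (q := orderOf (a * b) - 1 - p) (by omega)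
      (by rw [h.ord]; omega)
    rw [h.swap (by omega), h.swap (by omega)] at this
    convert this using 2 <;> omega

def Agree (cs : CoxeterSystem M W) (D : Subgroup W) (C E : Set W) : Prop :=
  ∀ t ∈ D, ∀ t' ∈ D, cs.IsReflection t → cs.IsReflection t' → bef cs C t t' → bef cs E t t'
def Opp (cs : CoxeterSystem M W) (D : Subgroup W) (C E : Set W) : Prop :=
  ∀ t ∈ D, ∀ t' ∈ D, cs.IsReflection t → cs.IsReflection t' → bef cs C t t' → bef cs E t' t

theorem dich (hw₀ : ∀ w : W, cs.length w ≤ cs.length w₀) {D : Subgroup W} (hD : IsDihedralSubgroup cs D)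
    (hn : IsNonCommutative cs D) {C E : Set W} (hC : IsMaxChain (weakLE cs) C) (hE : IsMaxChain (weakLE cs) E) :
    Agree cs D C E ∨ Opp cs D C E := by
  obtain ⟨a, b, ha, hb, hne, _⟩ := canon_exists cs hD hn
  have h : Dih cs D a b := ⟨hD, ha, hb, hne⟩
  have key : ∀ t ∈ D, ∀ t' ∈ D, cs.IsReflection t → cs.IsReflection t' → t ≠ t' →
      ∃ p q, p < orderOf (a * b) ∧ q < orderOf (a * b) ∧ t = R a b p ∧ t' = R a b q ∧ (p < q ∨ q < p) := by
    intro t ht t' ht' hr hr' hne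
    obtain ⟨p, hp, rfl⟩ := h.refl_R ht hr
    obtain ⟨q, hq, rfl⟩ := h.refl_R ht' hr'
    refine ⟨p, q, hp, hq, rfl, rfl, ?_⟩
    rcases lt_trichotomy p q with h | h | h
    · exact Or.inl h
    · subst h; exact absurd rfl hne
    · exact Or.inr h
  rcases h.order hw₀ hC with c | c <;> rcases h.order hw₀ hE with e | e
  · left
    intro t ht t' ht' hr hr' hb
    obtain ⟨p, q, hp, hq, rfl, rfl, hpq | hpq⟩ := key t ht t' ht' hr hr' (bef_ne hb)
    · exact e _ _ hpq hq
    · exact (bef_asymm hC.1 hb (c _ _ hpq hp)).elim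
  · right
    intro t ht t' ht' hr hr' hb
    obtain ⟨p, q, hp, hq, rfl, rfl, hpq | hpq⟩ := key t ht t' ht' hr hr' (bef_ne hb)
    · exact e _ _ hpq hq
    · exact (bef_asymm hC.1 hb (c _ _ hpq hp)).elim
  · right
    intro t ht t' ht' hr hr' hb
    obtain ⟨p, q, hp, hq, rfl, rfl, hpq | hpq⟩ := key t ht t' ht' hr hr' (bef_ne hb)
    · exact (bef_asymm hC.1 hb (c _ _ hpq hq)).elim
    · exact e _ _ hpq hp
  · left
    intro t ht t' ht' hr hr' hb
    obtain ⟨p, q, hp, hq, rfl, rfl, hpq | hpq⟩ := key t ht t' ht' hr hr' (bef_ne hb)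
    · exact (bef_asymm hC.1 hb (c _ _ hpq hq)).elim
    · exact e _ _ hpq hp

variable {ω₀ : List B}

theorem inv_iff (hw₀ : ∀ w : W, cs.length w ≤ cs.length w₀) (hr₀ : cs.IsReduced ω₀) (hp₀ : cs.wordProd ω₀ = w₀)
    {C : Set W} (hC : IsMaxChain (weakLE cs) C) {D : Subgroup W} (hD : IsMaxDihedralSubgroup cs D)
    (hn : IsNonCommutative cs D) :
    (D ∈ invSubgroups cs ω₀ C ↔ Opp cs D (chainOf cs 1 ω₀) C) ∧
    (D ∉ invSubgroups cs ω₀ C ↔ Agree cs D (chainOf cs 1 ω₀) C) := by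
  have h0 := word_maxChain hw₀ hr₀ hp₀
  have hex : D ∈ invSubgroups cs ω₀ C ↔ ∃ t t' : W, cs.IsReflection t ∧ cs.IsReflection t' ∧ t ∈ D ∧ t' ∈ D ∧
      bef cs (chainOf cs 1 ω₀) t t' ∧ bef cs C t' t := by
    constructor
    · rintro ⟨_, _, t, t', h1, h2, h3, h4, h5, h6⟩
      exact ⟨t, t', h1, h2, h3, h4, (seq_iff_bef hr₀ (by rw [hp₀]; exact n_top hw₀ h2)).1 h5, chainBefore_bef h6⟩
    · rintro ⟨t, t', h1, h2, h3, h4, h5, h6⟩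
      exact ⟨hD, hn, t, t', h1, h2, h3, h4, (seq_iff_bef hr₀ (by rw [hp₀]; exact n_top hw₀ h2)).2 h5,
        (chainBefore_iff hw₀ hC h1).2 h6⟩
  have nott : ¬ (Agree cs D (chainOf cs 1 ω₀) C ∧ Opp cs D (chainOf cs 1 ω₀) C) := by
    rintro ⟨hA, hO⟩
    obtain ⟨t, t', h1, h2, h3, h4, h5⟩ := hn
    rcases bef_total hw₀ h0 h1 h2 (fun e => h5 (by rw [e])) with h | h
    · exact bef_asymm hC.1 (hA _ h3 _ h4 h1 h2 h) (hO _ h3 _ h4 h1 h2 h)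
    · exact bef_asymm hC.1 (hA _ h4 _ h3 h2 h1 h) (hO _ h4 _ h3 h2 h1 h)
  have e1 : D ∈ invSubgroups cs ω₀ C → Opp cs D (chainOf cs 1 ω₀) C := by
    intro h
    obtain ⟨t, t', h1, h2, h3, h4, h5, h6⟩ := hex.1 h
    rcases dich hw₀ hD.1 hn h0 hC with h7 | h7
    · exact (bef_asymm hC.1 (h7 _ h3 _ h4 h1 h2 h5) h6).elim
    · exact h7
  have e2 : Opp cs D (chainOf cs 1 ω₀) C → D ∈ invSubgroups cs ω₀ C := by
    intro h
    rw [hex]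
    obtain ⟨t, t', h1, h2, h3, h4, h5⟩ := hn
    rcases bef_total hw₀ h0 h1 h2 (fun e => h5 (by rw [e])) with h6 | h6
    · exact ⟨t, t', h1, h2, h3, h4, h6, h _ h3 _ h4 h1 h2 h6⟩
    · exact ⟨t', t, h2, h1, h4, h3, h6, h _ h4 _ h3 h2 h1 h6⟩
  refine ⟨⟨e1, e2⟩, ?_⟩
  constructor
  · intro h
    rcases dich hw₀ hD.1 hn h0 hC with h7 | h7
    · exact h7
    · exact absurd (e2 h7) h
  · intro h h7
    exact nott ⟨h, e1 h7⟩

theorem Agree.comp {D : Subgroup W} {C E F : Set W} (h : Agree cs D C E) (h' : Agree cs D E F) : Agree cs D C F :=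
  fun t ht t' ht' hr hr' hb => h' t ht t' ht' hr hr' (h t ht t' ht' hr hr' hb)
theorem Agree.symm (hw₀ : ∀ w : W, cs.length w ≤ cs.length w₀) {D : Subgroup W} {C E : Set W}
    (hC : IsMaxChain (weakLE cs) C) (hE : IsMaxChain (weakLE cs) E) (h : Agree cs D C E) : Agree cs D E C := by
  intro t ht t' ht' hr hr' hb
  rcases bef_total hw₀ hC hr hr' (bef_ne hb) with h1 | h1
  · exact h1
  · exact (bef_asymm hE.1 hb (h _ ht' _ ht hr' hr h1)).elim
theorem Opp.comp {D : Subgroup W} {C E F : Set W} (h : Opp cs D C E) (h' : Opp cs D E F) : Agree cs D C F :=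
  fun t ht t' ht' hr hr' hb => h' t' ht' t ht hr' hr (h t ht t' ht' hr hr' hb)
theorem Opp.symm (hw₀ : ∀ w : W, cs.length w ≤ cs.length w₀) {D : Subgroup W} {C E : Set W}
    (hC : IsMaxChain (weakLE cs) C) (hE : IsMaxChain (weakLE cs) E) (h : Opp cs D C E) : Opp cs D E C := by
  intro t ht t' ht' hr hr' hb
  rcases bef_total hw₀ hC hr hr' (bef_ne hb) with h1 | h1
  · exact (bef_asymm hE.1 hb (h _ ht _ ht' hr hr' h1)).elim
  · exact h1
theorem Agree.comp_opp {D : Subgroup W} {C E F : Set W} (h : Agree cs D C E) (h' : Opp cs D E F) : Opp cs D C F :=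
  fun t ht t' ht' hr hr' hb => h' t ht t' ht' hr hr' (h t ht t' ht' hr hr' hb)

theorem move_agree (hw₀ : ∀ w : W, cs.length w ≤ cs.length w₀) {x : W} {C C' : Set W}
    (hC : IsMaxChain (weakLE cs) C) (hC' : IsMaxChain (weakLE cs) C') (hp : Pol cs x i j)
    (h3 : C \ side x (cs.simple i) (cs.simple j) (orderOf (cs.simple i * cs.simple j)) =
      C' \ side x (cs.simple j) (cs.simple i) (orderOf (cs.simple i * cs.simple j)))
    (h2 : side x (cs.simple j) (cs.simple i) (orderOf (cs.simple i * cs.simple j)) ⊆ C')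
    {D : Subgroup W} (hD : IsMaxDihedralSubgroup cs D) (hn : IsNonCommutative cs D)
    (hne : D ≠ polD cs x i j) : Agree cs D C C' := by
  rcases dich hw₀ hD.1 hn hC hC' with h | h
  · exact h
  exfalso
  have both : ∀ t ∈ D, ∀ t' ∈ D, cs.IsReflection t → cs.IsReflection t' → t ≠ t' → t ∈ polD cs x i j := by
    intro t ht t' ht' hr hr' hne
    by_contra hcon
    rcases bef_total hw₀ hC hr hr' hne with h1 | h1
    · exact bef_asymm hC'.1 (bef_out hp h3 h2 (Or.inl hcon) h1) (h _ ht _ ht' hr hr' h1)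
    · exact bef_asymm hC'.1 (bef_out hp h3 h2 (Or.inr hcon) h1) (h _ ht' _ ht hr' hr h1)
  have all : ∀ t ∈ D, cs.IsReflection t → t ∈ polD cs x i j := by
    intro t ht hr
    obtain ⟨u, v, hu, hv, hu', hv', hne⟩ := hn
    by_cases e : t = u
    · subst e
      exact both t ht v hv' hr hv (fun e => hne (by rw [e]))
    · exact both t ht u hu' hr hu e
  apply hne
  apply hD.2 _ (max_simple hp.ne x).1
  obtain ⟨t1, t2, r1, r2, e⟩ := hD.1
  have m1 : t1 ∈ D := by rw [e]; exact Subgroup.subset_closure (by simp)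
  have m2 : t2 ∈ D := by rw [e]; exact Subgroup.subset_closure (by simp)
  rw [e, Subgroup.closure_le]
  rintro y (rfl | rfl)
  · exact all _ m1 r1
  · exact all _ m2 r2

theorem inv_congr (hw₀ : ∀ w : W, cs.length w ≤ cs.length w₀) (hr₀ : cs.IsReduced ω₀) (hp₀ : cs.wordProd ω₀ = w₀)
    {C E : Set W} (hC : IsMaxChain (weakLE cs) C) (hE : IsMaxChain (weakLE cs) E) {D : Subgroup W}
    (hD : IsMaxDihedralSubgroup cs D) (hn : IsNonCommutative cs D) :
    (D ∈ invSubgroups cs ω₀ C ↔ D ∈ invSubgroups cs ω₀ E) ↔ Agree cs D C E := by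
  have c := inv_iff hw₀ hr₀ hp₀ hC hD hn
  have e := inv_iff hw₀ hr₀ hp₀ hE hD hn
  have h0 := word_maxChain hw₀ hr₀ hp₀
  constructor
  · intro h
    by_cases hc : D ∈ invSubgroups cs ω₀ C
    · exact ((c.1.1 hc).symm hw₀ h0 hC).comp (e.1.1 (h.1 hc))
    · exact ((c.2.1 hc).symm hw₀ h0 hC).comp (e.2.1 (fun h' => hc (h.2 h')))
  · intro h
    by_cases hc : D ∈ invSubgroups cs ω₀ C
    · simp only [hc, true_iff]
      refine e.1.2 ?_
      intro t ht t' ht' hr hr' hb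
      exact h _ ht' _ ht hr' hr (c.1.1 hc _ ht _ ht' hr hr' hb)
    · simp only [hc, false_iff]
      exact e.2.2 ((c.2.1 hc).comp h)

theorem square_inv (hw₀ : ∀ w : W, cs.length w ≤ cs.length w₀) (hr₀ : cs.IsReduced ω₀) (hp₀ : cs.wordProd ω₀ = w₀)
    {C C' : Set W} (hC : IsMaxChain (weakLE cs) C) (h : SquareMove (weakLE cs) C C') :
    IsMaxChain (weakLE cs) C' ∧ invSubgroups cs ω₀ C' = invSubgroups cs ω₀ C ∧ SquareMove (weakLE cs) C' C := by
  obtain ⟨x, y, P₁, P₂, hP, h4, h1, h2, h3⟩ := h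
  have hC' := move_max hC hP h1 h2 h3
  refine ⟨hC', ?_, x, y, P₂, P₁, ?_, h4, h2, h1, h3.symm⟩
  · obtain ⟨i, j, hp, rfl, rfl, rfl⟩ := E1 hP
    rw [hp.ncard4] at h4
    have comm : ∀ u ∈ polD cs x i j, ∀ v ∈ polD cs x i j, u * v = v * u := by
      have : ∀ u ∈ Subgroup.closure {cs.simple i, cs.simple j}, ∀ v ∈ Subgroup.closure {cs.simple i, cs.simple j}, u * v = v * u := by
        have hc : ∀ u ∈ ({cs.simple i, cs.simple j} : Set W), ∀ v ∈ ({cs.simple i, cs.simple j} : Set W), u * v = v * u := by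
          rintro u (rfl | rfl) v (rfl | rfl)
          · rfl
          · exact h4
          · exact h4.symm
          · rfl
        intro u hu v hv
        have h5 := Subgroup.isMulCommutative_closure hc
        have := h5.is_comm.comm ⟨u, hu⟩ ⟨v, hv⟩
        simpa using this
      rintro _ ⟨u, hu, rfl⟩ _ ⟨v, hv, rfl⟩
      rw [← map_mul, this u hu v hv, map_mul]
    ext D
    by_cases hD : IsMaxDihedralSubgroup cs D ∧ IsNonCommutative cs D
    · obtain ⟨hD, hn⟩ := hD
      rw [iff_comm, inv_congr hw₀ hr₀ hp₀ hC hC' hD hn]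
      refine move_agree hw₀ hC hC' hp h3 h2 hD hn ?_
      rintro rfl
      obtain ⟨t, t', _, _, m1, m2, hh⟩ := hn
      exact hh (comm _ m1 _ m2)
    · constructor
      · rintro ⟨a, b, _⟩; exact absurd ⟨a, b⟩ hD
      · rintro ⟨a, b, _⟩; exact absurd ⟨a, b⟩ hD
  · obtain ⟨a, b, c, d, e, f, g⟩ := hP
    exact ⟨a, c, b, d.symm, by rw [e, Set.union_comm], by rw [Set.inter_comm, f], fun C h => (g C h).symm⟩

theorem sq_inv (hw₀ : ∀ w : W, cs.length w ≤ cs.length w₀) (hr₀ : cs.IsReduced ω₀) (hp₀ : cs.wordProd ω₀ = w₀)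
    {C C' : Set W} (hC : IsMaxChain (weakLE cs) C) (h : SqEquiv (weakLE cs) C C') :
    IsMaxChain (weakLE cs) C' ∧ invSubgroups cs ω₀ C' = invSubgroups cs ω₀ C ∧ SqEquiv (weakLE cs) C' C := by
  induction h with
  | refl => exact ⟨hC, rfl, Relation.ReflTransGen.refl⟩
  | tail _ h ih =>
    obtain ⟨a, b, c⟩ := ih
    obtain ⟨d, e, f⟩ := square_inv hw₀ hr₀ hp₀ a h
    exact ⟨d, e.trans b, Relation.ReflTransGen.head f c⟩

theorem heap_bef (hr₀ : cs.IsReduced ω₀) {t t' : W} (h : heapLt cs ω₀ t t') : bef cs (chainOf cs 1 ω₀) t t' := by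
  have key : ∀ a b, (∃ j k : ℕ, j < k ∧ (cs.leftInvSeq ω₀)[j]? = some a ∧ (cs.leftInvSeq ω₀)[k]? = some b ∧
    a * b ≠ b * a) → bef cs (chainOf cs 1 ω₀) a b := by
    rintro a b ⟨p, q, hpq, e1, e2, _⟩
    refine (seq_iff_bef hr₀ ?_).1 ⟨p, q, hpq, e1, e2⟩
    rw [n_word_reduced cs hr₀]
    exact List.mem_of_getElem? e2
  have hch : IsChain (weakLE cs) (chainOf cs 1 ω₀) := chainOf_chain (by
    rw [one_mul, cs.length_one, zero_add]; exact hr₀)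
  induction h with
  | single h => exact key _ _ h
  | tail _ h ih => exact bef_trans hch ih (key _ _ h)

theorem inc_inv (hw₀ : ∀ w : W, cs.length w ≤ cs.length w₀) (hr₀ : cs.IsReduced ω₀) (hp₀ : cs.wordProd ω₀ = w₀)
    {C C' : Set W} (hC : IsMaxChain (weakLE cs) C)
    (h : IncPolygonMove (weakLE cs) (fun u w => w * u⁻¹) (heapLt cs ω₀) C C') :
    IsMaxChain (weakLE cs) C' ∧ ∃ D, IsMaxDihedralSubgroup cs D ∧ IsNonCommutative cs D ∧
      D ∉ invSubgroups cs ω₀ C ∧ invSubgroups cs ω₀ C' = insert D (invSubgroups cs ω₀ C) := by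
  obtain ⟨x, y, P₁, P₂, hP, h4, h1, h2, h3, hA⟩ := h
  have hC' := move_max hC hP h1 h2 h3
  refine ⟨hC', ?_⟩
  obtain ⟨i, j, hp, rfl, rfl, rfl⟩ := E1 hP
  rw [Ne, hp.ncard4] at h4
  have hd := dih_simple hp.ne
  have hm2 := hd.two
  have hD : IsMaxDihedralSubgroup cs (polD cs x i j) := max_simple hp.ne x
  have hcl : ∀ t ∈ Subgroup.closure {cs.simple i, cs.simple j}, x * t * x⁻¹ ∈ polD cs x i j := by
    intro t ht
    rw [mem_polD]
    have e : x⁻¹ * (x * t * x⁻¹) * x = t := by group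
    rwa [e]
  have hn : IsNonCommutative cs (polD cs x i j) := by
    refine ⟨x * cs.simple i * x⁻¹, x * cs.simple j * x⁻¹, hd.ca.2.1.conj x, hd.cb.2.1.conj x,
      hcl _ hd.ca.1, hcl _ hd.cb.1, ?_⟩
    intro e
    apply h4
    have : x * (cs.simple i * cs.simple j) * x⁻¹ = x * (cs.simple j * cs.simple i) * x⁻¹ := by
      calc _ = x * cs.simple i * x⁻¹ * (x * cs.simple j * x⁻¹) := by group
        _ = _ := e
        _ = _ := by group
    simpa using this
  have h0 := word_maxChain hw₀ hr₀ hp₀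
  have hOpp : Opp cs (polD cs x i j) C C' := fun t ht t' ht' hr hr' hb => bef_in hC.1 hp h1 h2 ht ht' hr hr' hb
  have hlab : ∀ k, x * alt (cs.simple i) (cs.simple j) (k+1) * (x * alt (cs.simple i) (cs.simple j) k)⁻¹ =
      x * R (cs.simple i) (cs.simple j) k * x⁻¹ := by
    intro k
    rw [← alt_conj hd.aa hd.bb]; group
  have hcov : ∀ k, k + 1 ≤ orderOf (cs.simple i * cs.simple j) →
      CovR (weakLE cs) (x * alt (cs.simple i) (cs.simple j) k) (x * alt (cs.simple i) (cs.simple j) (k+1)) := by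
    intro k hk
    refine ⟨hp.prefLe (by omega) hk, ?_, ?_⟩
    · intro e
      have l1 := hp.prefLen (k := k) (by omega)
      have l2 := hp.prefLen hk
      rw [e] at l1; omega
    · intro z z1 z2
      have l1 := hp.prefLen (k := k) (by omega)
      have l2 := hp.prefLen hk
      have q1 := le_len z1
      have q2 := le_len z2
      by_cases e : cs.length z = cs.length (x * alt (cs.simple i) (cs.simple j) k)
      · left; exact (le_eq_len z1 (by omega)).symm
      · right; exact le_eq_len z2 (by omega)
  have hasc := hA _ _ _ _ ⟨0, by omega, rfl⟩ ⟨1, by omega, rfl⟩ ⟨1, by omega, rfl⟩ ⟨2, by omega, rfl⟩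
    (hcov 0 (by omega)) (hcov 1 (by omega)) (le_refl' _)
  simp only at hasc
  rw [hlab 0, hlab 1] at hasc
  have hb0 := heap_bef hr₀ hasc
  have hb1 := bef_side hp h1 (p := 0) (q := 1) (by omega) (by omega)
  have hnot : polD cs x i j ∉ invSubgroups cs ω₀ C := by
    rw [(inv_iff hw₀ hr₀ hp₀ hC hD hn).2]
    rcases dich hw₀ hD.1 hn h0 hC with h | h
    · exact h
    · exfalso
      exact bef_asymm hC.1 hb1 (h _ (hcl _ (hd.Rm 0)) _ (hcl _ (hd.Rm 1)) ((hd.R_refl 0).conj x)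
        ((hd.R_refl 1).conj x) hb0)
  refine ⟨polD cs x i j, hD, hn, hnot, ?_⟩
  have hin : polD cs x i j ∈ invSubgroups cs ω₀ C' := by
    rw [(inv_iff hw₀ hr₀ hp₀ hC' hD hn).1]
    exact ((inv_iff hw₀ hr₀ hp₀ hC hD hn).2.1 hnot).comp_opp hOpp
  ext D
  rw [Set.mem_insert_iff]
  by_cases e : D = polD cs x i j
  · rw [e]; simp [hin]
  simp only [e, false_or]
  by_cases hDD : IsMaxDihedralSubgroup cs D ∧ IsNonCommutative cs D
  · obtain ⟨hD, hn⟩ := hDD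
    rw [iff_comm, inv_congr hw₀ hr₀ hp₀ hC hC' hD hn]
    exact move_agree hw₀ hC hC' hp h3 h2 hD hn e
  · constructor
    · rintro ⟨a, b, _⟩; exact absurd ⟨a, b⟩ hDD
    · rintro ⟨a, b, _⟩; exact absurd ⟨a, b⟩ hDD

end H
end MG

set_option linter.unusedSectionVars false
namespace MG
section I
variable {B : Type*} {W : Type*} [Group W] {M : CoxeterMatrix B} {cs : CoxeterSystem M W} [Finite W]
variable {i j : B} {w₀ : W} {ω₀ : List B}

theorem comm_app {ω ω' : List B} (h : Relation.ReflTransGen (CommMove cs) ω ω') (r : List B) :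
    Relation.ReflTransGen (CommMove cs) (ω ++ r) (ω' ++ r) := by
  induction h with
  | refl => exact Relation.ReflTransGen.refl
  | tail _ h ih =>
    refine ih.tail ?_
    obtain ⟨l, r', i, j, hc, rfl, rfl⟩ := h
    exact ⟨l, r' ++ r, i, j, hc, by simp, by simp⟩

theorem lis_app (ω : List B) (i : B) :
    cs.leftInvSeq (ω ++ [i]) = cs.leftInvSeq ω ++ [cs.wordProd ω * cs.simple i * (cs.wordProd ω)⁻¹] := by
  have := cs.leftInvSeq_concat ω i
  simpa [List.concat_eq_append] using this

theorem comm_prod {ω ω' : List B} (h : Relation.ReflTransGen (CommMove cs) ω ω') :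
    cs.wordProd ω' = cs.wordProd ω ∧ ω'.length = ω.length := by
  induction h with
  | refl => exact ⟨rfl, rfl⟩
  | tail _ h ih =>
    obtain ⟨l, r', i, j, hc, rfl, rfl⟩ := h
    rw [← ih.1, ← ih.2]
    refine ⟨?_, by simp⟩
    simp only [cs.wordProd_append, cs.wordProd_cons]
    rw [← mul_assoc (cs.simple j), ← hc, mul_assoc]

theorem sort_ins (c : W → ℕ) : ∀ (k : ℕ) (ω : List B) (i : B), ω.length = k →
    (cs.leftInvSeq ω).Pairwise (fun t t' => c t ≤ c t') →
    (∀ u ∈ cs.leftInvSeq ω, u * (cs.wordProd ω * cs.simple i * (cs.wordProd ω)⁻¹) ≠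
      (cs.wordProd ω * cs.simple i * (cs.wordProd ω)⁻¹) * u →
      c u ≤ c (cs.wordProd ω * cs.simple i * (cs.wordProd ω)⁻¹)) →
    ∃ ω', Relation.ReflTransGen (CommMove cs) (ω ++ [i]) ω' ∧
      (cs.leftInvSeq ω').Perm (cs.leftInvSeq (ω ++ [i])) ∧
      (cs.leftInvSeq ω').Pairwise (fun t t' => c t ≤ c t') := by
  intro k
  induction k with
  | zero =>
    intro ω i h0 _ _
    obtain rfl := List.length_eq_zero_iff.1 h0
    refine ⟨_, Relation.ReflTransGen.refl, List.Perm.refl _, ?_⟩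
    rw [lis_app]; simp
  | succ k ih =>
    intro ω i hl hs hc
    obtain ⟨ω1, j, rfl⟩ : ∃ ω1 j, ω = ω1 ++ [j] := by
      rcases List.eq_nil_or_concat ω with h | ⟨l, b, h⟩
      · simp [h] at hl
      · exact ⟨l, b, by simpa using h⟩
    set x := cs.wordProd ω1 with hx
    have hw : cs.wordProd (ω1 ++ [j]) = x * cs.simple j := by
      rw [cs.wordProd_append, cs.wordProd_singleton]
    rw [lis_app] at hs
    rw [hw] at hc
    set t := x * cs.simple j * cs.simple i * (x * cs.simple j)⁻¹ with ht
    rw [lis_app, ← hx] at hc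
    set u := x * cs.simple j * x⁻¹ with hu
    rw [List.pairwise_append] at hs
    obtain ⟨hs1, _, hs3⟩ := hs
    simp only [List.mem_singleton, forall_eq] at hs3
    have ii : cs.simple i * cs.simple i = 1 := cs.simple_mul_simple_self i
    have jj : cs.simple j * cs.simple j = 1 := cs.simple_mul_simple_self j
    by_cases hle : c u ≤ c t
    · refine ⟨_, Relation.ReflTransGen.refl, List.Perm.refl _, ?_⟩
      rw [lis_app, lis_app, hw, ← ht, ← hx, ← hu, List.pairwise_append, List.pairwise_append]
      refine ⟨⟨hs1, by simp, by simpa using hs3⟩, by simp, ?_⟩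
      intro a ha b hb
      simp only [List.mem_append, List.mem_singleton] at ha hb
      rcases ha with ha | ha
      · rw [hb]; exact (hs3 a ha).trans hle
      · rw [ha, hb]; exact hle
    · have hut : u * t = t * u := by
        by_contra h
        exact hle (hc u (by simp) h)
      have hij : cs.simple i * cs.simple j = cs.simple j * cs.simple i := by
        have ji : (cs.simple j)⁻¹ = cs.simple j := cs.inv_simple j
        have e1 : u * t = x * (cs.simple i * cs.simple j) * x⁻¹ := by
          rw [hu, ht, mul_inv_rev, ji]
          calc _ = x * ((cs.simple j * cs.simple j) * cs.simple i * cs.simple j) * x⁻¹ := by group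
            _ = _ := by rw [jj]; group
        have e2 : t * u = x * (cs.simple j * cs.simple i) * x⁻¹ := by
          rw [hu, ht, mul_inv_rev, ji]
          calc _ = x * (cs.simple j * cs.simple i * (cs.simple j * cs.simple j)) * x⁻¹ := by group
            _ = _ := by rw [jj]; group
        rw [e1, e2] at hut
        simpa using hut
      have ht2 : x * cs.simple i * x⁻¹ = t := by
        rw [ht, mul_assoc x (cs.simple j), ← hij]; group
      have hu2 : x * cs.simple i * cs.simple j * (x * cs.simple i)⁻¹ = u := by
        rw [hu, mul_assoc x (cs.simple i), hij]; group
      obtain ⟨ω2, r1, r2, r3⟩ := ih ω1 i (by simpa using hl) hs1 (by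
        rw [← hx, ht2]
        intro v hv
        exact hc v (by simp [hv]))
      have r4 := (comm_prod r1).1
      rw [cs.wordProd_append, cs.wordProd_singleton, ← hx] at r4
      rw [lis_app, ← hx, ht2] at r2
      refine ⟨ω2 ++ [j], ?_, ?_, ?_⟩
      · refine Relation.ReflTransGen.head (b := ω1 ++ [i] ++ [j]) ?_ (comm_app r1 [j])
        exact ⟨ω1, [], j, i, hij.symm, by simp, by simp⟩
      · rw [lis_app, lis_app, lis_app, hw, r4, hu2, ← ht, ← hx, ← hu]
        refine (r2.append_right _).trans ?_
        rw [List.append_assoc, List.append_assoc]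
        exact List.Perm.append_left _ (List.Perm.swap _ _ _)
      · rw [lis_app, r4, hu2, List.pairwise_append]
        refine ⟨r3, by simp, ?_⟩
        intro a ha b hb
        rw [List.mem_singleton] at hb
        rw [r2.mem_iff, List.mem_append, List.mem_singleton] at ha
        rw [hb]
        rcases ha with ha | ha
        · exact hs3 a ha
        · rw [ha]; omega

theorem sort_word (c : W → ℕ) (ω : List B) 
    (h : (cs.leftInvSeq ω).Pairwise (fun t t' => t * t' ≠ t' * t → c t ≤ c t')) :
    ∃ ω', Relation.ReflTransGen (CommMove cs) ω ω' ∧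
      (cs.leftInvSeq ω').Perm (cs.leftInvSeq ω) ∧
      (cs.leftInvSeq ω').Pairwise (fun t t' => c t ≤ c t') := by
  induction ω using List.reverseRecOn with
  | nil => exact ⟨[], Relation.ReflTransGen.refl, List.Perm.refl _, by simp⟩
  | append_singleton ω i ih =>
    rw [lis_app, List.pairwise_append] at h
    obtain ⟨h1, _, h3⟩ := h
    obtain ⟨ω1, r1, r2, r3⟩ := ih h1
    have r4 := (comm_prod r1).1
    obtain ⟨ω2, q1, q2, q3⟩ := sort_ins c _ ω1 i rfl r3 (by
      rw [r4]
      intro u hu hne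
      exact h3 u (r2.mem_iff.1 hu) _ (by simp) hne)
    refine ⟨ω2, (comm_app r1 [i]).trans q1, q2.trans ?_, q3⟩
    rw [lis_app, lis_app, r4]
    exact r2.append_right _

theorem comm_square (hw₀ : ∀ w : W, cs.length w ≤ cs.length w₀) {ω ω' : List B} (hr : cs.IsReduced ω)
    (h : CommMove cs ω ω') :
    SquareMove (weakLE cs) (chainOf cs 1 ω) (chainOf cs 1 ω') := by
  obtain ⟨l, r, i, j, hc, rfl, rfl⟩ := h
  have jj : cs.simple j * cs.simple j = 1 := cs.simple_mul_simple_self j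
  have ii : cs.simple i * cs.simple i = 1 := cs.simple_mul_simple_self i
  have hne : cs.simple i ≠ cs.simple j := by
    intro e
    have h1 : cs.wordProd (l ++ i :: j :: r) = cs.wordProd (l ++ r) := by
      simp only [cs.wordProd_append, cs.wordProd_cons]
      rw [← mul_assoc (cs.simple i), e, jj, one_mul]
    have h2 := cs.length_wordProd_le (l ++ r)
    rw [← h1, hr] at h2
    simp at h2
  have hm : orderOf (cs.simple i * cs.simple j) = 2 := by
    refine orderOf_eq_prime ?_ ?_
    · rw [pow_two]
      nth_rewrite 2 [hc]
      rw [mul_assoc, ← mul_assoc (cs.simple j), jj, one_mul, ii]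
    · intro e
      apply hne
      have : cs.simple i = cs.simple i * cs.simple j * cs.simple j := by rw [mul_assoc, jj, mul_one]
      rw [this, e, one_mul]
  have a0 : ∀ a b : W, alt a b 0 = 1 := fun _ _ => rfl
  have a1 : ∀ a b : W, alt a b 1 = a := fun a b => by simp [alt]
  have a2 : ∀ a b : W, alt a b 2 = a * b := fun a b => by simp [alt]
  set x := cs.wordProd l with hx
  have p0 : cs.length x = l.length := by
    have := hr.take l.length
    rw [List.take_left] at this; exact this
  have p2 : cs.length (x * (cs.simple i * cs.simple j)) = l.length + 2 := by
    have := hr.take (l.length + 2)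
    have e : List.take (l.length + 2) (l ++ i :: j :: r) = l ++ [i, j] := by
      rw [List.take_append]; simp
    rw [e] at this
    have h2 := this
    unfold CoxeterSystem.IsReduced at h2
    rw [cs.wordProd_append] at h2
    simpa [cs.wordProd_cons] using h2
  have hp : Pol cs x i j := ⟨hne, by rw [hm, a2, p2, p0]⟩
  have E := hp.E2
  have N := hp.ncard4.2 hc
  rw [hm] at E N
  have take1 : ∀ (i j : B) k, cs.wordProd ((l ++ i :: j :: r).take k) =
      if k ≤ l.length then cs.wordProd (l.take k) else if k = l.length + 1 then x * cs.simple i else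
        x * (cs.simple i * cs.simple j) * cs.wordProd (r.take (k - l.length - 2)) := by
    intro i j k
    split_ifs with h1 h2
    · rw [List.take_append_of_le_length h1]
    · rw [h2, List.take_append, List.take_of_length_le (by omega)]; simp [cs.wordProd_append, hx]
    · obtain ⟨p, rfl⟩ : ∃ p, k = l.length + 2 + p := ⟨k - l.length - 2, by omega⟩
      rw [List.take_append]
      have e1 : l.length + 2 + p - l.length = p + 2 := by omega
      have e2 : l.length + 2 + p - l.length - 2 = p := by omega
      rw [e1, List.take_of_length_le (by omega)]
      simp only [Nat.add_sub_cancel, List.take_succ_cons, cs.wordProd_append, cs.wordProd_cons]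
      rw [← hx]; group
  have mem : ∀ (i j : B) z, z ∈ chainOf cs 1 (l ++ i :: j :: r) ↔ z = x * cs.simple i ∨
      (∃ k ≤ l.length, z = cs.wordProd (l.take k)) ∨ (∃ k ≤ r.length, z = x * (cs.simple i * cs.simple j) * cs.wordProd (r.take k)) := by
    intro i j z
    constructor
    · rintro ⟨k, hk, rfl⟩
      rw [one_mul, take1]
      simp only [List.length_append, List.length_cons] at hk
      split_ifs with h1 h2
      · right; left; exact ⟨k, h1, rfl⟩
      · left; rfl
      · right; right; exact ⟨_, by omega, rfl⟩
    · rintro (rfl | ⟨k, hk, rfl⟩ | ⟨k, hk, rfl⟩)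
      · exact ⟨l.length + 1, by simp, by rw [one_mul, take1]; simp⟩
      · exact ⟨k, by simp; omega, by rw [one_mul, take1]; simp [hk]⟩
      · refine ⟨k + l.length + 2, by simp; omega, ?_⟩
        rw [one_mul, take1, if_neg (by omega), if_neg (by omega)]
        congr 3
        congr 1
        omega
  have smem : ∀ (a b z : W), z ∈ side x a b 2 ↔ z = x ∨ z = x * a ∨ z = x * (a * b) := by
    intro a b z
    constructor
    · rintro ⟨k, hk, rfl⟩
      interval_cases k
      · simp [a0]
      · simp [a1]
      · simp [a2]
    · rintro (rfl | rfl | rfl)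
      · exact ⟨0, by omega, by simp [a0]⟩
      · exact ⟨1, by omega, by simp [a1]⟩
      · exact ⟨2, by omega, by simp [a2]⟩
  have q1 : cs.length (x * cs.simple i) = l.length + 1 := by
    have := hp.prefLen (k := 1) (by omega)
    rwa [a1, p0] at this
  have q2 : cs.length (x * cs.simple j) = l.length + 1 := by
    have := hp.symm.prefLen (k := 1) (by rw [(dih_simple hne).ord]; omega)
    rwa [a1, p0] at this
  have lenA : ∀ z, (∃ k ≤ l.length, z = cs.wordProd (l.take k)) → cs.length z ≤ l.length := by
    rintro z ⟨k, hk, rfl⟩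
    have := cs.length_wordProd_le (l.take k)
    rw [List.length_take] at this; omega
  have lenB : ∀ z, (∃ k ≤ r.length, z = x * (cs.simple i * cs.simple j) * cs.wordProd (r.take k)) → l.length + 2 ≤ cs.length z := by
    rintro z ⟨k, hk, rfl⟩
    have h1 := hr.take (k + l.length + 2)
    unfold CoxeterSystem.IsReduced at h1
    rw [take1, if_neg (by omega), if_neg (by omega)] at h1
    have e : k + l.length + 2 - l.length - 2 = k := by omega
    rw [e] at h1
    rw [h1, List.length_take]
    simp only [List.length_append, List.length_cons]; omega
  refine ⟨x, _, _, _, E, N, ?_, ?_, ?_⟩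
  · intro z hz
    rw [smem] at hz
    rw [mem]
    rcases hz with h | h | h
    · right; left; exact ⟨l.length, le_rfl, by simp [h, hx]⟩
    · left; exact h
    · right; right; exact ⟨0, by omega, by simp [h]⟩
  · intro z hz
    rw [smem] at hz
    rw [mem]
    rcases hz with h | h | h
    · right; left; exact ⟨l.length, le_rfl, by simp [h, hx]⟩
    · left; exact h
    · right; right; exact ⟨0, by omega, by simp [h]⟩
  · ext z
    rw [Set.mem_sdiff, Set.mem_sdiff, mem, mem, smem, smem, ← hc]
    constructor
    · rintro ⟨h | h | h, h'⟩
      · exact absurd (Or.inr (Or.inl h)) h'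
      · refine ⟨Or.inr (Or.inl h), ?_⟩
        rintro (g | g | g)
        · exact h' (Or.inl g)
        · have := lenA z h; rw [g] at this; omega
        · exact h' (Or.inr (Or.inr g))
      · refine ⟨Or.inr (Or.inr h), ?_⟩
        rintro (g | g | g)
        · exact h' (Or.inl g)
        · have := lenB z h; rw [g] at this; omega
        · exact h' (Or.inr (Or.inr g))
    · rintro ⟨h | h | h, h'⟩
      · exact absurd (Or.inr (Or.inl h)) h'
      · refine ⟨Or.inr (Or.inl h), ?_⟩
        rintro (g | g | g)
        · exact h' (Or.inl g)
        · have := lenA z h; rw [g] at this; omega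
        · exact h' (Or.inr (Or.inr g))
      · refine ⟨Or.inr (Or.inr h), ?_⟩
        rintro (g | g | g)
        · exact h' (Or.inl g)
        · have := lenB z h; rw [g] at this; omega
        · exact h' (Or.inr (Or.inr g))

theorem comm_sq (hw₀ : ∀ w : W, cs.length w ≤ cs.length w₀) {ω ω' : List B} (hr : cs.IsReduced ω)
    (h : Relation.ReflTransGen (CommMove cs) ω ω') :
    cs.IsReduced ω' ∧ SqEquiv (weakLE cs) (chainOf cs 1 ω) (chainOf cs 1 ω') := by
  induction h with
  | refl => exact ⟨hr, Relation.ReflTransGen.refl⟩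
  | tail _ h ih =>
    refine ⟨?_, ih.2.tail (comm_square hw₀ ih.1 h)⟩
    have := comm_prod (Relation.ReflTransGen.single h)
    unfold CoxeterSystem.IsReduced
    rw [this.1, this.2]; exact ih.1

theorem lis_pairwise {ω : List B} (hr : cs.IsReduced ω) (P : W → W → Prop)
    (h : ∀ t t', cs.IsReflection t → cs.IsReflection t' → bef cs (chainOf cs 1 ω) t t' → P t t') :
    (cs.leftInvSeq ω).Pairwise P := by
  rw [List.pairwise_iff_getElem]
  intro p q hp hq hpq
  have hn : ∀ t ∈ cs.leftInvSeq ω, n cs (cs.wordProd ω) t = 1 := fun t ht => (n_word_reduced cs hr t).2 ht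
  refine h _ _ (n_lt cs (hn _ (List.getElem_mem hp))).1 (n_lt cs (hn _ (List.getElem_mem hq))).1 ?_
  refine (seq_iff_bef hr (hn _ (List.getElem_mem hq))).1 ⟨p, q, hpq, ?_, ?_⟩ <;> simp

theorem lis_chain {ω ω' : List B} (hr : cs.IsReduced ω) (hr' : cs.IsReduced ω')
    (h : cs.leftInvSeq ω = cs.leftInvSeq ω') : chainOf cs 1 ω = chainOf cs 1 ω' := by
  have hl : ω.length = ω'.length := by
    have := congrArg List.length h
    simpa using this
  have e : ∀ k, cs.wordProd (ω.take k) = cs.wordProd (ω'.take k) := by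
    intro k
    refine le_anti (cs := cs) (le_iff.2 fun t => ?_) (le_iff.2 fun t => ?_)
    · rw [n_pref hr, n_pref hr', h]; exact id
    · rw [n_pref hr, n_pref hr', h]; exact id
  ext z
  constructor
  · rintro ⟨k, hk, rfl⟩; exact ⟨k, by omega, by rw [e]⟩
  · rintro ⟨k, hk, rfl⟩; exact ⟨k, by omega, by rw [e]⟩

theorem exists_max {t t' : W} (ht : cs.IsReflection t) (ht' : cs.IsReflection t') (hne : t * t' ≠ t' * t) :
    ∃ D, IsMaxDihedralSubgroup cs D ∧ IsNonCommutative cs D ∧ t ∈ D ∧ t' ∈ D := by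
  obtain ⟨D, hle, hD⟩ := (Set.toFinite {D : Subgroup W | IsDihedralSubgroup cs D}).exists_le_maximal
    (a := Subgroup.closure {t, t'}) ⟨t, t', ht, ht', rfl⟩
  have m1 : t ∈ D := hle (Subgroup.subset_closure (by simp))
  have m2 : t' ∈ D := hle (Subgroup.subset_closure (by simp))
  exact ⟨D, ⟨hD.1, fun D' h1 h2 => le_antisymm h2 (hD.2 h1 h2)⟩, ⟨t, t', ht, ht', m1, m2, hne⟩, m1, m2⟩

theorem lemma1 (hw₀ : ∀ w : W, cs.length w ≤ cs.length w₀) (hr₀ : cs.IsReduced ω₀) (hp₀ : cs.wordProd ω₀ = w₀)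
    {C E : Set W} (hC : IsMaxChain (weakLE cs) C) (hE : IsMaxChain (weakLE cs) E)
    (h : invSubgroups cs ω₀ C = invSubgroups cs ω₀ E) : SqEquiv (weakLE cs) C E := by
  classical
  obtain ⟨ω, r, p, e⟩ := maxChain_word hw₀ hC
  obtain ⟨ω', r', p', e'⟩ := maxChain_word hw₀ hE
  have hmem : ∀ t, t ∈ cs.leftInvSeq ω ↔ t ∈ cs.leftInvSeq ω' := by
    intro t
    rw [← n_word_reduced cs r, ← n_word_reduced cs r', p, p']
  have hperm : (cs.leftInvSeq ω).Perm (cs.leftInvSeq ω') :=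
    (List.perm_ext_iff_of_nodup r.nodup_leftInvSeq r'.nodup_leftInvSeq).2 hmem
  obtain ⟨ω1, q1, q2, q3⟩ := sort_word (cs := cs) (fun t => (cs.leftInvSeq ω').idxOf t) ω
    (lis_pairwise r _ (by
      intro t t' ht ht' hb hne
      obtain ⟨D, hD, hn, m1, m2⟩ := exists_max ht ht' hne
      have hA := (inv_congr hw₀ hr₀ hp₀ hC hE hD hn).1 (by rw [h])
      have hb' := hA t m1 t' m2 ht ht' (by rw [e]; exact hb)
      rw [e'] at hb'
      have := (seq_iff_bef r' (by rw [p']; exact n_top hw₀ ht')).2 hb'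
      obtain ⟨a, b, hab, h1, h2⟩ := this
      obtain ⟨l1, g1⟩ := List.getElem?_eq_some_iff.1 h1
      obtain ⟨l2, g2⟩ := List.getElem?_eq_some_iff.1 h2
      rw [← g1, ← g2, r'.nodup_leftInvSeq.idxOf_getElem, r'.nodup_leftInvSeq.idxOf_getElem]
      omega))
  obtain ⟨s1, s2⟩ := comm_sq hw₀ r q1
  have hs : (cs.leftInvSeq ω').Pairwise
      (fun t t' => (cs.leftInvSeq ω').idxOf t ≤ (cs.leftInvSeq ω').idxOf t') := by
    rw [List.pairwise_iff_getElem]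
    intro p q hp hq hpq
    rw [r'.nodup_leftInvSeq.idxOf_getElem, r'.nodup_leftInvSeq.idxOf_getElem]; omega
  have heq : cs.leftInvSeq ω1 = cs.leftInvSeq ω' := by
    refine List.Perm.eq_of_pairwise ?_ q3 hs (q2.trans hperm)
    intro a b ha hb h1 h2
    have ha' := (q2.trans hperm).mem_iff.1 ha
    exact (List.idxOf_inj ha').1 (le_antisymm h1 h2)
  rw [e, e', ← lis_chain s1 r' heq]
  exact s2

end I
end MG

set_option linter.unusedSectionVars false
namespace MG
section J
variable {B : Type*} {W : Type*} [Group W] {M : CoxeterMatrix B} {cs : CoxeterSystem M W} [Finite W]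
variable {i j : B} {w₀ : W} {ω₀ : List B}

theorem alt_cj (x a b : W) (k : ℕ) : alt (x⁻¹ * a * x) (x⁻¹ * b * x) k = x⁻¹ * alt a b k * x := by
  induction k generalizing a b with
  | zero => simp [alt]
  | succ k ih => simp only [alt]; rw [ih]; group

theorem R_noncomm {a b : W} (ha : a * a = 1) (hb : b * b = 1) (h : a * b ≠ b * a) (k : ℕ) :
    R a b k * R a b (k + 1) ≠ R a b (k + 1) * R a b k := by
  induction k generalizing a b with
  | zero =>
    intro e
    apply h
    have e0 : R a b 0 = a := by simp [R]
    have e1 : R a b 1 = a * b * a := by simp [R]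
    rw [zero_add, e0, e1] at e
    have l : a * (a * b * a) = b * a := by
      calc a * (a * b * a) = (a * a) * b * a := by group
        _ = _ := by rw [ha]; group
    have r : a * b * a * a = a * b := by rw [mul_assoc, ha, mul_one]
    rw [l, r] at e
    exact e.symm
  | succ k ih =>
    intro e
    refine ih hb ha h.symm ?_
    rw [R_succ k, R_succ (k + 1)] at e
    have l : ∀ u v : W, a * u * a * (a * v * a) = a * (u * v) * a := by
      intro u v
      calc _ = a * u * (a * a) * v * a := by group
        _ = _ := by rw [ha]; group
    rw [l, l] at e
    simpa using e

theorem block {D : Subgroup W} {a b : W} (h : Dih cs D a b) {c : W → ℕ}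
    (hcD : ∀ k < orderOf (a * b), c (R a b k) = k + 1)
    (hcn : ∀ t, cs.IsReflection t → t ∉ D → c t = 0 ∨ c t = orderOf (a * b) + 1)
    {C : Set W} {X : ℕ → W} (hX : ∀ k, X k ∈ C) (hn : ∀ k t, n cs (X k) t = 1 ↔ cs.IsReflection t ∧ c t ≤ k) :
    ∃ x i j, Pol cs x i j ∧ side x (cs.simple i) (cs.simple j) (orderOf (cs.simple i * cs.simple j)) ⊆ C ∧
      cs.simple i = x⁻¹ * a * x ∧ cs.simple j = x⁻¹ * b * x := by
  have h2 := h.two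
  have step : ∀ k < orderOf (a * b), X (k + 1) = R a b k * X k ∧
      (∃ i, X (k + 1) = X k * cs.simple i) ∧ cs.length (X (k + 1)) = cs.length (X k) + 1 := by
    intro k hk
    have hle : weakLE cs (X k) (X (k + 1)) := le_iff.2 fun t ht => by
      rw [hn] at ht ⊢; exact ⟨ht.1, by omega⟩
    have hR : n cs (X (k + 1)) (R a b k) = 1 := (hn _ _).2 ⟨h.R_refl k, by rw [hcD k hk]⟩
    have hR' : ¬ n cs (X k) (R a b k) = 1 := by rw [hn, hcD k hk]; omega
    have hne : X k ≠ X (k + 1) := by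
      intro e; rw [← e] at hR; exact hR' hR
    obtain ⟨i, l1, l2, l3⟩ := exists_up hle hne
    have hcov := cov_n (cov_iff (cs := cs).2 ⟨i, rfl, l3⟩)
    set t := X k * cs.simple i * (X k)⁻¹ with ht
    have ht1 := le_iff.1 l2 _ hcov.2
    have htR : t = R a b k := by
      have q1 := (hn _ _).1 ht1
      have q2 : ¬ (cs.IsReflection t ∧ c t ≤ k) := by
        rw [← hn, hcov.1]; decide
      have q3 : c t = k + 1 := by
        have : ¬ c t ≤ k := fun q => q2 ⟨q1.1, q⟩
        omega
      by_cases hm : t ∈ D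
      · obtain ⟨p, hp, e⟩ := h.refl_R hm q1.1
        rw [e, hcD p hp] at q3
        rw [e]; congr 1; omega
      · rcases hcn t q1.1 hm with e | e <;> omega
    have heq : X k * cs.simple i = X (k + 1) := by
      refine le_anti l2 (le_iff.2 fun u hu => ?_)
      by_cases hu1 : n cs (X k) u = 1
      · exact le_iff.1 l1 _ hu1
      · have q1 := (hn _ _).1 hu
        have q2 : ¬ c u ≤ k := fun q => hu1 ((hn _ _).2 ⟨q1.1, q⟩)
        have q3 : c u = k + 1 := by omega
        have : u = R a b k := by
          by_cases hm : u ∈ D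
          · obtain ⟨p, hp, e⟩ := h.refl_R hm q1.1
            rw [e, hcD p hp] at q3
            rw [e]; congr 1; omega
          · rcases hcn u q1.1 hm with e | e <;> omega
        rw [this, ← htR]; exact hcov.2
    refine ⟨?_, ⟨i, heq.symm⟩, by rw [← heq]; exact l3⟩
    rw [← heq, ← htR, ht]; group
  have hXalt : ∀ k, k ≤ orderOf (a * b) → X k = alt a b k * X 0 ∧ cs.length (X k) = cs.length (X 0) + k := by
    intro k
    induction k with
    | zero => intro _; simp [alt]
    | succ k ih =>
      intro hk
      obtain ⟨s1, _, s3⟩ := step k (by omega)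
      obtain ⟨i1, i2⟩ := ih (by omega)
      refine ⟨?_, by omega⟩
      rw [s1, i1, ← alt_conj h.aa h.bb]; group
  obtain ⟨s1, ⟨i, hi⟩, _⟩ := step 0 (by omega)
  obtain ⟨s2, ⟨j, hj⟩, _⟩ := step 1 (by omega)
  rw [zero_add] at s1 hi
  have e0 : R a b 0 = a := by simp [R]
  have hi' : cs.simple i = (X 0)⁻¹ * a * X 0 := by
    have : X 0 * cs.simple i = a * X 0 := by rw [← hi, s1, e0]
    rw [mul_assoc, ← this]; group
  have hj' : cs.simple j = (X 0)⁻¹ * b * X 0 := by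
    have q := (hXalt 2 (by omega)).1
    have a2 : alt a b 2 = a * b := by simp [alt]
    rw [a2] at q
    have : a * X 0 * cs.simple j = a * b * X 0 := by
      rw [← q, hj, s1, e0]
    have h3 : X 0 * cs.simple j = b * X 0 := by
      rw [mul_assoc, mul_assoc] at this; exact mul_left_cancel this
    rw [mul_assoc, ← h3]; group
  have hord : orderOf (cs.simple i * cs.simple j) = orderOf (a * b) := by
    have : cs.simple i * cs.simple j = MulAut.conj (X 0)⁻¹ (a * b) := by
      rw [hi', hj', MulAut.conj_apply]; group
    rw [this]
    exact MulEquiv.orderOf_eq _ _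
  have hside : ∀ k ≤ orderOf (a * b), X 0 * alt (cs.simple i) (cs.simple j) k = X k := by
    intro k hk
    rw [hi', hj', alt_cj, (hXalt k hk).1]; group
  refine ⟨X 0, i, j, ⟨?_, ?_⟩, ?_, hi', hj'⟩
  · intro e
    apply h.ne
    rw [hi', hj'] at e
    simpa using e
  · rw [hord, hside _ le_rfl]; exact (hXalt _ le_rfl).2
  · rintro z ⟨k, hk, rfl⟩
    rw [hord] at hk
    rw [hside k hk]; exact hX k

theorem sorted_cut (c : W → ℕ) (v : ℕ) : ∀ L : List W, L.Pairwise (fun t t' => c t ≤ c t') →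
    ∃ p ≤ L.length, ∀ t, t ∈ L.take p ↔ t ∈ L ∧ c t ≤ v := by
  intro L
  induction L with
  | nil => intro _; exact ⟨0, by simp, by simp⟩
  | cons a L ih =>
    intro h
    rw [List.pairwise_cons] at h
    by_cases ha : c a ≤ v
    · obtain ⟨p, hp, hh⟩ := ih h.2
      refine ⟨p + 1, by simpa using hp, fun t => ?_⟩
      rw [List.take_succ_cons, List.mem_cons, List.mem_cons, hh]
      constructor
      · rintro (rfl | h)
        · exact ⟨Or.inl rfl, ha⟩
        · exact ⟨Or.inr h.1, h.2⟩
      · rintro ⟨rfl | h, h'⟩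
        · exact Or.inl rfl
        · exact Or.inr ⟨h, h'⟩
    · refine ⟨0, by simp, fun t => ?_⟩
      simp only [List.take_zero, List.not_mem_nil, List.mem_cons, false_iff, not_and]
      rintro (rfl | h')
      · exact ha
      · have := h.1 t h'; omega

theorem inc_build (hw₀ : ∀ w : W, cs.length w ≤ cs.length w₀) (hr₀ : cs.IsReduced ω₀) (hp₀ : cs.wordProd ω₀ = w₀)
    {C : Set W} (hC : IsMaxChain (weakLE cs) C) {x : W} (hp : Pol cs x i j)
    (hs : side x (cs.simple i) (cs.simple j) (orderOf (cs.simple i * cs.simple j)) ⊆ C)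
    (hnc : cs.simple i * cs.simple j ≠ cs.simple j * cs.simple i)
    (hb : ∀ k, k + 1 < orderOf (cs.simple i * cs.simple j) →
      bef cs (chainOf cs 1 ω₀) (x * R (cs.simple i) (cs.simple j) k * x⁻¹) (x * R (cs.simple i) (cs.simple j) (k+1) * x⁻¹)) :
    ∃ C', IncPolygonMove (weakLE cs) (fun u w => w * u⁻¹) (heapLt cs ω₀) C C' ∧ Opp cs (polD cs x i j) C C' := by
  have hd := dih_simple hp.ne
  set P₁ := side x (cs.simple i) (cs.simple j) (orderOf (cs.simple i * cs.simple j)) with hP1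
  set P₂ := side x (cs.simple j) (cs.simple i) (orderOf (cs.simple i * cs.simple j)) with hP2
  have hE := hp.E2
  have hdis : ∀ z ∈ C, z ∈ P₂ → z ∈ P₁ := by
    intro z hz hz2
    obtain ⟨_, m1, m2, _⟩ := hE
    have := m1.2.2 (insert z P₁) (Set.insert_subset (m2.1 hz2) m1.1)
      (hC.1.mono (Set.insert_subset hz hs)) (Set.subset_insert _ _)
    exact this.symm.subset (Set.mem_insert _ _)
  have hdiff : C \ P₁ = ((C \ P₁) ∪ P₂) \ P₂ := by
    ext z
    simp only [Set.mem_sdiff, Set.mem_union]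
    constructor
    · rintro ⟨h1, h2⟩
      exact ⟨Or.inl ⟨h1, h2⟩, fun h => h2 (hdis z h1 h)⟩
    · rintro ⟨h | h, h'⟩
      · exact h
      · exact absurd h h'
  have hsub : P₂ ⊆ (C \ P₁) ∪ P₂ := Set.subset_union_right
  refine ⟨(C \ P₁) ∪ P₂, ⟨x, _, P₁, P₂, hE, ?_, hs, hsub, hdiff, ?_⟩, ?_⟩
  · rw [Ne, hp.ncard4]; exact hnc
  · have hlab : ∀ k, x * alt (cs.simple i) (cs.simple j) (k+1) * (x * alt (cs.simple i) (cs.simple j) k)⁻¹ =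
        x * R (cs.simple i) (cs.simple j) k * x⁻¹ := by
      intro k
      rw [← alt_conj hd.aa hd.bb]; group
    have hheap : ∀ p q, p < q → q < orderOf (cs.simple i * cs.simple j) →
        heapLt cs ω₀ (x * R (cs.simple i) (cs.simple j) p * x⁻¹) (x * R (cs.simple i) (cs.simple j) q * x⁻¹) := by
      intro p q hpq
      have one : ∀ k, k + 1 < orderOf (cs.simple i * cs.simple j) →
          heapLt cs ω₀ (x * R (cs.simple i) (cs.simple j) k * x⁻¹) (x * R (cs.simple i) (cs.simple j) (k+1) * x⁻¹) := by
        intro k hk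
        obtain ⟨u, v, huv, g1, g2⟩ := (seq_iff_bef hr₀ (by rw [hp₀]; exact n_top hw₀ ((hd.R_refl _).conj x))).2 (hb k hk)
        refine Relation.TransGen.single ⟨u, v, huv, g1, g2, fun e => ?_⟩
        refine R_noncomm hd.aa hd.bb hnc k ?_
        have : x * (R (cs.simple i) (cs.simple j) k * R (cs.simple i) (cs.simple j) (k+1)) * x⁻¹ =
            x * (R (cs.simple i) (cs.simple j) (k+1) * R (cs.simple i) (cs.simple j) k) * x⁻¹ := by
          calc _ = _ := by group
            _ = _ := e
            _ = _ := by group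
        simpa using this
      induction q, hpq using Nat.le_induction with
      | base => exact one p
      | succ q hq ih => 
        intro h
        exact Relation.TransGen.trans (ih (by omega)) (one q h)
    rintro _ _ _ _ ⟨p, hp1, rfl⟩ ⟨p', hp2, rfl⟩ ⟨q, hq1, rfl⟩ ⟨q', hq2, rfl⟩ c1 c2 hle
    have l1 := hp.prefLen hp1
    have l2 := hp.prefLen hp2
    have l3 := hp.prefLen hq1
    have l4 := hp.prefLen hq2
    obtain ⟨_, _, k1⟩ := cov_iff.1 c1
    obtain ⟨_, _, k2⟩ := cov_iff.1 c2
    have k3 := le_len hle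
    have e1 : p' = p + 1 := by omega
    have e2 : q' = q + 1 := by omega
    subst e1 e2
    simp only
    rw [hlab, hlab]
    exact hheap p q (by omega) (by omega)
  · intro t ht t' ht' hr hr' hb
    exact bef_in hC.1 hp hs hsub ht ht' hr hr' hb

theorem lemma2 (hw₀ : ∀ w : W, cs.length w ≤ cs.length w₀) (hr₀ : cs.IsReduced ω₀) (hp₀ : cs.wordProd ω₀ = w₀)
    {C C' : Set W} (hC : IsMaxChain (weakLE cs) C) (hC' : IsMaxChain (weakLE cs) C')
    {D : Subgroup W} (hD : IsMaxDihedralSubgroup cs D) (hDn : IsNonCommutative cs D)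
    (hni : D ∉ invSubgroups cs ω₀ C) (hins : invSubgroups cs ω₀ C' = insert D (invSubgroups cs ω₀ C)) :
    ∃ C1 C2, SqEquiv (weakLE cs) C C1 ∧
      IncPolygonMove (weakLE cs) (fun u w => w * u⁻¹) (heapLt cs ω₀) C1 C2 ∧ SqEquiv (weakLE cs) C2 C' := by
  classical
  have h0 := word_maxChain hw₀ hr₀ hp₀
  have hOpp : Opp cs D C C' := by
    rcases dich hw₀ hD.1 hDn hC hC' with h | h
    · exfalso
      have := (inv_congr hw₀ hr₀ hp₀ hC hC' hD hDn).2 h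
      exact hni (this.2 (by rw [hins]; exact Set.mem_insert _ _))
    · exact h
  have persist : ∀ u v, cs.IsReflection u → cs.IsReflection v → u * v ≠ v * u → ¬ (u ∈ D ∧ v ∈ D) →
      bef cs C u v → bef cs C' u v := by
    intro u v hu hv hne hnD hb
    obtain ⟨E, hE, hEn, m1, m2⟩ := exists_max hu hv hne
    refine (inv_congr hw₀ hr₀ hp₀ hC hC' hE hEn).1 ?_ u m1 v m2 hu hv hb
    rw [hins, Set.mem_insert_iff]
    have : E ≠ D := by rintro rfl; exact hnD ⟨m1, m2⟩
    simp [this]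
  have hAg := (inv_iff hw₀ hr₀ hp₀ hC hD hDn).2.1 hni
  obtain ⟨a, b, hdih, hab, hinc⟩ : ∃ a b, Dih cs D a b ∧ a * b ≠ b * a ∧
      ∀ p q, p < q → q < orderOf (a * b) → bef cs C (R a b p) (R a b q) := by
    obtain ⟨a, b, ca, cb, hne, hab⟩ := canon_exists cs hD.1 hDn
    have hd : Dih cs D a b := ⟨hD.1, ca, cb, hne⟩
    rcases hd.order hw₀ hC with h | h
    · exact ⟨a, b, hd, hab, h⟩
    · refine ⟨b, a, hd.symm, hab.symm, ?_⟩
      intro p q hpq hq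
      rw [hd.ord] at hq
      rw [hd.swap (by omega), hd.swap hq]
      exact h _ _ (by omega) (by omega)
  set m := orderOf (a * b) with hm
  set N : W → W → Prop := fun u v => cs.IsReflection u ∧ cs.IsReflection v ∧ bef cs C u v ∧ u * v ≠ v * u ∧ v ∉ D with hN
  set above : W → Prop := fun t => ∃ d ∈ D, Relation.TransGen N d t with habove
  have hpath : ∀ d t, d ∈ D → Relation.TransGen N d t → cs.IsReflection d ∧ bef cs C d t ∧ bef cs C' d t := by
    intro d t hd h
    induction h with
    | single h => exact ⟨h.1, h.2.2.1, persist _ _ h.1 h.2.1 h.2.2.2.1 (fun q => h.2.2.2.2 q.2) h.2.2.1⟩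
    | tail _ h ih =>
      exact ⟨ih.1, bef_trans hC.1 ih.2.1 h.2.2.1, bef_trans hC'.1 ih.2.2
        (persist _ _ h.1 h.2.1 h.2.2.2.1 (fun q => h.2.2.2.2 q.2) h.2.2.1)⟩
  have hidx : ∀ t, ∃ k, t ∈ D → cs.IsReflection t → k < m ∧ t = R a b k := by
    intro t
    by_cases h : t ∈ D ∧ cs.IsReflection t
    · obtain ⟨k, h1, h2⟩ := hdih.refl_R h.1 h.2
      exact ⟨k, fun _ _ => ⟨h1, h2⟩⟩
    · exact ⟨0, fun h1 h2 => absurd ⟨h1, h2⟩ h⟩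
  choose idx hidx using hidx
  set c : W → ℕ := fun t => if t ∈ D then idx t + 1 else if above t then m + 1 else 0 with hc
  have cin : ∀ t, t ∈ D → c t = idx t + 1 := fun t h => by simp [hc, h]
  have cout : ∀ t, t ∉ D → c t = if above t then m + 1 else 0 := fun t h => by simp [hc, h]
  obtain ⟨ω, r, p, e⟩ := maxChain_word hw₀ hC
  obtain ⟨ω1, q1, q2, q3⟩ := sort_word (cs := cs) c ω (lis_pairwise r _ (by
    intro t t' ht ht' hb hne
    rw [← e] at hb
    by_cases m1 : t ∈ D <;> by_cases m2 : t' ∈ D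
    · rw [cin t m1, cin t' m2]
      obtain ⟨k1, k2⟩ := hidx t m1 ht
      obtain ⟨k3, k4⟩ := hidx t' m2 ht'
      by_contra hlt
      have := hinc (idx t') (idx t) (by omega) k1
      rw [← k2, ← k4] at this
      exact bef_asymm hC.1 hb this
    · rw [cin t m1, cout t' m2, if_pos ⟨t, m1, Relation.TransGen.single ⟨ht, ht', hb, hne, m2⟩⟩]
      have := (hidx t m1 ht).1
      omega
    · rw [cout t m1, if_neg]
      · omega
      · rintro ⟨d, hd, hpd⟩
        obtain ⟨g1, g2, g3⟩ := hpath d t hd hpd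
        have g4 := bef_trans hC.1 g2 hb
        have g5 := bef_trans hC'.1 g3 (persist t t' ht ht' hne (fun q => m1 q.1) hb)
        exact bef_asymm hC'.1 g5 (hOpp d hd t' m2 g1 ht' g4)
    · rw [cout t m1, cout t' m2]
      by_cases h : above t
      · rw [if_pos h, if_pos]
        obtain ⟨d, hd, hpd⟩ := h
        exact ⟨d, hd, hpd.tail ⟨ht, ht', hb, hne, m2⟩⟩
      · rw [if_neg h]; omega))
  obtain ⟨s1, s2⟩ := comm_sq hw₀ r q1
  have p1 : cs.wordProd ω1 = w₀ := by rw [(comm_prod q1).1, p]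
  have hmem : ∀ t, t ∈ cs.leftInvSeq ω1 ↔ cs.IsReflection t := by
    intro t
    rw [← n_word_reduced cs s1, p1]
    exact ⟨fun h => (n_lt cs h).1, fun h => n_top hw₀ h⟩
  have hX : ∀ v, ∃ y ∈ chainOf cs 1 ω1, ∀ t, n cs y t = 1 ↔ cs.IsReflection t ∧ c t ≤ v := by
    intro v
    obtain ⟨k, hk, hh⟩ := sorted_cut c v _ q3
    refine ⟨cs.wordProd (ω1.take k), ⟨k, by simpa using hk, by rw [one_mul]⟩, fun t => ?_⟩
    rw [n_pref s1, hh, hmem]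
  choose X hX1 hX2 using hX
  rw [← e] at s2
  have hC1 := sq_inv hw₀ hr₀ hp₀ hC s2
  obtain ⟨x, i, j, hpol, hside, ei, ej⟩ := block hdih (c := c) (by
      intro k hk
      rw [cin _ (hdih.Rm k)]
      obtain ⟨g1, g2⟩ := hidx _ (hdih.Rm k) (hdih.R_refl k)
      rw [← R_inj hk g1 g2]) (by
      intro t _ htD
      rw [cout t htD]
      by_cases h : above t <;> simp [h, hm]) hX1 hX2
  have hRR : ∀ k, x * R (cs.simple i) (cs.simple j) k * x⁻¹ = R a b k := by
    intro k
    have h1 := (dih_simple hpol.ne)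
    rw [← alt_conj h1.aa h1.bb, ← alt_conj hdih.aa hdih.bb, ei, ej, alt_cj, alt_cj]; group
  have hord : orderOf (cs.simple i * cs.simple j) = m := by
    have : cs.simple i * cs.simple j = MulAut.conj x⁻¹ (a * b) := by
      rw [ei, ej, MulAut.conj_apply]; group
    rw [this]
    exact MulEquiv.orderOf_eq _ _
  have hpD : polD cs x i j = D := by
    have : ∀ y, y ∈ ({x * cs.simple i * x⁻¹, x * cs.simple j * x⁻¹} : Set W) ↔ y ∈ ({a, b} : Set W) := by
      have g1 : x * cs.simple i * x⁻¹ = a := by rw [ei]; group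
      have g2 : x * cs.simple j * x⁻¹ = b := by rw [ej]; group
      intro y; rw [g1, g2]
    rw [hdih.clos, ← Set.ext this]
    unfold polD
    rw [MonoidHom.map_closure]
    congr 1
    ext y
    simp [Set.image_insert_eq, Set.image_singleton, MulAut.conj_apply]
  obtain ⟨C2, hinc2, hopp2⟩ := inc_build hw₀ hr₀ hp₀ hC1.1 hpol hside (by
      intro hh
      apply hab
      rw [ei, ej] at hh
      have h3 : x⁻¹ * (a * b) * x = x⁻¹ * (b * a) * x := by
        calc _ = _ := by group
          _ = _ := hh
          _ = _ := by group
      simpa using h3) (by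
      intro k hk
      rw [hord] at hk
      rw [hRR, hRR]
      have hA' : Agree cs D C (chainOf cs 1 ω₀) := hAg.symm hw₀ h0 hC
      exact hA' _ (hdih.Rm _) _ (hdih.Rm _) (hdih.R_refl _) (hdih.R_refl _) (hinc k (k+1) (by omega) hk))
  obtain ⟨hC2, D', hD', hn', hni', hins'⟩ := inc_inv hw₀ hr₀ hp₀ hC1.1 hinc2
  refine ⟨_, C2, s2, hinc2, lemma1 hw₀ hr₀ hp₀ hC2 hC' ?_⟩
  rw [hpD] at hopp2
  rw [hC1.2.1] at hins' hni'
  have hDin : D ∈ invSubgroups cs ω₀ C2 := by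
    rw [(inv_iff hw₀ hr₀ hp₀ hC2 hD hDn).1]
    refine Agree.comp_opp ?_ hopp2
    rw [← (inv_iff hw₀ hr₀ hp₀ hC1.1 hD hDn).2, hC1.2.1]
    exact hni
  rw [hins'] at hDin
  rcases hDin with hh | hh
  · rw [hins', hins, hh]
  · exact absurd hh hni

theorem pre_inv (hw₀ : ∀ w : W, cs.length w ≤ cs.length w₀) (hr₀ : cs.IsReduced ω₀) (hp₀ : cs.wordProd ω₀ = w₀)
    {C C' : Set W} (hC : IsMaxChain (weakLE cs) C)
    (h : MGPre (weakLE cs) (fun u w => w * u⁻¹) (heapLt cs ω₀) C C') :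
    IsMaxChain (weakLE cs) C' ∧ invSubgroups cs ω₀ C ⊆ invSubgroups cs ω₀ C' := by
  induction h with
  | refl => exact ⟨hC, subset_rfl⟩
  | tail _ h ih =>
    rcases h with h | h
    · obtain ⟨a, b, _⟩ := sq_inv hw₀ hr₀ hp₀ ih.1 h
      exact ⟨a, by rw [b]; exact ih.2⟩
    · obtain ⟨a, D, _, _, _, b⟩ := inc_inv hw₀ hr₀ hp₀ ih.1 h
      exact ⟨a, by rw [b]; exact ih.2.trans (Set.subset_insert _ _)⟩

theorem pre_first (hw₀ : ∀ w : W, cs.length w ≤ cs.length w₀) (hr₀ : cs.IsReduced ω₀) (hp₀ : cs.wordProd ω₀ = w₀)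
    {C C' : Set W} 
    (h : MGPre (weakLE cs) (fun u w => w * u⁻¹) (heapLt cs ω₀) C C') :
    SqEquiv (weakLE cs) C C' ∨ ∃ C1 C2, SqEquiv (weakLE cs) C C1 ∧
      IncPolygonMove (weakLE cs) (fun u w => w * u⁻¹) (heapLt cs ω₀) C1 C2 ∧
      MGPre (weakLE cs) (fun u w => w * u⁻¹) (heapLt cs ω₀) C2 C' := by
  induction h with
  | refl => exact Or.inl Relation.ReflTransGen.refl
  | tail _ h ih =>
    rcases ih with ih | ⟨C1, C2, g1, g2, g3⟩
    · rcases h with h | h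
      · exact Or.inl (Relation.ReflTransGen.trans ih h)
      · exact Or.inr ⟨_, _, ih, h, Relation.ReflTransGen.refl⟩
    · exact Or.inr ⟨C1, C2, g1, g2, Relation.ReflTransGen.tail g3 h⟩

theorem main (hw₀ : ∀ w : W, cs.length w ≤ cs.length w₀) (hr₀ : cs.IsReduced ω₀) (hp₀ : cs.wordProd ω₀ = w₀)
    {C C' : Set W} (hC : IsMaxChain (weakLE cs) C) (hC' : IsMaxChain (weakLE cs) C') :
    MGCover (weakLE cs) (fun u w => w * u⁻¹) (heapLt cs ω₀) C C' ↔
      ∃ D, IsMaxDihedralSubgroup cs D ∧ IsNonCommutative cs D ∧ D ∉ invSubgroups cs ω₀ C ∧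
        invSubgroups cs ω₀ C' = insert D (invSubgroups cs ω₀ C) := by
  have sqpre : ∀ A E, SqEquiv (weakLE cs) A E → MGPre (weakLE cs) (fun u w => w * u⁻¹) (heapLt cs ω₀) A E :=
    fun A E h => Relation.ReflTransGen.single (Or.inl h)
  constructor
  · rintro ⟨h1, h2, h3⟩
    rcases pre_first hw₀ hr₀ hp₀ h1 with h | ⟨C1, C2, g1, g2, g3⟩
    · exact absurd (sqpre _ _ (sq_inv hw₀ hr₀ hp₀ hC h).2.2) h2
    · obtain ⟨k1, k2, k3⟩ := sq_inv hw₀ hr₀ hp₀ hC g1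
      obtain ⟨l1, D, l2, l3, l4, l5⟩ := inc_inv hw₀ hr₀ hp₀ k1 g2
      rw [k2] at l4 l5
      refine ⟨D, l2, l3, l4, ?_⟩
      have pre2 : MGPre (weakLE cs) (fun u w => w * u⁻¹) (heapLt cs ω₀) C C2 :=
        Relation.ReflTransGen.tail (sqpre _ _ g1) (Or.inr g2)
      rcases h3 C2 l1 pre2 g3 with h | h
      · exfalso
        have := (sq_inv hw₀ hr₀ hp₀ l1 h).2.1
        apply l4
        rw [this, l5]; exact Set.mem_insert _ _
      · rw [(sq_inv hw₀ hr₀ hp₀ l1 h).2.1, l5]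
  · rintro ⟨D, d1, d2, d3, d4⟩
    obtain ⟨C1, C2, g1, g2, g3⟩ := lemma2 hw₀ hr₀ hp₀ hC hC' d1 d2 d3 d4
    refine ⟨((sqpre _ _ g1).tail (Or.inr g2)).tail (Or.inl g3), ?_, ?_⟩
    · intro h
      apply d3
      apply (pre_inv hw₀ hr₀ hp₀ hC' h).2
      rw [d4]; exact Set.mem_insert _ _
    · intro E hE e1 e2
      have i1 := (pre_inv hw₀ hr₀ hp₀ hC e1).2
      have i2 := (pre_inv hw₀ hr₀ hp₀ hE e2).2
      by_cases hm : D ∈ invSubgroups cs ω₀ E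
      · right
        refine lemma1 hw₀ hr₀ hp₀ hE hC' (Set.Subset.antisymm i2 ?_)
        rw [d4]; exact Set.insert_subset hm i1
      · left
        refine lemma1 hw₀ hr₀ hp₀ hE hC (Set.Subset.antisymm ?_ i1)
        intro F hF
        have := i2 hF
        rw [d4] at this
        rcases this with h | h
        · rw [h] at hF; exact absurd hF hm
        · exact h

end J
end MG


/-- Let `(W, S)` be a finite Coxeter system, `w₀` its longest element, `ω₀` a
reduced word for `w₀`, and `≼` the partial order on square-equivalence
classes of maximal chains of the right weak order generated by increasing
polygon moves with respect to the heap poset of `ω₀`.  For maximal chains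
`C`, `C'`, the class `[C']` covers `[C]` if and only if
`inv_{ω₀}(C') = inv_{ω₀}(C) ∪ {D}` for some non-commutative maximal dihedral
reflection subgroup `D ∉ inv_{ω₀}(C)`. -/
theorem mg_cover_iff_inv_insert {B W : Type*} [Group W]
    {M : CoxeterMatrix B} (cs : CoxeterSystem M W) [Finite W]
    (w₀ : W) (hw₀ : ∀ w : W, cs.length w ≤ cs.length w₀)
    (ω₀ : List B) (hω₀ : cs.IsReduced ω₀) (hω₀p : cs.wordProd ω₀ = w₀)
    (C C' : Set W)
    (hC : IsMaxChain (weakLE cs) C) (hC' : IsMaxChain (weakLE cs) C') :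
    MGCover (weakLE cs) (fun u w => w * u⁻¹) (heapLt cs ω₀) C C' ↔
      ∃ D : Subgroup W, IsMaxDihedralSubgroup cs D ∧ IsNonCommutative cs D ∧
        D ∉ invSubgroups cs ω₀ C ∧
        invSubgroups cs ω₀ C' = insert D (invSubgroups cs ω₀ C) := by
  exact MG.main hw₀ hω₀ hω₀p hC hC'
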